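/- Let p > 1, let Ω ⊆ ℝ² be a nonempty open set and let −∞ ≤ T₁ < T₂ ≤ +∞. Then there exists C > 0 depending only on p (and not on Ω, T₁, T₂ or u) such that every nonnegative classical solution u of ∂ₜu = Δu + u^p in Ω×(T₁,T₂) satisfies u(x,t) ≤ C((t−T₁)^{−β} + (T₂−t)^{−β} + dist(x,∂Ω)^{−2β}) for all (x,t) ∈ Ω×(T₁,T₂), where β = 1/(p−1), with the conventions (t−T₁)^{−β} := 0 if T₁ = −∞, (T₂−t)^{−β} := 0 if T₂ = +∞, and dist(x,∂Ω)^{−2β} := 0 if Ω = ℝ². -/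

import Mathlib

open scoped BigOperators Classical
open Set

/-- The Laplacian of `f : ℝⁿ → ℝ` at `x`, as the sum of the second partial
derivatives in the coordinate directions. -/
noncomputable def lap {n : ℕ} (f : EuclideanSpace ℝ (Fin n) → ℝ)
    (x : EuclideanSpace ℝ (Fin n)) : ℝ :=
  ∑ i : Fin n,
    fderiv ℝ (fun y => fderiv ℝ f y (EuclideanSpace.single i 1)) x
      (EuclideanSpace.single i 1)

open MeasureTheory Filter Topology

abbrev E2 := EuclideanSpace ℝ (Fin 2)

/-- Partial derivative of `f` in the `i`-th coordinate direction. -/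
noncomputable def pd (i : Fin 2) (f : E2 → ℝ) (x : E2) : ℝ :=
  fderiv ℝ f x (EuclideanSpace.single i 1)

/-- Pointwise inner product of the gradients of `f` and `g`. -/
noncomputable def gd (f g : E2 → ℝ) (x : E2) : ℝ := ∑ i, pd i f x * pd i g x

lemma lap_eq (f : E2 → ℝ) (x : E2) : lap f x = ∑ i, pd i (pd i f) x := rfl

lemma contDiff_pd {f : E2 → ℝ} {n : WithTop ℕ∞} (hf : ContDiff ℝ (n + 1) f) (i : Fin 2) :
    ContDiff ℝ n (pd i f) :=
  (hf.fderiv_right le_rfl).clm_apply contDiff_const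

lemma contDiff_pd_one {f : E2 → ℝ} (hf : ContDiff ℝ 2 f) (i : Fin 2) : ContDiff ℝ 1 (pd i f) :=
  contDiff_pd (n := 1) (by simpa [one_add_one_eq_two] using hf) i

lemma continuous_pd {f : E2 → ℝ} (hf : ContDiff ℝ 1 f) (i : Fin 2) : Continuous (pd i f) :=
  (contDiff_pd (n := 0) (by simpa using hf) i).continuous

lemma continuous_pd' {f : E2 → ℝ} (hf : ContDiff ℝ 2 f) (i : Fin 2) : Continuous (pd i f) :=
  (contDiff_pd_one hf i).continuous

lemma continuous_gd {f g : E2 → ℝ} (hf : ContDiff ℝ 2 f) (hg : ContDiff ℝ 2 g) :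
    Continuous (gd f g) :=
  continuous_finsetSum _ fun i _ => (continuous_pd' hf i).mul (continuous_pd' hg i)

lemma continuous_lap {f : E2 → ℝ} (hf : ContDiff ℝ 2 f) : Continuous (lap f) :=
  continuous_finsetSum _ fun i _ => continuous_pd (contDiff_pd_one hf i) i

lemma pd_mul {f g : E2 → ℝ} {x : E2} (hf : DifferentiableAt ℝ f x) (hg : DifferentiableAt ℝ g x)
    (i : Fin 2) : pd i (fun y => f y * g y) x = f x * pd i g x + g x * pd i f x := by
  simp [pd, fderiv_fun_mul hf hg]

lemma pd_add {f g : E2 → ℝ} {x : E2} (hf : DifferentiableAt ℝ f x) (hg : DifferentiableAt ℝ g x)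
    (i : Fin 2) : pd i (fun y => f y + g y) x = pd i f x + pd i g x := by
  simp [pd, fderiv_fun_add hf hg]

lemma pd_sub {f g : E2 → ℝ} {x : E2} (hf : DifferentiableAt ℝ f x) (hg : DifferentiableAt ℝ g x)
    (i : Fin 2) : pd i (fun y => f y - g y) x = pd i f x - pd i g x := by
  simp [pd, fderiv_fun_sub hf hg]

lemma ContDiff.diffAt {f : E2 → ℝ} (hf : ContDiff ℝ 2 f) (x : E2) : DifferentiableAt ℝ f x :=
  (hf.differentiable (by norm_num)) x

lemma ContDiff.diffAt_pd {f : E2 → ℝ} (hf : ContDiff ℝ 2 f) (i : Fin 2) (x : E2) :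
    DifferentiableAt ℝ (pd i f) x :=
  ((contDiff_pd_one hf i).differentiable (by norm_num)) x

lemma lap_mul {f g : E2 → ℝ} (hf : ContDiff ℝ 2 f) (hg : ContDiff ℝ 2 g) (x : E2) :
    lap (fun y => f y * g y) x = f x * lap g x + 2 * gd f g x + g x * lap f x := by
  have h : ∀ i, pd i (fun y => f y * g y) = fun y => f y * pd i g y + g y * pd i f y := fun i => by
    ext y; exact pd_mul (hf.diffAt y) (hg.diffAt y) i
  simp only [lap_eq, gd, h, Finset.mul_sum, ← Finset.sum_add_distrib]
  refine Finset.sum_congr rfl fun i _ => ?_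
  rw [pd_add ((hf.diffAt x).fun_mul (hg.diffAt_pd i x)) ((hg.diffAt x).fun_mul (hf.diffAt_pd i x)),
    pd_mul (hf.diffAt x) (hg.diffAt_pd i x), pd_mul (hg.diffAt x) (hf.diffAt_pd i x)]
  ring

lemma lap_sub {f g : E2 → ℝ} (hf : ContDiff ℝ 2 f) (hg : ContDiff ℝ 2 g) (x : E2) :
    lap (fun y => f y - g y) x = lap f x - lap g x := by
  have h : ∀ i, pd i (fun y => f y - g y) = fun y => pd i f y - pd i g y := fun i => by
    ext y; exact pd_sub (hf.diffAt y) (hg.diffAt y) i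
  simp only [lap_eq, h, ← Finset.sum_sub_distrib]
  exact Finset.sum_congr rfl fun i _ => pd_sub (hf.diffAt_pd i x) (hg.diffAt_pd i x) i

lemma lap_add {f g : E2 → ℝ} (hf : ContDiff ℝ 2 f) (hg : ContDiff ℝ 2 g) (x : E2) :
    lap (fun y => f y + g y) x = lap f x + lap g x := by
  have h : ∀ i, pd i (fun y => f y + g y) = fun y => pd i f y + pd i g y := fun i => by
    ext y; exact pd_add (hf.diffAt y) (hg.diffAt y) i
  simp only [lap_eq, h, ← Finset.sum_add_distrib]
  exact Finset.sum_congr rfl fun i _ => pd_add (hf.diffAt_pd i x) (hg.diffAt_pd i x) i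

lemma gd_sub_left {f g h : E2 → ℝ} (hf : ContDiff ℝ 2 f) (hg : ContDiff ℝ 2 g) (x : E2) :
    gd (fun y => f y - g y) h x = gd f h x - gd g h x := by
  simp only [gd, ← Finset.sum_sub_distrib, pd_sub (hf.diffAt x) (hg.diffAt x), sub_mul]

lemma gd_comm (f g : E2 → ℝ) (x : E2) : gd f g x = gd g f x := by
  simp only [gd, mul_comm]

/-- `gd` only depends on germs. -/
lemma pd_congr {f g : E2 → ℝ} {x : E2} (h : f =ᶠ[𝓝 x] g) (i : Fin 2) : pd i f x = pd i g x := by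
  simp only [pd, h.fderiv_eq]

lemma lap_congr {f g : E2 → ℝ} {x : E2} (h : f =ᶠ[𝓝 x] g) : lap f x = lap g x := by
  simp only [lap_eq]
  refine Finset.sum_congr rfl fun i _ => pd_congr ?_ i
  filter_upwards [h.eventuallyEq_nhds] with y hy using pd_congr hy i

/-- `f` vanishes outside the closed ball of radius `R` about the origin. -/
def VanishOff (R : ℝ) (f : E2 → ℝ) : Prop := ∀ x, R < ‖x‖ → f x = 0

lemma VanishOff.mul_left {R : ℝ} {f : E2 → ℝ} (hf : VanishOff R f) (g : E2 → ℝ) :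
    VanishOff R (fun x => g x * f x) := fun x hx => by simp [hf x hx]

lemma VanishOff.mul_right {R : ℝ} {f : E2 → ℝ} (hf : VanishOff R f) (g : E2 → ℝ) :
    VanishOff R (fun x => f x * g x) := fun x hx => by simp [hf x hx]

lemma VanishOff.hasCompactSupport {R : ℝ} {f : E2 → ℝ} (hf : VanishOff R f) :
    HasCompactSupport f :=
  HasCompactSupport.of_support_subset_isCompact (isCompact_closedBall (0 : E2) R) fun x hx => by
    by_contra h
    exact hx (hf x (by simpa using h))

lemma VanishOff.integrable {R : ℝ} {f : E2 → ℝ} (hf : VanishOff R f) (hc : Continuous f) :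
    Integrable f :=
  hc.integrable_of_hasCompactSupport hf.hasCompactSupport

lemma VanishOff.pd {R : ℝ} {f : E2 → ℝ} (hf : VanishOff R f) (i : Fin 2) :
    VanishOff R (pd i f) := fun x hx => by
  have : f =ᶠ[𝓝 x] fun _ => 0 := by
    filter_upwards [(isOpen_lt continuous_const continuous_norm).mem_nhds hx] with y hy
      using hf y hy
  rw [pd_congr this]; simp [_root_.pd]

lemma VanishOff.gd {R : ℝ} {f : E2 → ℝ} (hf : VanishOff R f) (g : E2 → ℝ) :
    VanishOff R (gd f g) := fun x hx => by
  simp only [_root_.gd, hf.pd _ x hx, zero_mul, Finset.sum_const_zero]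

lemma VanishOff.lap {R : ℝ} {f : E2 → ℝ} (hf : VanishOff R f) : VanishOff R (lap f) :=
  fun x hx => by simp only [lap_eq, (hf.pd _).pd _ x hx, Finset.sum_const_zero]

lemma integral_mul_pd {R : ℝ} {f g : E2 → ℝ} (hf : ContDiff ℝ 1 f) (hg : ContDiff ℝ 1 g)
    (hs : VanishOff R f) (i : Fin 2) : ∫ x, f x * pd i g x = -∫ x, pd i f x * g x := by
  refine integral_mul_fderiv_eq_neg_fderiv_mul_of_integrable ?_ ?_ ?_ ?_ ?_
  · exact ((hs.pd i).mul_right g).integrable ((continuous_pd hf i).mul hg.continuous)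
  · exact (hs.mul_right _).integrable (hf.continuous.mul (continuous_pd hg i))
  · exact (hs.mul_right _).integrable (hf.continuous.mul hg.continuous)
  · exact fun x _ => hf.differentiable (by norm_num) x
  · exact fun x _ => hg.differentiable (by norm_num) x

/-- Green's first identity. -/
lemma integral_mul_lap {R : ℝ} {φ v : E2 → ℝ} (hφ : ContDiff ℝ 2 φ) (hv : ContDiff ℝ 2 v)
    (hs : VanishOff R φ) : ∫ x, φ x * lap v x = -∫ x, gd φ v x := by
  have h1 : ∀ i, Integrable fun x => φ x * pd i (pd i v) x := fun i =>
    (hs.mul_right _).integrable (hφ.continuous.mul (continuous_pd (contDiff_pd_one hv i) i))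
  have h2 : ∀ i, Integrable fun x => pd i φ x * pd i v x := fun i =>
    ((hs.pd i).mul_right _).integrable ((continuous_pd' hφ i).mul (continuous_pd' hv i))
  simp only [lap_eq, gd, Finset.mul_sum]
  rw [integral_finsetSum _ fun i _ => h1 i, integral_finsetSum _ fun i _ => h2 i,
    ← Finset.sum_neg_distrib]
  exact Finset.sum_congr rfl fun i _ =>
    integral_mul_pd (hφ.of_le (by norm_num)) (contDiff_pd_one hv i) hs i

/-- Green's second identity. -/
lemma integral_mul_lap_comm {R : ℝ} {φ v : E2 → ℝ} (hφ : ContDiff ℝ 2 φ) (hv : ContDiff ℝ 2 v)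
    (hs : VanishOff R φ) : ∫ x, φ x * lap v x = ∫ x, v x * lap φ x := by
  have h1 : ∀ i, Integrable fun x => v x * pd i (pd i φ) x := fun i =>
    (((hs.pd i).pd i).mul_left _).integrable
      (hv.continuous.mul (continuous_pd (contDiff_pd_one hφ i) i))
  have h2 : ∀ i, Integrable fun x => pd i φ x * pd i v x := fun i =>
    ((hs.pd i).mul_right _).integrable ((continuous_pd' hφ i).mul (continuous_pd' hv i))
  rw [integral_mul_lap hφ hv hs]
  simp only [lap_eq, gd, Finset.mul_sum]
  rw [integral_finsetSum _ fun i _ => h1 i, integral_finsetSum _ fun i _ => h2 i,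
    ← Finset.sum_neg_distrib]
  refine Finset.sum_congr rfl fun i _ => ?_
  rw [integral_mul_pd (contDiff_pd_one hφ i) (hv.of_le (by norm_num)) (hs.pd i), neg_neg]
  exact integral_congr_ae (ae_of_all _ fun x => mul_comm _ _)

/-- The weighted Dirichlet integral through the Laplacian. -/
lemma integral_gd_self_mul {R : ℝ} {φ v : E2 → ℝ} (hφ : ContDiff ℝ 2 φ) (hv : ContDiff ℝ 2 v)
    (hs : VanishOff R φ) :
    ∫ x, φ x * gd v v x = ∫ x, (-(φ x * (v x * lap v x)) + 1 / 2 * ((v x * v x) * lap φ x)) := by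
  have h := integral_mul_lap_comm hφ (hv.mul hv) hs
  simp only [lap_mul hv hv] at h
  have i1 : Integrable fun x => φ x * (v x * lap v x) := (hs.mul_right _).integrable
    (hφ.continuous.mul (hv.continuous.mul (continuous_lap hv)))
  have i2 : Integrable fun x => (v x * v x) * lap φ x := (hs.lap.mul_left _).integrable
    ((hv.continuous.mul hv.continuous).mul (continuous_lap hφ))
  have i3 : Integrable fun x => φ x * gd v v x := (hs.mul_right _).integrable
    (hφ.continuous.mul (continuous_gd hv hv))
  have e : ∀ x, φ x * (v x * lap v x + 2 * gd v v x + v x * lap v x)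
      = 2 * (φ x * (v x * lap v x)) + 2 * (φ x * gd v v x) := fun x => by ring
  simp only [e] at h
  rw [integral_add (i1.const_mul 2) (i3.const_mul 2), integral_const_mul, integral_const_mul] at h
  have i1' : Integrable fun x => -(φ x * (v x * lap v x)) := i1.neg
  rw [integral_add i1' (i2.const_mul _), integral_neg, integral_const_mul]
  linarith

lemma contDiffOn_two_of_hasDerivAt {h h' h'' : ℝ → ℝ} {s : Set ℝ} (hs : IsOpen s)
    (h1 : ∀ x ∈ s, HasDerivAt h (h' x) x) (h2 : ∀ x ∈ s, HasDerivAt h' (h'' x) x)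
    (h3 : ContinuousOn h'' s) : ContDiffOn ℝ 2 h s := by
  have e1 : EqOn (deriv h) h' s := fun x hx => (h1 x hx).deriv
  have e2 : EqOn (deriv h') h'' s := fun x hx => (h2 x hx).deriv
  have c1 : ContDiffOn ℝ 1 h' s := by
    have := (contDiffOn_succ_iff_deriv_of_isOpen (n := 0) (f := h') (𝕜 := ℝ) hs).2
      ⟨fun x hx => (h2 x hx).differentiableAt.differentiableWithinAt, by simp,
        contDiffOn_zero.2 (h3.congr e2)⟩
    simpa using this
  have := (contDiffOn_succ_iff_deriv_of_isOpen (n := 1) (f := h) (𝕜 := ℝ) hs).2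
      ⟨fun x hx => (h1 x hx).differentiableAt.differentiableWithinAt, by simp, c1.congr e1⟩
  simpa [one_add_one_eq_two] using this

lemma pd_normSq_comp {h : ℝ → ℝ} {d : ℝ} {x : E2} (hd : HasDerivAt h d (‖x‖ ^ 2)) (i : Fin 2) :
    pd i (fun y => h (‖y‖ ^ 2)) x = 2 * x i * d := by
  have h1 : HasFDerivAt (fun y : E2 => ‖y‖ ^ 2) (2 • innerSL ℝ x) x :=
    (hasStrictFDerivAt_norm_sq x).hasFDerivAt
  have h2 : HasFDerivAt (fun y : E2 => h (‖y‖ ^ 2)) _ x := hd.comp_hasFDerivAt x h1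
  simp only [pd]
  rw [h2.fderiv]
  simp [EuclideanSpace.inner_single_right]
  ring

lemma pd_coord (i : Fin 2) (x : E2) : pd i (fun y => y i) x = 1 := by
  have h2 : HasFDerivAt (fun y : E2 => y i) (EuclideanSpace.proj i : E2 →L[ℝ] ℝ) x :=
    (EuclideanSpace.proj i : E2 →L[ℝ] ℝ).hasFDerivAt
  simp only [pd]
  rw [h2.fderiv]
  simp

lemma sum_sq_coord (x : E2) : ∑ i, x i ^ 2 = ‖x‖ ^ 2 := by
  rw [EuclideanSpace.norm_sq_eq]; simp

/-- A radial profile: `h`, `h'`, `h''` are a `C²` function of `s = |x|²` with its derivatives. -/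
structure Profile (h h' h'' : ℝ → ℝ) : Prop where
  d1 : ∀ s > -1, HasDerivAt h (h' s) s
  d2 : ∀ s > -1, HasDerivAt h' (h'' s) s
  c : ContinuousOn h'' (Ioi (-1))

lemma neg_one_lt_normSq (x : E2) : -1 < ‖x‖ ^ 2 := by nlinarith [sq_nonneg ‖x‖]

lemma Profile.contDiff {h h' h'' : ℝ → ℝ} (H : Profile h h' h'') :
    ContDiff ℝ 2 (fun x : E2 => h (‖x‖ ^ 2)) := by
  have := contDiffOn_two_of_hasDerivAt isOpen_Ioi H.d1 H.d2 H.c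
  rw [← contDiffOn_univ]
  exact this.comp (contDiff_norm_sq ℝ).contDiffOn fun x _ => neg_one_lt_normSq x

lemma Profile.pd {h h' h'' : ℝ → ℝ} (H : Profile h h' h'') (i : Fin 2) (x : E2) :
    pd i (fun x : E2 => h (‖x‖ ^ 2)) x = 2 * x i * h' (‖x‖ ^ 2) :=
  pd_normSq_comp (H.d1 _ (neg_one_lt_normSq x)) i

lemma Profile.lap {h h' h'' : ℝ → ℝ} (H : Profile h h' h'') (x : E2) :
    lap (fun x : E2 => h (‖x‖ ^ 2)) x = 4 * ‖x‖ ^ 2 * h'' (‖x‖ ^ 2) + 4 * h' (‖x‖ ^ 2) := by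
  have e : ∀ i, _root_.pd i (fun x : E2 => h (‖x‖ ^ 2)) = fun y => (y i) * (2 * h' (‖y‖ ^ 2)) :=
    fun i => by ext y; rw [H.pd]; ring
  have hd : HasDerivAt (fun s => 2 * h' s) (2 * h'' (‖x‖ ^ 2)) (‖x‖ ^ 2) :=
    (H.d2 _ (neg_one_lt_normSq x)).const_mul 2
  have e2 : ∀ i, _root_.pd i (fun y : E2 => (y i) * (2 * h' (‖y‖ ^ 2))) x
      = x i * (2 * x i * (2 * h'' (‖x‖ ^ 2))) + 2 * h' (‖x‖ ^ 2) * 1 := fun i => by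
    have d1 : DifferentiableAt ℝ (fun y : E2 => y i) x :=
      (EuclideanSpace.proj i : E2 →L[ℝ] ℝ).differentiableAt
    have d2 : DifferentiableAt ℝ (fun y : E2 => 2 * h' (‖y‖ ^ 2)) x :=
      hd.differentiableAt.comp x
        (f := fun y : E2 => ‖y‖ ^ 2) (hasStrictFDerivAt_norm_sq x).hasFDerivAt.differentiableAt
    rw [pd_mul d1 d2, pd_coord, pd_normSq_comp (h := fun s => 2 * h' s) hd]
  simp only [lap_eq, e, e2, ← sum_sq_coord x, Fin.sum_univ_two]
  ring

lemma Profile.gd_sq_le {h h' h'' : ℝ → ℝ} (H : Profile h h' h'') (v : E2 → ℝ) (x : E2) :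
    (gd (fun x : E2 => h (‖x‖ ^ 2)) v x) ^ 2 ≤ 4 * ‖x‖ ^ 2 * h' (‖x‖ ^ 2) ^ 2 * gd v v x := by
  simp only [gd, H.pd, ← sum_sq_coord x, Fin.sum_univ_two]
  have : 0 ≤ 4 * (h' (x 0 ^ 2 + x 1 ^ 2)) ^ 2 * (x 0 * _root_.pd 1 v x - x 1 * _root_.pd 0 v x) ^ 2 := by
    positivity
  nlinarith [this]

lemma hasDerivAt_pos_pow (k : ℕ) (y : ℝ) :
    HasDerivAt (fun y : ℝ => max y 0 ^ (k + 2)) ((k + 2) * max y 0 ^ (k + 1)) y := by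
  rcases lt_trichotomy y 0 with h | h | h
  · have : (fun y : ℝ => max y 0 ^ (k + 2)) =ᶠ[𝓝 y] fun _ => 0 := by
      filter_upwards [Iio_mem_nhds h] with z hz
      simp [max_eq_right (a := z) (b := 0) (mem_Iio.1 hz).le]
    rw [max_eq_right h.le]
    simpa using (hasDerivAt_const y (0 : ℝ)).congr_of_eventuallyEq this
  · subst h
    rw [hasDerivAt_iff_isLittleO]
    have : (fun x : ℝ => x ^ (k + 2)) =o[𝓝 0] fun x => x := by
      have := Asymptotics.isLittleO_pow_pow (𝕜 := ℝ) (m := 1) (n := k + 2) (by omega)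
      simpa using this
    refine (Asymptotics.IsBigO.of_bound 1 ?_).trans_isLittleO (by simpa using this)
    filter_upwards with x
    simp only [max_self, ne_eq, Nat.add_eq_zero_iff, OfNat.ofNat_ne_zero, and_false,
      not_false_eq_true, zero_pow, sub_zero, smul_eq_mul, mul_zero, norm_pow, one_mul,
      one_ne_zero]
    gcongr
    rcases le_total x 0 with h | h
    · simp [max_eq_right h]
    · simp [max_eq_left h]
  · have : (fun y : ℝ => max y 0 ^ (k + 2)) =ᶠ[𝓝 y] fun y => y ^ (k + 2) := by
      filter_upwards [Ioi_mem_nhds h] with z hz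
      simp [max_eq_left (a := z) (b := 0) (mem_Ioi.1 hz).le]
    rw [max_eq_left h.le]
    have h2 := (hasDerivAt_pow (k + 2) y).congr_of_eventuallyEq this
    exact h2.congr_deriv (by push_cast; simp)

/-- The profile of the bump `(1 - |x|²/ρ)₊ ^ m`. -/
lemma bump_profile (k : ℕ) (ρ : ℝ) :
    Profile (fun s => max (1 - s / ρ) 0 ^ (k + 3))
      (fun s => (k + 3) * max (1 - s / ρ) 0 ^ (k + 2) * (-(1 / ρ)))
      (fun s => (k + 3) * ((k + 2) * max (1 - s / ρ) 0 ^ (k + 1) * (-(1 / ρ))) * (-(1 / ρ))) where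
  d1 s _ := by
    have h := (hasDerivAt_pos_pow (k + 1) (1 - s / ρ)).comp s
      (((hasDerivAt_id s).div_const ρ).const_sub 1)
    exact h.congr_deriv (by push_cast; ring)
  d2 s _ := by
    have h := (((hasDerivAt_pos_pow k (1 - s / ρ)).comp s
      (((hasDerivAt_id s).div_const ρ).const_sub 1)).const_mul ((k : ℝ) + 3)).mul_const (-(1 / ρ))
    exact h.congr_deriv (by ring)
  c := by fun_prop

/-- The bump function `(1 - |x|²/ρ)₊ ^ m`. -/
noncomputable def bump (m : ℕ) (ρ : ℝ) (x : E2) : ℝ := max (1 - ‖x‖ ^ 2 / ρ) 0 ^ m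

lemma bump_nonneg (m : ℕ) (ρ : ℝ) (x : E2) : 0 ≤ bump m ρ x := by unfold bump; positivity

lemma bump_le_one (m : ℕ) {ρ : ℝ} (hρ : 0 < ρ) (x : E2) : bump m ρ x ≤ 1 := by
  unfold bump
  exact pow_le_one₀ (by positivity) (max_le (by
    have : 0 ≤ ‖x‖ ^ 2 / ρ := by positivity
    linarith) zero_le_one)

lemma bump_contDiff (k : ℕ) (ρ : ℝ) : ContDiff ℝ 2 (bump (k + 3) ρ) :=
  (bump_profile k ρ).contDiff

lemma bump_continuous (m : ℕ) (ρ : ℝ) : Continuous (bump m ρ) := by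
  unfold bump; fun_prop

lemma bump_vanish (m : ℕ) (hm : m ≠ 0) {R : ℝ} (hR : 0 < R) : VanishOff R (bump m (R ^ 2)) := by
  intro x hx
  have : 1 ≤ ‖x‖ ^ 2 / R ^ 2 := by
    rw [one_le_div (by positivity)]; gcongr
  simp [bump, max_eq_right (show 1 - ‖x‖ ^ 2 / R ^ 2 ≤ 0 by linarith), hm]

lemma le_bump (m : ℕ) {ρ r : ℝ} (hρ : 0 < ρ) (hr : r ≤ ρ) {x : E2} (hx : ‖x‖ ^ 2 ≤ r) :
    (1 - r / ρ) ^ m ≤ bump m ρ x := by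
  unfold bump
  have h : ‖x‖ ^ 2 / ρ ≤ r / ρ := by gcongr
  have h2 : r / ρ ≤ 1 := (div_le_one hρ).2 hr
  exact pow_le_pow_left₀ (by linarith) (le_max_of_le_left (by linarith)) m

lemma lap_bump (k : ℕ) {ρ : ℝ} (hρ : 0 < ρ) (x : E2) :
    lap (bump (k + 3) ρ) x = 4 * ‖x‖ ^ 2 / ρ * ((k + 3) * (k + 2)) / ρ * bump (k + 1) ρ x
      - 4 * (k + 3) / ρ * bump (k + 2) ρ x := by
  have := (bump_profile k ρ).lap x
  refine this.trans ?_
  simp only [bump]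
  field_simp
  ring

lemma abs_lap_bump_le (k : ℕ) {ρ : ℝ} (hρ : 0 < ρ) (x : E2) :
    |lap (bump (k + 3) ρ) x| ≤ 4 * (k + 3) ^ 2 / ρ * bump (k + 1) ρ x := by
  rw [lap_bump k hρ]
  by_cases h : ‖x‖ ^ 2 / ρ ≤ 1
  · have q0 : max (1 - ‖x‖ ^ 2 / ρ) 0 = 1 - ‖x‖ ^ 2 / ρ := max_eq_left (by linarith)
    have q1 : 0 ≤ ‖x‖ ^ 2 / ρ := by positivity
    have b1 := bump_nonneg (k + 1) ρ x
    have e : bump (k + 2) ρ x = (1 - ‖x‖ ^ 2 / ρ) * bump (k + 1) ρ x := by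
      simp only [bump, q0]; ring
    rw [e]
    have e2 : 4 * ‖x‖ ^ 2 / ρ * ((k + 3) * (k + 2)) / ρ * bump (k + 1) ρ x
      - 4 * (k + 3) / ρ * ((1 - ‖x‖ ^ 2 / ρ) * bump (k + 1) ρ x)
      = (4 * (k + 3) / ρ * bump (k + 1) ρ x) * ((‖x‖ ^ 2 / ρ) * (k + 2) - (1 - ‖x‖ ^ 2 / ρ)) := by
      field_simp
    have e3 : 4 * ((k : ℝ) + 3) ^ 2 / ρ * bump (k + 1) ρ x
      = (4 * (k + 3) / ρ * bump (k + 1) ρ x) * (k + 3) := by ring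
    rw [e2, e3, abs_mul, abs_of_nonneg (by positivity)]
    gcongr
    have hk : (0 : ℝ) ≤ k := by positivity
    rw [abs_le]
    constructor <;> nlinarith
  · have h1 : ∀ j : ℕ, bump (j + 1) ρ x = 0 := fun j => by
      have : max (1 - ‖x‖ ^ 2 / ρ) 0 = 0 := max_eq_right (by linarith)
      simp [bump, this]
    rw [h1 k, h1 (k + 1)]; simp

lemma lap_bump_three_ge {ρ : ℝ} (hρ : 0 < ρ) (x : E2) :
    -(27 / ρ) * bump 3 ρ x ≤ lap (bump 3 ρ) x := by
  rw [lap_bump 0 hρ]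
  by_cases h : ‖x‖ ^ 2 / ρ ≤ 1
  · have q0 : max (1 - ‖x‖ ^ 2 / ρ) 0 = 1 - ‖x‖ ^ 2 / ρ := max_eq_left (by linarith)
    simp only [bump, q0]
    have q2 : 0 ≤ 1 - ‖x‖ ^ 2 / ρ := by linarith
    set q := 1 - ‖x‖ ^ 2 / ρ with hq
    have e : 4 * ‖x‖ ^ 2 / ρ = 4 * (1 - q) := by rw [hq]; ring
    rw [e]
    have : 4 * (1 - q) * (((0 : ℕ) + 3) * ((0 : ℕ) + 2)) / ρ * q ^ (0 + 1)
        - 4 * ((0 : ℕ) + 3) / ρ * q ^ (0 + 2) - -(27 / ρ) * q ^ 3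
      = q * (27 * (q - 2 / 3) ^ 2 + 12) / ρ := by push_cast; ring
    have h2 : 0 ≤ q * (27 * (q - 2 / 3) ^ 2 + 12) / ρ := by positivity
    linarith
  · have h1 : ∀ j : ℕ, bump (j + 1) ρ x = 0 := fun j => by
      have : max (1 - ‖x‖ ^ 2 / ρ) 0 = 0 := max_eq_right (by linarith)
      simp [bump, this]
    rw [h1 0, h1 1, h1 2]; simp

lemma continuousOn_integral_of_vanish {F : E2 → ℝ → ℝ} {I : Set ℝ} {R M : ℝ}
    (hx : ∀ t ∈ I, Continuous fun x => F x t) (ht : ∀ x, ContinuousOn (F x) I)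
    (hM : ∀ x, ∀ t ∈ I, |F x t| ≤ M) (hs : ∀ t ∈ I, VanishOff R fun x => F x t) :
    ContinuousOn (fun t => ∫ x, F x t) I := by
  refine continuousOn_of_dominated (bound := (Metric.closedBall (0 : E2) R).indicator fun _ => M)
    (fun t h => (hx t h).aestronglyMeasurable) (fun t h => ae_of_all _ fun x => ?_) ?_
    (ae_of_all _ ht)
  · by_cases hxR : x ∈ Metric.closedBall (0 : E2) R
    · simpa [indicator_of_mem hxR] using hM x t h
    · simp [indicator_of_notMem hxR, hs t h x (by simpa using hxR)]
  · exact (integrable_indicator_iff measurableSet_closedBall).2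
      (integrableOn_const (measure_closedBall_lt_top.ne))

/-- Differentiation under the integral at one point, with a Lipschitz bound. -/
lemma hasDerivAt_integral_of_vanish {F : E2 → ℝ → ℝ} {D : E2 → ℝ} {t R M : ℝ}
    (hx : ∀ᶠ s in 𝓝 t, Continuous fun x => F x s) (hD : Continuous D)
    (hd : ∀ x, HasDerivAt (F x) (D x) t)
    (hM : ∀ᶠ s in 𝓝 t, ∀ x, |F x s - F x t| ≤ M * |s - t|)
    (hs : ∀ᶠ s in 𝓝 t, VanishOff R fun x => F x s) :
    HasDerivAt (fun t => ∫ x, F x t) (∫ x, D x) t := by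
  obtain ⟨ε, hε, hb⟩ := Metric.eventually_nhds_iff_ball.1 (hx.and (hM.and hs))
  have h0 := hb t (Metric.mem_ball_self hε)
  have key := hasFDerivAt_integral_of_dominated_loc_of_lip' (μ := (volume : Measure E2))
    (F := fun s x => F x s) (F' := fun x => ContinuousLinearMap.toSpanSingleton ℝ (D x))
    (x₀ := t) (s := Metric.ball t ε)
    (bound := (Metric.closedBall (0 : E2) R).indicator fun _ => M)
    (Metric.ball_mem_nhds t hε) (fun s h => (hb s h).1.aestronglyMeasurable)
    (h0.2.2.integrable h0.1) ?_ (ae_of_all _ fun x s h => ?_)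
    ((integrable_indicator_iff measurableSet_closedBall).2
      (integrableOn_const (measure_closedBall_lt_top.ne)))
    (ae_of_all _ fun x => (hd x).hasFDerivAt)
  · refine key.2.hasDerivAt.congr_deriv ?_
    rw [ContinuousLinearMap.integral_apply key.1]
    simp
  · exact ((ContinuousLinearMap.toSpanSingletonCLE (𝕜 := ℝ) (E := ℝ)).continuous.comp
      hD).aestronglyMeasurable
  · by_cases hxR : x ∈ Metric.closedBall (0 : E2) R
    · simpa [indicator_of_mem hxR] using (hb s h).2.1 x
    · have hxR' : R < ‖x‖ := by simpa using hxR
      have e1 : F x s = 0 := (hb s h).2.2 x hxR'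
      have e2 : F x t = 0 := h0.2.2 x hxR'
      simp [indicator_of_notMem hxR, e1, e2]

/-- `v` is `C²` in space, `C¹` in time with derivative `v'`; both functions
are supported in a fixed ball and bounded. -/
structure GReg (v v' : E2 → ℝ → ℝ) (a b R M : ℝ) : Prop where
  c2 : ∀ t ∈ Ioo a b, ContDiff ℝ 2 fun x => v x t
  c0 : ∀ t ∈ Ioo a b, Continuous fun x => v' x t
  der : ∀ x, ∀ t ∈ Ioo a b, HasDerivAt (v x) (v' x t) t
  ct : ∀ x, ContinuousOn (v' x) (Ioo a b)
  bd : ∀ x, ∀ t ∈ Ioo a b, |v x t| ≤ M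
  bd' : ∀ x, ∀ t ∈ Ioo a b, |v' x t| ≤ M
  van : ∀ t ∈ Ioo a b, VanishOff R fun x => v x t
  van' : ∀ t ∈ Ioo a b, VanishOff R fun x => v' x t

section
variable {v v' : E2 → ℝ → ℝ} {a b R M : ℝ}

lemma GReg.ctv (h : GReg v v' a b R M) (x : E2) : ContinuousOn (v x) (Ioo a b) :=
  fun t ht => (h.der x t ht).continuousAt.continuousWithinAt

lemma GReg.cx (h : GReg v v' a b R M) {t : ℝ} (ht : t ∈ Ioo a b) : Continuous fun x => v x t :=
  (h.c2 t ht).continuous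

lemma GReg.mono (h : GReg v v' a b R M) {a' b' : ℝ} (ha : a ≤ a') (hb : b' ≤ b) :
    GReg v v' a' b' R M := by
  have hs : Ioo a' b' ⊆ Ioo a b := Ioo_subset_Ioo ha hb
  exact ⟨fun t ht => h.c2 t (hs ht), fun t ht => h.c0 t (hs ht), fun x t ht => h.der x t (hs ht),
    fun x => (h.ct x).mono hs, fun x t ht => h.bd x t (hs ht), fun x t ht => h.bd' x t (hs ht),
    fun t ht => h.van t (hs ht), fun t ht => h.van' t (hs ht)⟩

lemma abs_sub_le_of_hasDerivAt {f f' : ℝ → ℝ} {a b M : ℝ}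
    (hf : ∀ t ∈ Ioo a b, HasDerivAt f (f' t) t) (hM : ∀ t ∈ Ioo a b, |f' t| ≤ M) {s t : ℝ}
    (hs : s ∈ Ioo a b) (ht : t ∈ Ioo a b) : |f s - f t| ≤ M * |s - t| :=
  (convex_Ioo a b).norm_image_sub_le_of_norm_hasDerivWithin_le
    (fun x hx => (hf x hx).hasDerivWithinAt) hM ht hs

lemma GReg.lip (h : GReg v v' a b R M) (x : E2) {s t : ℝ} (hs : s ∈ Ioo a b) (ht : t ∈ Ioo a b) :
    |v x s - v x t| ≤ M * |s - t| :=
  abs_sub_le_of_hasDerivAt (h.der x) (h.bd' x) hs ht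

/-- Derivative of a weighted integral with a time-dependent weight. -/
lemma GReg.hasDerivAt_integral (h : GReg v v' a b R M) {φ φ' : E2 → ℝ → ℝ} {T : ℝ}
    (hφ : ContinuousOn (fun q : E2 × ℝ => φ q.1 q.2) (univ ×ˢ Iio T))
    (hφ' : ContinuousOn (fun q : E2 × ℝ => φ' q.1 q.2) (univ ×ˢ Iio T))
    (hd : ∀ x, ∀ t < T, HasDerivAt (φ x) (φ' x t) t) {t : ℝ} (ht : t ∈ Ioo a b) (htT : t < T) :
    HasDerivAt (fun t => ∫ x, v x t * φ x t) (∫ x, (v' x t * φ x t + v x t * φ' x t)) t := by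
  obtain ⟨c, hc1, hc2⟩ := exists_between ht.1
  obtain ⟨d, hd1, hd2⟩ := exists_between (lt_min ht.2 htT)
  have hdb : d < b := hd2.trans_le (min_le_left _ _)
  have hdT : d < T := hd2.trans_le (min_le_right _ _)
  have hsub : Ioo c d ⊆ Ioo a b := Ioo_subset_Ioo hc1.le hdb.le
  have htcd : t ∈ Ioo c d := ⟨hc2, hd1⟩
  have hK : IsCompact (Metric.closedBall (0 : E2) R ×ˢ Icc c d) :=
    (isCompact_closedBall _ _).prod isCompact_Icc
  have hKs : (Metric.closedBall (0 : E2) R ×ˢ Icc c d) ⊆ univ ×ˢ Iio T := fun q hq =>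
    ⟨trivial, hq.2.2.trans_lt hdT⟩
  obtain ⟨B, hB⟩ := hK.exists_bound_of_continuousOn (hφ.mono hKs)
  obtain ⟨B', hB'⟩ := hK.exists_bound_of_continuousOn (hφ'.mono hKs)
  have hM0 : 0 ≤ M := (abs_nonneg _).trans (h.bd 0 t ht)
  have cφ : ∀ s < T, Continuous fun x => φ x s := fun s hs =>
    hφ.comp_continuous (Continuous.prodMk continuous_id continuous_const) fun x => ⟨trivial, hs⟩
  have cφ' : ∀ s < T, Continuous fun x => φ' x s := fun s hs =>
    hφ'.comp_continuous (Continuous.prodMk continuous_id continuous_const) fun x => ⟨trivial, hs⟩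
  have hn : ∀ᶠ s in 𝓝 t, s ∈ Ioo c d := Ioo_mem_nhds hc2 hd1
  refine hasDerivAt_integral_of_vanish (R := R) (M := M * |B| + M * |B'|) ?_ ?_ ?_ ?_ ?_
  · filter_upwards [hn] with s hs
    exact (h.cx (hsub hs)).mul (cφ s (hs.2.trans hdT))
  · exact ((h.c0 t ht).mul (cφ t htT)).add ((h.cx ht).mul (cφ' t htT))
  · exact fun x => (h.der x t ht).mul (hd x t htT)
  · filter_upwards [hn] with s hs x
    by_cases hx : ‖x‖ ≤ R
    · have hf : ∀ r ∈ Ioo c d, HasDerivAt (fun r => v x r * φ x r)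
          (v' x r * φ x r + v x r * φ' x r) r := fun r hr =>
        (h.der x r (hsub hr)).mul (hd x r (hr.2.trans hdT))
      refine abs_sub_le_of_hasDerivAt hf (fun r hr => ?_) hs htcd
      have q : (x, r) ∈ Metric.closedBall (0 : E2) R ×ˢ Icc c d :=
        ⟨by simpa using hx, Ioo_subset_Icc_self hr⟩
      refine (abs_add_le _ _).trans ?_
      rw [abs_mul, abs_mul]
      have e1 := h.bd' x r (hsub hr)
      have e2 := h.bd x r (hsub hr)
      have e3 : |φ x r| ≤ |B| := (hB _ q).trans (le_abs_self _)
      have e4 : |φ' x r| ≤ |B'| := (hB' _ q).trans (le_abs_self _)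
      gcongr
    · have e1 := h.van s (hsub hs) x (not_le.1 hx)
      have e2 := h.van t ht x (not_le.1 hx)
      simp only at e1 e2
      rw [e1, e2]; simp; positivity
  · filter_upwards [hn] with s hs
    exact (h.van s (hsub hs)).mul_right _

lemma GReg.hasDerivAt_integral_const (h : GReg v v' a b R M) {φ : E2 → ℝ} (hφ : Continuous φ)
    {t : ℝ} (ht : t ∈ Ioo a b) :
    HasDerivAt (fun t => ∫ x, v x t * φ x) (∫ x, v' x t * φ x) t := by
  have := h.hasDerivAt_integral (φ := fun x _ => φ x) (φ' := fun _ _ => 0) (T := t + 1)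
    (by fun_prop) (by fun_prop) (fun x _ _ => hasDerivAt_const _ _) ht (by linarith)
  simpa using this

lemma GReg.integrable_mul (h : GReg v v' a b R M) {φ : E2 → ℝ} (hφ : Continuous φ)
    {t : ℝ} (ht : t ∈ Ioo a b) : Integrable fun x => v x t * φ x :=
  ((h.van t ht).mul_right _).integrable ((h.cx ht).mul hφ)

lemma GReg.integrable_mul' (h : GReg v v' a b R M) {φ : E2 → ℝ} (hφ : Continuous φ)
    {t : ℝ} (ht : t ∈ Ioo a b) : Integrable fun x => v' x t * φ x :=
  ((h.van' t ht).mul_right _).integrable ((h.c0 t ht).mul hφ)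

lemma GReg.green (h : GReg v v' a b R M) {φ : E2 → ℝ} (hφ : ContDiff ℝ 2 φ)
    {t : ℝ} (ht : t ∈ Ioo a b) :
    ∫ x, lap (fun y => v y t) x * φ x = ∫ x, v x t * lap φ x := by
  rw [integral_mul_lap_comm (h.c2 t ht) hφ (h.van t ht)]
  exact integral_congr_ae (ae_of_all _ fun x => mul_comm _ _)

lemma GReg.integrable_lap_mul (h : GReg v v' a b R M) {φ : E2 → ℝ} (hφ : Continuous φ)
    {t : ℝ} (ht : t ∈ Ioo a b) : Integrable fun x => lap (fun y => v y t) x * φ x :=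
  ((h.van t ht).lap.mul_right _).integrable ((continuous_lap (h.c2 t ht)).mul hφ)

lemma GReg.continuousOn_integral (h : GReg v v' a b R M) {φ : E2 → ℝ} (hφ : Continuous φ) :
    ContinuousOn (fun t => ∫ x, v x t * φ x) (Ioo a b) := fun _ ht =>
  (h.hasDerivAt_integral_const hφ ht).continuousAt.continuousWithinAt

end

/-- The (unnormalised) heat kernel profile in the plane, as a function of `s = |x|²`. -/
noncomputable def hk (s θ : ℝ) : ℝ := θ⁻¹ * Real.exp (-(s / (4 * θ)))

lemma hk_pos (s : ℝ) {θ : ℝ} (hθ : 0 < θ) : 0 < hk s θ := by unfold hk; positivity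

lemma hk_deriv_s (s θ : ℝ) : HasDerivAt (fun s => hk s θ) (-(1 / (4 * θ)) * hk s θ) s := by
  have := ((((hasDerivAt_id s).div_const (4 * θ)).neg).exp).const_mul θ⁻¹
  refine this.congr_deriv ?_
  simp only [hk, Pi.neg_apply, id]; ring

lemma hk_deriv_θ (s : ℝ) {θ : ℝ} (hθ : 0 < θ) :
    HasDerivAt (fun θ => hk s θ) ((s / (4 * θ ^ 2) - 1 / θ) * hk s θ) θ := by
  have h4 : HasDerivAt (fun θ : ℝ => s / (4 * θ)) (-(s / (4 * θ ^ 2))) θ := by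
    have := ((hasDerivAt_inv hθ.ne').const_mul (s / 4))
    refine (this.congr_of_eventuallyEq ?_).congr_deriv ?_
    · exact Eventually.of_forall fun y => by simp; ring
    · field_simp
  have := (hasDerivAt_inv hθ.ne').mul h4.neg.exp
  refine this.congr_deriv ?_
  simp only [hk, Pi.neg_apply]; field_simp; ring

lemma hk_continuousOn {T : ℝ} :
    ContinuousOn (fun q : E2 × ℝ => hk (‖q.1‖ ^ 2) (T - q.2)) (univ ×ˢ Iio T) := by
  have h0 : ∀ q ∈ (univ : Set E2) ×ˢ Iio T, T - q.2 ≠ 0 := fun q hq =>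
    (sub_pos.2 (mem_Iio.1 hq.2)).ne'
  have h1 : ∀ q ∈ (univ : Set E2) ×ˢ Iio T, 4 * (T - q.2) ≠ 0 := fun q hq =>
    mul_ne_zero (by norm_num) (h0 q hq)
  unfold hk
  fun_prop (disch := assumption)

lemma hk_le (s : ℝ) (hs : 0 ≤ s) {θ : ℝ} (hθ : 0 < θ) : hk s θ ≤ 1 / θ := by
  unfold hk
  rw [one_div]
  have : Real.exp (-(s / (4 * θ))) ≤ 1 := by
    rw [Real.exp_le_one_iff]; have : 0 ≤ s / (4 * θ) := by positivity
    linarith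
  have h2 : 0 < θ⁻¹ := by positivity
  nlinarith

lemma hk_integral {θ : ℝ} (hθ : 0 < θ) :
    Integrable (fun x : E2 => hk (‖x‖ ^ 2) θ) ∧ ∫ x : E2, hk (‖x‖ ^ 2) θ = 4 * Real.pi := by
  have hb : 0 < 1 / (4 * θ) := by positivity
  have e : (fun x : E2 => hk (‖x‖ ^ 2) θ)
      = fun x => θ⁻¹ * Real.exp (-(1 / (4 * θ)) * ‖x‖ ^ 2) := by
    ext x; unfold hk; congr 2; ring
  have h := GaussianFourier.integral_rexp_neg_mul_sq_norm (V := E2) hb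
  have hi : Integrable (fun x : E2 => Real.exp (-(1 / (4 * θ)) * ‖x‖ ^ 2)) := by
    by_contra hc
    rw [integral_undef hc] at h
    have : 0 < (Real.pi / (1 / (4 * θ))) ^ ((Module.finrank ℝ E2 : ℝ) / 2) := by positivity
    linarith
  rw [e]
  refine ⟨hi.const_mul _, ?_⟩
  rw [integral_const_mul, h]
  simp
  field_simp

lemma tendsto_hk_integral {w : E2 → ℝ → ℝ} {a T R M : ℝ} (haT : a < T)
    (hc : ∀ t ∈ Ioc a T, Continuous fun x => w x t)
    (hv : ∀ t ∈ Ioc a T, VanishOff R fun x => w x t)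
    (hl : ∀ x, ∀ t ∈ Ioc a T, |w x t - w x T| ≤ M * |t - T|) :
    Tendsto (fun t => ∫ x, w x t * hk (‖x‖ ^ 2) (T - t)) (𝓝[<] T)
      (𝓝 (4 * Real.pi * w 0 T)) := by
  have hT : T ∈ Ioc a T := ⟨haT, le_rfl⟩
  have hfin : Module.finrank ℝ E2 = 2 := by simp
  have hdec : Tendsto (fun x : E2 => ‖x‖ ^ Module.finrank ℝ E2 * ((4 * Real.pi)⁻¹ * hk (‖x‖ ^ 2) 1))
      (Bornology.cobounded E2) (𝓝 0) := by
    have hA : Tendsto (fun x : E2 => ‖x‖ ^ 2 / 4) (Bornology.cobounded E2) atTop :=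
      ((tendsto_pow_atTop two_ne_zero).comp tendsto_norm_cobounded_atTop).atTop_div_const
        (by norm_num)
    have hB := ((Real.tendsto_pow_mul_exp_neg_atTop_nhds_zero 1).comp hA).const_mul Real.pi⁻¹
    rw [mul_zero] at hB
    refine hB.congr fun x => ?_
    simp only [hfin, hk, Function.comp, inv_one, mul_one, one_mul, pow_one]
    field_simp
  have h1 := tendsto_integral_comp_smul_smul_of_integrable' (μ := (volume : Measure E2))
    (φ := fun x : E2 => (4 * Real.pi)⁻¹ * hk (‖x‖ ^ 2) 1) (g := fun x => w x T) (x₀ := 0)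
    (fun x => mul_nonneg (by positivity) (hk_pos _ one_pos).le)
    (by rw [integral_const_mul, (hk_integral one_pos).2]; field_simp) hdec
    ((hv T hT).integrable (hc T hT)) (hc T hT).continuousAt
  have hcθ : Tendsto (fun t => (√(T - t))⁻¹) (𝓝[<] T) atTop := by
    have h0 : Tendsto (fun t => √(T - t)) (𝓝[<] T) (𝓝[>] 0) := by
      refine tendsto_nhdsWithin_iff.2 ⟨?_, ?_⟩
      · have : Continuous fun t => √(T - t) := by fun_prop
        simpa using (this.tendsto T).mono_left nhdsWithin_le_nhds
      · filter_upwards [self_mem_nhdsWithin] with t ht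
        exact mem_Ioi.2 (Real.sqrt_pos.2 (sub_pos.2 ht))
    exact tendsto_inv_nhdsGT_zero.comp h0
  have h2 := (h1.comp hcθ).const_mul (4 * Real.pi)
  have h3 : Tendsto (fun t => ∫ x, w x T * hk (‖x‖ ^ 2) (T - t)) (𝓝[<] T)
      (𝓝 (4 * Real.pi * w 0 T)) := by
    refine h2.congr' ?_
    filter_upwards [self_mem_nhdsWithin] with t ht
    have h0 : 0 < T - t := sub_pos.2 ht
    simp only [Function.comp]
    rw [← integral_const_mul]
    refine integral_congr_ae (ae_of_all _ fun x => ?_)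
    have hq : √(T - t) ^ 2 = T - t := Real.sq_sqrt h0.le
    simp only [hk, hfin, zero_sub, norm_neg, smul_eq_mul, norm_smul, norm_inv,
      Real.norm_of_nonneg (Real.sqrt_nonneg _), mul_pow, inv_pow, hq, inv_one, one_mul, mul_one]
    have e1 : (T - t)⁻¹ * ‖x‖ ^ 2 / 4 = ‖x‖ ^ 2 / (4 * (T - t)) := by field_simp
    rw [e1]; field_simp
  have h4 : Tendsto (fun t => ∫ x, (w x t - w x T) * hk (‖x‖ ^ 2) (T - t)) (𝓝[<] T) (𝓝 0) := by
    have hb : Tendsto (fun t => M * |t - T| * (4 * Real.pi)) (𝓝[<] T) (𝓝 0) := by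
      have : Continuous fun t => M * |t - T| * (4 * Real.pi) := by fun_prop
      simpa using (this.tendsto T).mono_left nhdsWithin_le_nhds
    refine squeeze_zero_norm' ?_ hb
    filter_upwards [Ioo_mem_nhdsLT haT] with t ht
    have h0 : 0 < T - t := sub_pos.2 ht.2
    obtain ⟨hi, he⟩ := hk_integral h0
    rw [← he, ← integral_const_mul]
    refine norm_integral_le_of_norm_le (hi.const_mul _) (ae_of_all _ fun x => ?_)
    rw [norm_mul, Real.norm_eq_abs, Real.norm_of_nonneg (hk_pos _ h0).le]
    exact mul_le_mul_of_nonneg_right (hl x t ⟨ht.1, ht.2.le⟩) (hk_pos _ h0).le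
  have h5 := h4.add h3
  rw [zero_add] at h5
  refine h5.congr' ?_
  filter_upwards [Ioo_mem_nhdsLT haT] with t ht
  have h0 : 0 < T - t := sub_pos.2 ht.2
  have ck : Continuous fun x : E2 => hk (‖x‖ ^ 2) (T - t) := by unfold hk; fun_prop
  have i1 : Integrable fun x => w x t * hk (‖x‖ ^ 2) (T - t) :=
    ((hv t ⟨ht.1, ht.2.le⟩).mul_right _).integrable ((hc t ⟨ht.1, ht.2.le⟩).mul ck)
  have i2 : Integrable fun x => w x T * hk (‖x‖ ^ 2) (T - t) :=
    ((hv T hT).mul_right _).integrable ((hc T hT).mul ck)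
  simp only [sub_mul]
  rw [integral_sub i1 i2]; ring

lemma sub_le_integral_of_hasDerivAt {f f' g : ℝ → ℝ} {s t : ℝ} (hst : s ≤ t)
    (hf : ∀ τ ∈ Icc s t, HasDerivAt f (f' τ) τ) (hg : ContinuousOn g (Icc s t))
    (h : ∀ τ ∈ Icc s t, f' τ ≤ g τ) : f t - f s ≤ ∫ τ in s..t, g τ :=
  intervalIntegral.sub_le_integral_of_hasDeriv_right_of_le hst
    (fun τ hτ => (hf τ hτ).continuousAt.continuousWithinAt)
    (fun τ hτ => (hf τ (Ioo_subset_Icc_self hτ)).hasDerivWithinAt)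
    (hg.integrableOn_Icc) (fun τ hτ => h τ (Ioo_subset_Icc_self hτ))

lemma integral_le_sub_of_hasDerivAt {f f' g : ℝ → ℝ} {s t : ℝ} (hst : s ≤ t)
    (hf : ∀ τ ∈ Icc s t, HasDerivAt f (f' τ) τ) (hg : ContinuousOn g (Icc s t))
    (h : ∀ τ ∈ Icc s t, g τ ≤ f' τ) : ∫ τ in s..t, g τ ≤ f t - f s :=
  intervalIntegral.integral_le_sub_of_hasDeriv_right_of_le hst
    (fun τ hτ => (hf τ hτ).continuousAt.continuousWithinAt)
    (fun τ hτ => (hf τ (Ioo_subset_Icc_self hτ)).hasDerivWithinAt)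
    (hg.integrableOn_Icc) (fun τ hτ => h τ (Ioo_subset_Icc_self hτ))

lemma le_of_hasDerivAt_nonneg {f f' : ℝ → ℝ} {s t : ℝ} (hst : s ≤ t)
    (hf : ∀ τ ∈ Icc s t, HasDerivAt f (f' τ) τ) (h : ∀ τ ∈ Icc s t, 0 ≤ f' τ) : f s ≤ f t := by
  have := integral_le_sub_of_hasDerivAt (g := fun _ => 0) hst hf continuousOn_const h
  simp at this; linarith

/-- Weighted mass of a nonnegative supersolution decays at most exponentially. -/
lemma mass_le {u u' : E2 → ℝ → ℝ} {a b R M r : ℝ} (hr : 0 < r) (H : GReg u u' a b R M)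
    (hu : ∀ x, ∀ t ∈ Ioo a b, 0 ≤ u x t)
    (he : ∀ x, ‖x‖ ≤ r → ∀ t ∈ Ioo a b, lap (fun y => u y t) x ≤ u' x t)
    {s t : ℝ} (hs : s ∈ Ioo a b) (ht : t ∈ Ioo a b) (hst : s ≤ t) :
    ∫ x, u x s * bump 3 (r ^ 2) x
      ≤ Real.exp (27 / r ^ 2 * (t - s)) * ∫ x, u x t * bump 3 (r ^ 2) x := by
  have hr2 : 0 < r ^ 2 := by positivity
  have hsub : ∀ τ ∈ Icc s t, τ ∈ Ioo a b := fun τ hτ =>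
    ⟨hs.1.trans_le hτ.1, hτ.2.trans_lt ht.2⟩
  have hbc : ContDiff ℝ 2 (bump 3 (r ^ 2)) := bump_contDiff 0 _
  have key := le_of_hasDerivAt_nonneg
    (f := fun τ => Real.exp (27 / r ^ 2 * (τ - s)) * ∫ x, u x τ * bump 3 (r ^ 2) x)
    (f' := fun τ => Real.exp (27 / r ^ 2 * (τ - s)) *
      (27 / r ^ 2 * (∫ x, u x τ * bump 3 (r ^ 2) x) + ∫ x, u' x τ * bump 3 (r ^ 2) x))
    hst (fun τ hτ => ?_) (fun τ hτ => ?_)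
  · simpa using key
  · have h1 : HasDerivAt (fun τ => Real.exp (27 / r ^ 2 * (τ - s)))
        (Real.exp (27 / r ^ 2 * (τ - s)) * (27 / r ^ 2)) τ := by
      have := (((hasDerivAt_id τ).sub_const s).const_mul (27 / r ^ 2)).exp
      simpa using this
    exact (h1.mul (H.hasDerivAt_integral_const hbc.continuous (hsub τ hτ))).congr_deriv (by ring)
  · refine mul_nonneg (Real.exp_pos _).le ?_
    have hτ' := hsub τ hτ
    have e1 : ∫ x, lap (fun y => u y τ) x * bump 3 (r ^ 2) x
        ≤ ∫ x, u' x τ * bump 3 (r ^ 2) x := by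
      refine integral_mono (H.integrable_lap_mul hbc.continuous hτ')
        (H.integrable_mul' hbc.continuous hτ') fun x => ?_
      by_cases hx : ‖x‖ ≤ r
      · exact mul_le_mul_of_nonneg_right (he x hx τ hτ') (bump_nonneg _ _ _)
      · simp [bump_vanish 3 (by norm_num) hr x (not_le.1 hx)]
    rw [H.green hbc hτ'] at e1
    have e2 : ∫ x, -(27 / r ^ 2) * (u x τ * bump 3 (r ^ 2) x)
        ≤ ∫ x, u x τ * lap (bump 3 (r ^ 2)) x := by
      refine integral_mono ((H.integrable_mul hbc.continuous hτ').const_mul _)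
        (H.integrable_mul (continuous_lap hbc) hτ') fun x => ?_
      have := mul_le_mul_of_nonneg_left (lap_bump_three_ge hr2 x) (hu x τ hτ')
      simp only; linarith
    rw [integral_const_mul] at e2
    linarith

/-- The fixed cutoff profile used to localise the heat kernel. -/
lemma exists_cutoff : ∃ (c c' c'' : ℝ → ℝ) (B : ℝ), Profile c c' c'' ∧ (∀ s, 0 ≤ c s) ∧
    (∀ s, c s ≤ 1) ∧ c 0 = 1 ∧ (∀ s > 1, c s = 0 ∧ c' s = 0 ∧ c'' s = 0) ∧
    (∀ s < 1 / 4, c' s = 0 ∧ c'' s = 0) ∧ (∀ s ∈ Icc (0 : ℝ) 1, |c' s| ≤ B ∧ |c'' s| ≤ B) := by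
  set c : ℝ → ℝ := fun s => Real.smoothTransition ((1 - s) * (4 / 3)) with hc
  have hcd : ContDiff ℝ 2 c := Real.smoothTransition.contDiff.comp (by fun_prop)
  have hcd' : ContDiff ℝ 1 (deriv c) :=
    ((contDiff_succ_iff_deriv (n := 1)).1 (by simpa [one_add_one_eq_two] using hcd)).2.2
  have hcd'' : Continuous (deriv (deriv c)) := hcd'.continuous_deriv le_rfl
  have hgt : ∀ s > 1, c =ᶠ[𝓝 s] fun _ => 0 := fun s hs => by
    filter_upwards [Ioi_mem_nhds hs] with r hr
    exact Real.smoothTransition.zero_of_nonpos (by nlinarith [mem_Ioi.1 hr])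
  have hlt : ∀ s < 1 / 4, c =ᶠ[𝓝 s] fun _ => 1 := fun s hs => by
    filter_upwards [Iio_mem_nhds hs] with r hr
    exact Real.smoothTransition.one_of_one_le (by nlinarith [mem_Iio.1 hr])
  have hd : ∀ (s k : ℝ), c =ᶠ[𝓝 s] (fun _ => k) → deriv c s = 0 ∧ deriv (deriv c) s = 0 :=
    fun s k h => by
      refine ⟨by rw [h.deriv_eq]; simp, ?_⟩
      rw [h.deriv.deriv_eq]; simp
  obtain ⟨B1, hB1⟩ := isCompact_Icc.exists_bound_of_continuousOn
    (s := Icc (0 : ℝ) 1) (f := deriv c) hcd'.continuous.continuousOn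
  obtain ⟨B2, hB2⟩ := isCompact_Icc.exists_bound_of_continuousOn
    (s := Icc (0 : ℝ) 1) (f := deriv (deriv c)) hcd''.continuousOn
  refine ⟨c, deriv c, deriv (deriv c), max B1 B2, ⟨?_, ?_, hcd''.continuousOn⟩, ?_, ?_, ?_, ?_, ?_,
    ?_⟩
  · exact fun s _ => (hcd.differentiable (by norm_num) s).hasDerivAt
  · exact fun s _ => (hcd'.differentiable (by norm_num) s).hasDerivAt
  · exact fun s => Real.smoothTransition.nonneg _
  · exact fun s => Real.smoothTransition.le_one _
  · exact Real.smoothTransition.one_of_one_le (by norm_num)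
  · exact fun s hs => ⟨(hgt s hs).eq_of_nhds, hd s 0 (hgt s hs)⟩
  · exact fun s hs => hd s 1 (hlt s hs)
  · exact fun s hs => ⟨(hB1 s hs).trans (le_max_left _ _), (hB2 s hs).trans (le_max_right _ _)⟩

/-- The auxiliary weight `(2 - |x|²)₊`. -/
noncomputable def wt (x : E2) : ℝ := max (2 - ‖x‖ ^ 2) 0

lemma wt_continuous : Continuous wt := by unfold wt; fun_prop
lemma wt_nonneg (x : E2) : 0 ≤ wt x := le_max_right _ _
lemma one_le_wt {x : E2} (hx : ‖x‖ ^ 2 ≤ 1) : 1 ≤ wt x := le_max_of_le_left (by linarith)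

/-- Profile of the heat kernel multiplied by a cutoff. -/
lemma hk_mul_profile {c c' c'' : ℝ → ℝ} (hc : Profile c c' c'') (θ : ℝ) :
    Profile (fun s => hk s θ * c s)
      (fun s => -(1 / (4 * θ)) * hk s θ * c s + hk s θ * c' s)
      (fun s => -(1 / (4 * θ)) * (-(1 / (4 * θ)) * hk s θ * c s + hk s θ * c' s)
        + (-(1 / (4 * θ)) * hk s θ * c' s + hk s θ * c'' s)) where
  d1 s hs := (hk_deriv_s s θ).mul (hc.d1 s hs)
  d2 s hs := by
    have h1 := ((hk_deriv_s s θ).const_mul (-(1 / (4 * θ)))).mul (hc.d1 s hs)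
    have h2 := (hk_deriv_s s θ).mul (hc.d2 s hs)
    exact (h1.add h2).congr_deriv (by ring)
  c := by
    have h0 : ContinuousOn (fun s => hk s θ) (Ioi (-1)) := by unfold hk; fun_prop
    have h1 : ContinuousOn c (Ioi (-1)) := fun s hs => (hc.d1 s hs).continuousAt.continuousWithinAt
    have h2 : ContinuousOn c' (Ioi (-1)) := fun s hs => (hc.d2 s hs).continuousAt.continuousWithinAt
    have h3 := hc.c
    fun_prop

lemma hk_bounds {s θ : ℝ} (hs : 1 / 4 ≤ s) (hθ : 0 < θ) : hk s θ ≤ 16 ∧ hk s θ / θ ≤ 512 := by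
  have hy : 0 < s / (4 * θ) := by positivity
  have h1 : Real.exp (-(s / (4 * θ))) ≤ 16 * θ := by
    have := Real.add_one_le_exp (s / (4 * θ))
    rw [Real.exp_neg, inv_le_comm₀ (Real.exp_pos _) (by positivity)]
    refine le_trans ?_ this
    have : (16 * θ)⁻¹ ≤ s / (4 * θ) := by
      rw [inv_eq_one_div, div_le_div_iff₀ (by positivity) (by positivity)]; nlinarith
    linarith
  have h2 : Real.exp (-(s / (4 * θ))) ≤ 512 * θ ^ 2 := by
    have := Real.quadratic_le_exp_of_nonneg hy.le
    rw [Real.exp_neg, inv_le_comm₀ (Real.exp_pos _) (by positivity)]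
    refine le_trans ?_ this
    have : (16 * θ)⁻¹ ≤ s / (4 * θ) := by
      rw [inv_eq_one_div, div_le_div_iff₀ (by positivity) (by positivity)]; nlinarith
    have h3 : (512 * θ ^ 2)⁻¹ = (16 * θ)⁻¹ ^ 2 / 2 := by field_simp; norm_num
    have h4 : (16 * θ)⁻¹ ^ 2 ≤ (s / (4 * θ)) ^ 2 := by gcongr
    rw [h3]; linarith
  unfold hk
  constructor
  · rw [inv_mul_le_iff₀ hθ]; linarith
  · rw [div_le_iff₀ hθ, inv_mul_le_iff₀ hθ]; linarith

/-- Duality estimate: testing a subsolution against a nonnegative weight. -/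
lemma GReg.weighted_le {v v' : E2 → ℝ → ℝ} {a b R M Λ G s t r K C₁ : ℝ} (H : GReg v v' a b R M)
    (hv : ∀ x, ∀ t ∈ Ioo a b, 0 ≤ v x t) (hΛ : 0 ≤ Λ) (hG : 0 ≤ G) (hK : 0 ≤ K) (hC₁ : 0 ≤ C₁)
    (he : ∀ x, ‖x‖ ≤ r → ∀ t ∈ Ioo a b, v' x t ≤ lap (fun y => v y t) x + Λ * v x t + G)
    (hs : s ∈ Ioo a b) (ht : t ∈ Ioo a b) (hst : s < t)
    {φ φ' : E2 → ℝ → ℝ} {W : E2 → ℝ} (hWc : Continuous W) (hW0 : ∀ x, 0 ≤ W x)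
    (cφ : ContinuousOn (fun q : E2 × ℝ => φ q.1 q.2) (univ ×ˢ Iio t))
    (cφ' : ContinuousOn (fun q : E2 × ℝ => φ' q.1 q.2) (univ ×ˢ Iio t))
    (hφd : ∀ x, ∀ τ < t, HasDerivAt (φ x) (φ' x τ) τ)
    (φ0 : ∀ x, ∀ τ < t, 0 ≤ φ x τ) (φz : ∀ x τ, r < ‖x‖ → φ x τ = 0)
    (φC : ∀ τ < t, ContDiff ℝ 2 fun x => φ x τ)
    (herr : ∀ x, ∀ τ < t, lap (fun y => φ y τ) x + φ' x τ ≤ C₁ * W x)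
    (hφK : ∀ τ < t, ∫ x, φ x τ ≤ K) {τ : ℝ} (hτ : τ ∈ Ico s t) :
    Real.exp (-(Λ * (τ - s))) * (∫ x, v x τ * φ x τ) ≤ (∫ x, v x s * φ x s)
      + ∫ τ in s..t, (K * G + C₁ * ∫ x, v x τ * W x) := by
  have cφ'x : ∀ τ < t, Continuous fun x => φ' x τ := fun τ hτ =>
    cφ'.comp_continuous (Continuous.prodMk continuous_id continuous_const) fun x => ⟨trivial, hτ⟩
  set g : ℝ → ℝ := fun τ => K * G + C₁ * ∫ x, v x τ * W x with hg
  have hsub : ∀ τ ∈ Ico s t, τ ∈ Ioo a b := fun τ hτ => ⟨hs.1.trans_le hτ.1, hτ.2.trans ht.2⟩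
  have gcont : ContinuousOn g (Icc s t) := by
    have := (H.continuousOn_integral hWc).mono
      (fun τ (hτ : τ ∈ Icc s t) => ⟨hs.1.trans_le hτ.1, hτ.2.trans_lt ht.2⟩)
    fun_prop
  have g0 : ∀ τ ∈ Icc s t, 0 ≤ g τ := fun τ hτ => by
    have : 0 ≤ ∫ x, v x τ * W x := integral_nonneg fun x =>
      mul_nonneg (hv x τ ⟨hs.1.trans_le hτ.1, hτ.2.trans_lt ht.2⟩) (hW0 x)
    positivity
  set J : ℝ → ℝ := fun τ => Real.exp (-(Λ * (τ - s))) * ∫ x, v x τ * φ x τ with hJ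
  have hJd : ∀ τ ∈ Ico s t, HasDerivAt J (Real.exp (-(Λ * (τ - s))) *
      (-Λ * (∫ x, v x τ * φ x τ) + ∫ x, (v' x τ * φ x τ + v x τ * φ' x τ))) τ := fun τ hτ => by
    have h1 : HasDerivAt (fun τ => Real.exp (-(Λ * (τ - s))))
        (Real.exp (-(Λ * (τ - s))) * (-Λ)) τ := by
      have := (((hasDerivAt_id τ).sub_const s).const_mul Λ).neg.exp
      simpa using this
    exact (h1.mul (H.hasDerivAt_integral cφ cφ' hφd (hsub τ hτ) hτ.2)).congr_deriv (by ring)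
  have hJle : ∀ τ ∈ Ico s t, Real.exp (-(Λ * (τ - s))) *
      (-Λ * (∫ x, v x τ * φ x τ) + ∫ x, (v' x τ * φ x τ + v x τ * φ' x τ)) ≤ g τ := fun τ hτ => by
    have hτ' := hsub τ hτ
    have cφx := (φC τ hτ.2).continuous
    have i0 := H.integrable_mul cφx hτ'
    have iφ : Integrable fun x => φ x τ :=
      VanishOff.integrable (R := r) (fun x hx => φz x τ hx) cφx
    have i3 := H.integrable_mul (cφ'x τ hτ.2) hτ'
    have iw := H.integrable_mul hWc hτ'
    have il := H.integrable_mul (continuous_lap (φC τ hτ.2)) hτ'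
    have ia : Integrable fun x => G * φ x τ + v x τ * φ' x τ := (iφ.const_mul G).add i3
    have ib : Integrable fun x => Λ * (v x τ * φ x τ) + (G * φ x τ + v x τ * φ' x τ) :=
      (i0.const_mul Λ).add ia
    have e1 : ∫ x, (v' x τ * φ x τ + v x τ * φ' x τ) ≤
        ∫ x, (lap (fun y => v y τ) x * φ x τ + (Λ * (v x τ * φ x τ) + (G * φ x τ
          + v x τ * φ' x τ))) := by
      refine integral_mono ((H.integrable_mul' cφx hτ').add i3)
        ((H.integrable_lap_mul cφx hτ').add ib)
        fun x => ?_
      simp only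
      by_cases hx : ‖x‖ ≤ r
      · have := mul_le_mul_of_nonneg_right (he x hx τ hτ') (φ0 x τ hτ.2)
        linarith
      · simp [φz x τ (not_le.1 hx)]
    rw [integral_add (H.integrable_lap_mul cφx hτ') ib,
      H.green (φC τ hτ.2) hτ', integral_add (i0.const_mul Λ) ia,
      integral_add (iφ.const_mul G) i3, integral_const_mul, integral_const_mul] at e1
    have e2 : (∫ x, v x τ * lap (fun y => φ y τ) x) + ∫ x, v x τ * φ' x τ
        ≤ C₁ * ∫ x, v x τ * W x := by
      rw [← integral_add il i3, ← integral_const_mul]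
      refine integral_mono (il.add i3) (iw.const_mul _) fun x => ?_
      have := mul_le_mul_of_nonneg_left (herr x τ hτ.2) (hv x τ hτ')
      simp only; linarith
    have e4 : G * ∫ x, φ x τ ≤ G * K := mul_le_mul_of_nonneg_left (hφK τ hτ.2) hG
    have e5 : Real.exp (-(Λ * (τ - s))) ≤ 1 := by
      rw [Real.exp_le_one_iff]
      have := mul_nonneg hΛ (sub_nonneg.2 hτ.1)
      linarith
    calc _ ≤ Real.exp (-(Λ * (τ - s))) * g τ :=
          mul_le_mul_of_nonneg_left (by simp only [hg]; linarith) (Real.exp_pos _).le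
      _ ≤ 1 * g τ := mul_le_mul_of_nonneg_right e5 (g0 τ ⟨hτ.1, hτ.2.le⟩)
      _ = g τ := one_mul _
  have hI : ∀ r ∈ Icc s τ, r ∈ Ico s t := fun r hr => ⟨hr.1, hr.2.trans_lt hτ.2⟩
  have h1 := sub_le_integral_of_hasDerivAt hτ.1 (fun r hr => hJd r (hI r hr))
    (gcont.mono fun r hr => ⟨hr.1, hr.2.trans hτ.2.le⟩) (fun r hr => hJle r (hI r hr))
  have h2 : ∫ r in s..τ, g r ≤ ∫ r in s..t, g r := by
    refine intervalIntegral.integral_mono_interval le_rfl hτ.1 hτ.2.le ?_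
      (gcont.intervalIntegrable_of_Icc hst.le)
    filter_upwards [ae_restrict_mem measurableSet_Ioc] with r hr using g0 r ⟨hr.1.le, hr.2⟩
  have hJs : J s = ∫ x, v x s * φ x s := by simp [hJ]
  rw [hJs] at h1
  exact (sub_le_iff_le_add'.1 h1).trans (add_le_add_right h2 _)

/-- The localised heat kernel is an almost subsolution of the backward heat equation. -/
lemma lap_hk_mul_add_le {c c' c'' : ℝ → ℝ} {B : ℝ} (hP : Profile c c' c'')
    (hgt : ∀ s > 1, c s = 0 ∧ c' s = 0 ∧ c'' s = 0)
    (hlt : ∀ s < 1 / 4, c' s = 0 ∧ c'' s = 0)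
    (hB : ∀ s ∈ Icc (0 : ℝ) 1, |c' s| ≤ B ∧ |c'' s| ≤ B) (x : E2) {θ : ℝ} (hθ : 0 < θ) :
    lap (fun y => hk (‖y‖ ^ 2) θ * c (‖y‖ ^ 2)) x
      + -((‖x‖ ^ 2 / (4 * θ ^ 2) - 1 / θ) * hk (‖x‖ ^ 2) θ) * c (‖x‖ ^ 2)
      ≤ (1500 * B + 1) * wt x := by
  have hB0 : 0 ≤ B := (abs_nonneg _).trans (hB 0 ⟨le_rfl, zero_le_one⟩).1
  have e : lap (fun y => hk (‖y‖ ^ 2) θ * c (‖y‖ ^ 2)) x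
      + -((‖x‖ ^ 2 / (4 * θ ^ 2) - 1 / θ) * hk (‖x‖ ^ 2) θ) * c (‖x‖ ^ 2) = -(2 * ‖x‖ ^ 2) * c' (‖x‖ ^ 2)
      * (hk (‖x‖ ^ 2) θ / θ)
      + (4 * ‖x‖ ^ 2 * c'' (‖x‖ ^ 2) + 4 * c' (‖x‖ ^ 2)) * hk (‖x‖ ^ 2) θ := by
    rw [(hk_mul_profile hP θ).lap]
    field_simp; ring
  rw [e]
  have w0 := wt_nonneg x
  have s0 : 0 ≤ ‖x‖ ^ 2 := by positivity
  by_cases h1 : ‖x‖ ^ 2 < 1 / 4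
  · rw [(hlt _ h1).1, (hlt _ h1).2]; simp; positivity
  by_cases h2 : 1 < ‖x‖ ^ 2
  · rw [(hgt _ h2).2.1, (hgt _ h2).2.2]; simp; positivity
  rw [not_lt] at h1 h2
  obtain ⟨k1, k2⟩ := hk_bounds h1 hθ
  obtain ⟨b1, b2⟩ := hB _ ⟨s0, h2⟩
  have k0 := (hk_pos (‖x‖ ^ 2) hθ).le
  have k3 : 0 ≤ hk (‖x‖ ^ 2) θ / θ := by positivity
  have w1 := one_le_wt h2
  have a1 : -(2 * ‖x‖ ^ 2) * c' (‖x‖ ^ 2) ≤ 2 * B := by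
    have := neg_le_of_abs_le b1
    nlinarith
  have a2 : 4 * ‖x‖ ^ 2 * c'' (‖x‖ ^ 2) + 4 * c' (‖x‖ ^ 2) ≤ 8 * B := by
    have := le_of_abs_le b1
    have := le_of_abs_le b2
    nlinarith
  calc _ ≤ 2 * B * 512 + 8 * B * 16 := by
        refine add_le_add ?_ ?_
        · exact (mul_le_mul_of_nonneg_right a1 k3).trans
            (mul_le_mul_of_nonneg_left k2 (by positivity))
        · exact (mul_le_mul_of_nonneg_right a2 k0).trans
            (mul_le_mul_of_nonneg_left k1 (by positivity))
    _ ≤ (1500 * B + 1) * 1 := by linarith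
    _ ≤ _ := by gcongr

set_option maxHeartbeats 400000 in
/-- Local maximum estimate through the heat kernel (raw form). -/
lemma exists_mv_raw : ∃ (c : ℝ → ℝ) (C₁ : ℝ), Continuous (fun x : E2 => c (‖x‖ ^ 2)) ∧
    (∀ s, 0 ≤ c s) ∧ (∀ s, c s ≤ 1) ∧ (∀ s > 1, c s = 0) ∧ 0 < C₁ ∧
    ∀ (v v' : E2 → ℝ → ℝ) (a b R M Λ G s t : ℝ), GReg v v' a b R M →
      (∀ x, ∀ t ∈ Ioo a b, 0 ≤ v x t) → 0 ≤ Λ → 0 ≤ G →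
      (∀ x, ‖x‖ ≤ 1 → ∀ t ∈ Ioo a b, v' x t ≤ lap (fun y => v y t) x + Λ * v x t + G) →
      s ∈ Ioo a b → t ∈ Ioo a b → s < t → t ≤ s + 1 →
      4 * Real.pi * v 0 t ≤ Real.exp Λ * ((∫ x, v x s * (hk (‖x‖ ^ 2) (t - s) * c (‖x‖ ^ 2))) +
        ∫ τ in s..t, (4 * Real.pi * G + C₁ * ∫ x, v x τ * wt x)) := by
  obtain ⟨c, c', c'', B, hP, hc0, hc1, hcz, hgt, hlt, hB⟩ := exists_cutoff
  have hB0 : 0 ≤ B := (abs_nonneg _).trans (hB 0 ⟨le_rfl, zero_le_one⟩).1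
  have hcc : Continuous fun x : E2 => c (‖x‖ ^ 2) := hP.contDiff.continuous
  refine ⟨c, 1500 * B + 1, hcc, hc0, hc1, fun s hs => (hgt s hs).1, by positivity, ?_⟩
  intro v v' a b R M Λ G s t H hv hΛ hG he hs ht hst hst1
  set φ : E2 → ℝ → ℝ := fun x τ => hk (‖x‖ ^ 2) (t - τ) * c (‖x‖ ^ 2) with hφ
  set φ' : E2 → ℝ → ℝ := fun x τ =>
    -((‖x‖ ^ 2 / (4 * (t - τ) ^ 2) - 1 / (t - τ)) * hk (‖x‖ ^ 2) (t - τ)) * c (‖x‖ ^ 2) with hφ'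
  have cφ : ContinuousOn (fun q : E2 × ℝ => φ q.1 q.2) (univ ×ˢ Iio t) :=
    hk_continuousOn.mul (hcc.comp continuous_fst).continuousOn
  have cφ' : ContinuousOn (fun q : E2 × ℝ => φ' q.1 q.2) (univ ×ˢ Iio t) := by
    refine ContinuousOn.mul (ContinuousOn.neg (ContinuousOn.mul ?_ hk_continuousOn))
      (hcc.comp continuous_fst).continuousOn
    have h0 : ∀ q ∈ (univ : Set E2) ×ˢ Iio t, t - q.2 ≠ 0 := fun q hq =>
      (sub_pos.2 (mem_Iio.1 hq.2)).ne'
    have h1 : ∀ q ∈ (univ : Set E2) ×ˢ Iio t, 4 * (t - q.2) ^ 2 ≠ 0 := fun q hq =>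
      mul_ne_zero (by norm_num) (pow_ne_zero _ (h0 q hq))
    fun_prop (disch := assumption)
  have hφd : ∀ x, ∀ τ < t, HasDerivAt (φ x) (φ' x τ) τ := fun x τ hτ => by
    have := ((hk_deriv_θ (‖x‖ ^ 2) (sub_pos.2 hτ)).comp τ ((hasDerivAt_id τ).const_sub t)).mul_const
      (c (‖x‖ ^ 2))
    exact this.congr_deriv (by simp only [hφ']; ring)
  have φ0 : ∀ x, ∀ τ < t, 0 ≤ φ x τ := fun x τ hτ =>
    mul_nonneg (hk_pos _ (sub_pos.2 hτ)).le (hc0 _)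
  have φz : ∀ x τ, 1 < ‖x‖ → φ x τ = 0 := fun x τ hx => by
    simp [hφ, (hgt (‖x‖ ^ 2) (by nlinarith)).1]
  have φC : ∀ τ, ContDiff ℝ 2 fun x => φ x τ := fun τ => (hk_mul_profile hP (t - τ)).contDiff
  have herr : ∀ x, ∀ τ < t, lap (fun y => φ y τ) x + φ' x τ ≤ (1500 * B + 1) * wt x :=
    fun x τ hτ => lap_hk_mul_add_le hP hgt hlt hB x (sub_pos.2 hτ)
  have i3 : ∀ τ < t, ∫ x, φ x τ ≤ 4 * Real.pi := fun τ hτ => by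
    obtain ⟨h1, h2⟩ := hk_integral (sub_pos.2 hτ)
    rw [← h2]
    exact integral_mono (VanishOff.integrable (R := 1) (fun x hx => φz x τ hx) (φC τ).continuous) h1
      fun x => mul_le_of_le_one_right (hk_pos _ (sub_pos.2 hτ)).le (hc1 _)
  have hmain := fun τ (hτ : τ ∈ Ico s t) => H.weighted_le hv hΛ hG (by positivity : 0 ≤ 4 * Real.pi)
    (by positivity : 0 ≤ 1500 * B + 1) he hs ht hst wt_continuous wt_nonneg cφ cφ' hφd φ0 φz
    (fun τ _ => φC τ) herr i3 hτ
  have hlim : Tendsto (fun τ => Real.exp (-(Λ * (τ - s))) * ∫ x, v x τ * φ x τ) (𝓝[<] t)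
      (𝓝 (Real.exp (-(Λ * (t - s))) * (4 * Real.pi * v 0 t))) := by
    refine Tendsto.mul ?_ ?_
    · have : Continuous fun τ => Real.exp (-(Λ * (τ - s))) := by fun_prop
      exact (this.tendsto t).mono_left nhdsWithin_le_nhds
    · have h := tendsto_hk_integral (w := fun x τ => v x τ * c (‖x‖ ^ 2)) (R := R) (M := M) hst
        (fun τ hτ => (H.cx ⟨hs.1.trans hτ.1, hτ.2.trans_lt ht.2⟩).mul hcc)
        (fun τ hτ => (H.van τ ⟨hs.1.trans hτ.1, hτ.2.trans_lt ht.2⟩).mul_right _)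
        (fun x τ hτ => ?_)
      · simp only [norm_zero, ne_eq, OfNat.ofNat_ne_zero, not_false_eq_true, zero_pow, hcz,
          mul_one] at h
        refine h.congr fun τ => integral_congr_ae (ae_of_all _ fun x => ?_)
        simp only [hφ]; ring
      · rw [← sub_mul, abs_mul, abs_of_nonneg (hc0 _)]
        have h1 := H.lip x (s := τ) (t := t) ⟨hs.1.trans hτ.1, hτ.2.trans_lt ht.2⟩ ht
        exact (mul_le_of_le_one_right (abs_nonneg _) (hc1 _)).trans h1
  have hfin := le_of_tendsto hlim (by
    filter_upwards [Ioo_mem_nhdsLT hst] with τ hτ using hmain τ ⟨hτ.1.le, hτ.2⟩)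
  set S := (∫ x, v x s * φ x s) +
    ∫ τ in s..t, (4 * Real.pi * G + (1500 * B + 1) * ∫ x, v x τ * wt x) with hS
  have hpos : 0 ≤ S := le_trans (mul_nonneg (Real.exp_pos _).le (integral_nonneg fun x =>
    mul_nonneg (hv x s hs) (φ0 x s hst))) (hmain s ⟨le_rfl, hst⟩)
  calc 4 * Real.pi * v 0 t
      = Real.exp (Λ * (t - s)) * (Real.exp (-(Λ * (t - s))) * (4 * Real.pi * v 0 t)) := by
        rw [← mul_assoc, ← Real.exp_add]; simp
    _ ≤ Real.exp (Λ * (t - s)) * S := by gcongr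
    _ ≤ Real.exp Λ * S := by
        refine mul_le_mul_of_nonneg_right (Real.exp_le_exp.2 ?_) hpos
        nlinarith

/-- Local maximum estimates for nonnegative subsolutions, in terms of either the supremum or the
mass at the initial time. -/
lemma exists_mv : ∃ C₁ > 0, 
    ∀ (v v' : E2 → ℝ → ℝ) (a b R M Λ G s t : ℝ), GReg v v' a b R M →
      (∀ x, ∀ t ∈ Ioo a b, 0 ≤ v x t) → 0 ≤ Λ → 0 ≤ G →
      (∀ x, ‖x‖ ≤ 1 → ∀ t ∈ Ioo a b, v' x t ≤ lap (fun y => v y t) x + Λ * v x t + G) →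
      s ∈ Ioo a b → t ∈ Ioo a b → s < t → t ≤ s + 1 →
      (∀ m, (∀ x, ‖x‖ ≤ 1 → v x s ≤ m) →
        v 0 t ≤ Real.exp Λ * (m + ∫ τ in s..t, (G + C₁ * ∫ x, v x τ * wt x))) ∧
      v 0 t ≤ Real.exp Λ * (1 / (t - s) * (∫ x, v x s * wt x)
        + ∫ τ in s..t, (G + C₁ * ∫ x, v x τ * wt x)) := by
  obtain ⟨c, C₁, hcc, hc0, hc1, hcz, hC₁, hmv⟩ := exists_mv_raw
  refine ⟨C₁, hC₁, ?_⟩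
  intro v v' a b R M Λ G s t H hv hΛ hG he hs ht hst hst1
  have hθ := sub_pos.2 hst
  have raw := hmv v v' a b R M Λ G s t H hv hΛ hG he hs ht hst hst1
  have hpi : 1 ≤ 4 * Real.pi := by linarith [Real.pi_gt_three]
  have hsub : ∀ τ ∈ Icc s t, τ ∈ Ioo a b := fun τ hτ =>
    ⟨hs.1.trans_le hτ.1, hτ.2.trans_lt ht.2⟩
  have cW : ContinuousOn (fun τ => ∫ x, v x τ * wt x) (Icc s t) :=
    (H.continuousOn_integral wt_continuous).mono hsub
  have W0 : ∀ τ ∈ Icc s t, 0 ≤ ∫ x, v x τ * wt x := fun τ hτ =>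
    integral_nonneg fun x => mul_nonneg (hv x τ (hsub τ hτ)) (wt_nonneg x)
  have hI : ∫ τ in s..t, (4 * Real.pi * G + C₁ * ∫ x, v x τ * wt x)
      ≤ 4 * Real.pi * ∫ τ in s..t, (G + C₁ * ∫ x, v x τ * wt x) := by
    rw [← intervalIntegral.integral_const_mul]
    refine intervalIntegral.integral_mono_on hst.le ?_ ?_ fun τ hτ => ?_
    · exact ContinuousOn.intervalIntegrable_of_Icc hst.le (by fun_prop)
    · exact ContinuousOn.intervalIntegrable_of_Icc hst.le (by fun_prop)
    · have := mul_nonneg hC₁.le (W0 τ hτ)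
      nlinarith
  have key : ∀ A, (∫ x, v x s * (hk (‖x‖ ^ 2) (t - s) * c (‖x‖ ^ 2))) ≤ 4 * Real.pi * A →
      v 0 t ≤ Real.exp Λ * (A + ∫ τ in s..t, (G + C₁ * ∫ x, v x τ * wt x)) := fun A hA => by
    refine le_of_mul_le_mul_left (raw.trans ?_) (by linarith : 0 < 4 * Real.pi)
    calc _ ≤ Real.exp Λ * (4 * Real.pi * A
          + 4 * Real.pi * ∫ τ in s..t, (G + C₁ * ∫ x, v x τ * wt x)) := by gcongr
      _ = _ := by ring
  have ck : Continuous fun x : E2 => hk (‖x‖ ^ 2) (t - s) := by unfold hk; fun_prop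
  have i1 := H.integrable_mul (ck.mul hcc) hs
  obtain ⟨hk1, hk2⟩ := hk_integral hθ
  refine ⟨fun m hm => key m ?_, ?_⟩
  · have hm0 : 0 ≤ m := (hv 0 s hs).trans (hm 0 (by simp))
    rw [← hk2, mul_comm, ← integral_const_mul]
    refine integral_mono i1 (hk1.const_mul m) fun x => ?_
    have k0 := (hk_pos (‖x‖ ^ 2) hθ).le
    by_cases hx : ‖x‖ ≤ 1
    · exact mul_le_mul (hm x hx) (mul_le_of_le_one_right k0 (hc1 _)) (mul_nonneg k0 (hc0 _)) hm0
    · have : c (‖x‖ ^ 2) = 0 := hcz _ (by nlinarith [not_le.1 hx])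
      simp only [this, mul_zero]
      positivity
  · have e : ∫ x, v x s * (hk (‖x‖ ^ 2) (t - s) * c (‖x‖ ^ 2))
        ≤ 1 / (t - s) * ∫ x, v x s * wt x := by
      rw [← integral_const_mul]
      refine integral_mono i1 ((H.integrable_mul wt_continuous hs).const_mul _) fun x => ?_
      have hcw : c (‖x‖ ^ 2) ≤ wt x := by
        by_cases hx : ‖x‖ ^ 2 ≤ 1
        · exact (hc1 _).trans (one_le_wt hx)
        · rw [hcz _ (not_le.1 hx)]; exact wt_nonneg x
      have := mul_le_mul (hk_le (‖x‖ ^ 2) (by positivity) hθ) hcw (hc0 _) (by positivity)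
      calc v x s * (hk (‖x‖ ^ 2) (t - s) * c (‖x‖ ^ 2)) ≤ v x s * (1 / (t - s) * wt x) :=
            mul_le_mul_of_nonneg_left this (hv x s hs)
        _ = _ := by ring
    refine key _ (e.trans ?_)
    exact le_mul_of_one_le_left (mul_nonneg (by positivity) (W0 s ⟨le_rfl, hst.le⟩)) hpi

/-- A continuous function is somewhere at most its average. -/
lemma exists_mul_le_integral {f : ℝ → ℝ} {a b : ℝ} (hab : a ≤ b) (hf : ContinuousOn f (Icc a b)) :
    ∃ s ∈ Icc a b, f s * (b - a) ≤ ∫ τ in a..b, f τ := by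
  obtain ⟨s, hs, hmin⟩ := isCompact_Icc.exists_isMinOn (nonempty_Icc.2 hab) hf
  refine ⟨s, hs, ?_⟩
  have := intervalIntegral.integral_mono_on hab (f := fun _ => f s) (g := f) (μ := volume)
    (by simp) (hf.intervalIntegrable_of_Icc hab) fun τ hτ => hmin hτ
  simp at this
  linarith

/-- Positive part of `k - 1/4`. -/
noncomputable def hpp (k : ℝ) : ℝ := max (k - 1 / 4) 0

/-- A convex truncation of the identity. -/
noncomputable def trunc (k : ℝ) : ℝ := hpp k ^ 3 / k ^ 2
/-- First derivative of `trunc`. -/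
noncomputable def trunc' (k : ℝ) : ℝ := 3 * hpp k ^ 2 / k ^ 2 - 2 * hpp k ^ 3 / k ^ 3
/-- Second derivative of `trunc`. -/
noncomputable def trunc'' (k : ℝ) : ℝ := 6 * hpp k * (k - hpp k) ^ 2 / k ^ 4

lemma hpp_nonneg (k : ℝ) : 0 ≤ hpp k := le_max_right _ _

lemma hpp_pow_two (k : ℝ) : HasDerivAt (fun k => hpp k ^ 2) (2 * hpp k) k := by
  have := (hasDerivAt_pos_pow 0 (k - 1 / 4)).comp k ((hasDerivAt_id k).sub_const (1 / 4))
  exact this.congr_deriv (by simp [hpp])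

lemma hpp_pow_three (k : ℝ) : HasDerivAt (fun k => hpp k ^ 3) (3 * hpp k ^ 2) k := by
  have := (hasDerivAt_pos_pow 1 (k - 1 / 4)).comp k ((hasDerivAt_id k).sub_const (1 / 4))
  exact this.congr_deriv (by simp [hpp]; norm_num)

lemma hasDerivAt_trunc {k : ℝ} (hk : 0 < k) : HasDerivAt trunc (trunc' k) k := by
  have := (hpp_pow_three k).div (hasDerivAt_pow 2 k) (by positivity)
  refine this.congr_deriv ?_
  unfold trunc'; field_simp; push_cast; ring

lemma hasDerivAt_trunc' {k : ℝ} (hk : 0 < k) : HasDerivAt trunc' (trunc'' k) k := by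
  have h1 := ((hpp_pow_two k).const_mul 3).div (hasDerivAt_pow 2 k) (by positivity)
  have h2 := ((hpp_pow_three k).const_mul 2).div (hasDerivAt_pow 3 k) (by positivity)
  refine (h1.sub h2).congr_deriv ?_
  unfold trunc''; field_simp; push_cast; ring

lemma trunc''_nonneg (k : ℝ) : 0 ≤ trunc'' k := by
  have := hpp_nonneg k
  unfold trunc''; positivity

lemma trunc_nonneg (k : ℝ) : 0 ≤ trunc k := by
  have := hpp_nonneg k
  unfold trunc; positivity

lemma trunc_le {k : ℝ} (hk : 0 < k) : trunc k ≤ k := by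
  have h : hpp k ≤ k := max_le (by linarith) hk.le
  unfold trunc
  rw [div_le_iff₀ (by positivity)]
  calc hpp k ^ 3 ≤ k ^ 3 := pow_le_pow_left₀ (hpp_nonneg k) h 3
    _ = _ := by ring

lemma trunc_eq_zero {k : ℝ} (hk : k ≤ 1 / 4) : trunc k = 0 := by
  have : hpp k = 0 := max_eq_right (by linarith)
  simp [trunc, this]

lemma trunc_ge {k : ℝ} (h1 : 1 / 3 ≤ k) (h2 : k ≤ 1) : 1 / 1728 ≤ trunc k := by
  have h : 1 / 12 ≤ hpp k := le_max_of_le_left (by linarith)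
  unfold trunc
  rw [le_div_iff₀ (by positivity)]
  have h3 : (1 / 12 : ℝ) ^ 3 ≤ hpp k ^ 3 := by gcongr
  have h4 : k ^ 2 ≤ 1 := by nlinarith
  nlinarith

lemma continuousOn_trunc : ContinuousOn trunc (Ioi 0) := fun _ hk =>
  (hasDerivAt_trunc hk).continuousAt.continuousWithinAt

lemma continuousOn_trunc' : ContinuousOn trunc' (Ioi 0) := fun _ hk =>
  (hasDerivAt_trunc' hk).continuousAt.continuousWithinAt

lemma continuousOn_trunc'' : ContinuousOn trunc'' (Ioi 0) := by
  have : ∀ k ∈ Ioi (0 : ℝ), k ^ 4 ≠ 0 := fun k hk => by have := mem_Ioi.1 hk; positivity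
  unfold trunc'' hpp
  fun_prop (disch := assumption)

lemma trunc_profile {θ : ℝ} (hθ : 0 < θ) :
    Profile (fun s => trunc (hk s θ)) (fun s => trunc' (hk s θ) * (-(1 / (4 * θ)) * hk s θ))
      (fun s => trunc'' (hk s θ) * (-(1 / (4 * θ)) * hk s θ) * (-(1 / (4 * θ)) * hk s θ)
        + trunc' (hk s θ) * (-(1 / (4 * θ)) * (-(1 / (4 * θ)) * hk s θ))) where
  d1 s _ := by
    have h := hasDerivAt_trunc (hk_pos s hθ)
    exact h.comp s (hk_deriv_s s θ)
  d2 s _ := by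
    have h := (hasDerivAt_trunc' (hk_pos s hθ)).comp s (hk_deriv_s s θ)
    exact h.mul ((hk_deriv_s s θ).const_mul (-(1 / (4 * θ))))
  c := by
    have h0 : Continuous fun s => hk s θ := by unfold hk; fun_prop
    have h1 : Continuous fun s => trunc' (hk s θ) :=
      continuousOn_trunc'.comp_continuous h0 fun s => hk_pos s hθ
    have h2 : Continuous fun s => trunc'' (hk s θ) :=
      continuousOn_trunc''.comp_continuous h0 fun s => hk_pos s hθ
    fun_prop

lemma hk_le_quarter {s θ : ℝ} (hs : 8 ≤ s) (hθ : 0 < θ) (hθ1 : θ ≤ 1) : hk s θ ≤ 1 / 4 := by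
  have hw : 1 ≤ θ⁻¹ := (one_le_inv₀ hθ).2 hθ1
  have h1 : 2 * θ⁻¹ ≤ s / (4 * θ) := by
    rw [← div_eq_mul_inv, div_le_div_iff₀ hθ (by positivity)]; nlinarith
  have h2 : 4 * θ⁻¹ ≤ Real.exp (s / (4 * θ)) := by
    have := Real.quadratic_le_exp_of_nonneg (by positivity : 0 ≤ 2 * θ⁻¹)
    have h3 := Real.exp_le_exp.2 h1
    nlinarith
  unfold hk
  rw [Real.exp_neg, ← div_eq_mul_inv, div_le_iff₀ (Real.exp_pos _)]
  linarith

/-- Testing a nonnegative supersolution against a subcaloric weight gives a nondecreasing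
quantity. -/
lemma GReg.integral_mono {u u' : E2 → ℝ → ℝ} {a b R M r s T : ℝ} (H : GReg u u' a b R M)
    (hu : ∀ x, ∀ t ∈ Ioo a b, 0 ≤ u x t)
    (he : ∀ x, ‖x‖ ≤ r → ∀ t ∈ Ioo a b, lap (fun y => u y t) x ≤ u' x t)
    (hs : s ∈ Ioo a b) (ht : T ∈ Ioo a b) {φ φ' : E2 → ℝ → ℝ}
    (cφ : ContinuousOn (fun q : E2 × ℝ => φ q.1 q.2) (univ ×ˢ Iio T))
    (cφ' : ContinuousOn (fun q : E2 × ℝ => φ' q.1 q.2) (univ ×ˢ Iio T))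
    (hφd : ∀ x, ∀ τ < T, HasDerivAt (φ x) (φ' x τ) τ)
    (φC : ∀ τ < T, ContDiff ℝ 2 fun x => φ x τ)
    (φ0 : ∀ x, ∀ τ < T, 0 ≤ φ x τ)
    (φz : ∀ x, ∀ τ ∈ Ico s T, r < ‖x‖ → φ x τ = 0)
    (hlap : ∀ x, ∀ τ < T, 0 ≤ lap (fun y => φ y τ) x + φ' x τ) {τ : ℝ} (hτ : τ ∈ Ico s T) :
    ∫ x, u x s * φ x s ≤ ∫ x, u x τ * φ x τ := by
  have hsub : ∀ τ ∈ Ico s T, τ ∈ Ioo a b := fun τ hτ => ⟨hs.1.trans_le hτ.1, hτ.2.trans ht.2⟩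
  refine le_of_hasDerivAt_nonneg (f := fun τ => ∫ x, u x τ * φ x τ)
    (f' := fun τ => ∫ x, (u' x τ * φ x τ + u x τ * φ' x τ)) hτ.1 (fun q hr => ?_) fun q hr => ?_
  · have hr' : q ∈ Ico s T := ⟨hr.1, hr.2.trans_lt hτ.2⟩
    exact H.hasDerivAt_integral cφ cφ' hφd (hsub q hr') hr'.2
  · have hr' : q ∈ Ico s T := ⟨hr.1, hr.2.trans_lt hτ.2⟩
    have hab := hsub q hr'
    have cx' : Continuous fun x => φ' x q :=
      cφ'.comp_continuous (Continuous.prodMk continuous_id continuous_const)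
        fun x => ⟨trivial, hr'.2⟩
    have i1 := H.integrable_lap_mul (φC q hr'.2).continuous hab
    have i2 := H.integrable_mul cx' hab
    have i3 := H.integrable_mul (continuous_lap (φC q hr'.2)) hab
    have i4 := H.integrable_mul' (φC q hr'.2).continuous hab
    have h1 : 0 ≤ ∫ x, (lap (fun y => u y q) x * φ x q + u x q * φ' x q) := by
      rw [integral_add i1 i2, H.green (φC q hr'.2) hab, ← integral_add i3 i2]
      refine integral_nonneg fun x => ?_
      have := mul_nonneg (hu x q hab) (hlap x q hr'.2)
      simp only [Pi.zero_apply]; linarith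
    refine h1.trans (MeasureTheory.integral_mono (i1.add i2) (i4.add i2) fun x => ?_)
    by_cases hx : ‖x‖ ≤ r
    · exact add_le_add_left (mul_le_mul_of_nonneg_right (he x hx q hab) (φ0 x q hr'.2)) _
    · simp [φz x q hr' (not_le.1 hx)]

/-- Quantitative strong minimum principle for nonnegative supersolutions. -/
lemma mass_le_value {u u' : E2 → ℝ → ℝ} {a b R M s : ℝ} (H : GReg u u' a b R M)
    (hu : ∀ x, ∀ t ∈ Ioo a b, 0 ≤ u x t)
    (he : ∀ x, ‖x‖ ≤ 3 → ∀ t ∈ Ioo a b, lap (fun y => u y t) x ≤ u' x t)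
    (hs : s ∈ Ioo a b) (ht : s + 1 ∈ Ioo a b) {ζ : E2 → ℝ} (hζ : Continuous ζ)
    (hζ1 : ∀ x, ζ x ≤ 1) (hζz : VanishOff 2 ζ) :
    ∫ x, u x s * ζ x ≤ 1728 * (4 * Real.pi) * u 0 (s + 1) := by
  set T := s + 1 with hT
  set φ : E2 → ℝ → ℝ := fun x τ => trunc (hk (‖x‖ ^ 2) (T - τ)) with hφ
  set φ' : E2 → ℝ → ℝ := fun x τ => trunc' (hk (‖x‖ ^ 2) (T - τ)) *
    -((‖x‖ ^ 2 / (4 * (T - τ) ^ 2) - 1 / (T - τ)) * hk (‖x‖ ^ 2) (T - τ)) with hφ'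
  have hmaps : MapsTo (fun q : E2 × ℝ => hk (‖q.1‖ ^ 2) (T - q.2)) (univ ×ˢ Iio T) (Ioi 0) :=
    fun q hq => hk_pos _ (sub_pos.2 (mem_Iio.1 hq.2))
  have cφ : ContinuousOn (fun q : E2 × ℝ => φ q.1 q.2) (univ ×ˢ Iio T) :=
    continuousOn_trunc.comp hk_continuousOn hmaps
  have cφ' : ContinuousOn (fun q : E2 × ℝ => φ' q.1 q.2) (univ ×ˢ Iio T) := by
    refine (continuousOn_trunc'.comp hk_continuousOn hmaps).mul
      (ContinuousOn.neg (ContinuousOn.mul ?_ hk_continuousOn))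
    have h0 : ∀ q ∈ (univ : Set E2) ×ˢ Iio T, T - q.2 ≠ 0 := fun q hq =>
      (sub_pos.2 (mem_Iio.1 hq.2)).ne'
    have h1 : ∀ q ∈ (univ : Set E2) ×ˢ Iio T, 4 * (T - q.2) ^ 2 ≠ 0 := fun q hq =>
      mul_ne_zero (by norm_num) (pow_ne_zero _ (h0 q hq))
    fun_prop (disch := assumption)
  have hφd : ∀ x, ∀ τ < T, HasDerivAt (φ x) (φ' x τ) τ := fun x τ hτ => by
    have h1 := (hk_deriv_θ (‖x‖ ^ 2) (sub_pos.2 hτ)).comp τ ((hasDerivAt_id τ).const_sub T)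
    have h2 := (hasDerivAt_trunc (hk_pos (‖x‖ ^ 2) (sub_pos.2 hτ))).comp τ h1
    exact h2.congr_deriv (by simp only [hφ']; ring)
  have φC : ∀ τ < T, ContDiff ℝ 2 fun x => φ x τ := fun τ hτ =>
    (trunc_profile (sub_pos.2 hτ)).contDiff
  have φz : ∀ x, ∀ τ ∈ Ico s T, 3 < ‖x‖ → φ x τ = 0 := fun x τ hτ hx =>
    trunc_eq_zero (hk_le_quarter (by nlinarith) (sub_pos.2 hτ.2) (by linarith [hτ.1]))
  have hlap : ∀ x, ∀ τ < T, 0 ≤ lap (fun y => φ y τ) x + φ' x τ := fun x τ hτ => by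
    have hθ := sub_pos.2 hτ
    have e : lap (fun y => φ y τ) x + φ' x τ = 4 * ‖x‖ ^ 2 * (trunc'' (hk (‖x‖ ^ 2) (T - τ)) *
        (1 / (4 * (T - τ)) * hk (‖x‖ ^ 2) (T - τ)) ^ 2) := by
      rw [(trunc_profile hθ).lap]
      simp only [hφ']
      field_simp
      ring
    rw [e]
    have := trunc''_nonneg (hk (‖x‖ ^ 2) (T - τ))
    positivity
  have hsub : ∀ τ ∈ Ico s T, τ ∈ Ioo a b := fun τ hτ => ⟨hs.1.trans_le hτ.1, hτ.2.trans ht.2⟩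
  have hmono : ∀ τ ∈ Ico s T, ∫ x, u x s * φ x s ≤ ∫ x, u x τ * φ x τ := fun τ hτ =>
    H.integral_mono hu he hs ht cφ cφ' hφd φC (fun x τ _ => trunc_nonneg _) φz hlap hτ
  have hlim : Tendsto (fun τ => ∫ x, u x τ * hk (‖x‖ ^ 2) (T - τ)) (𝓝[<] T)
      (𝓝 (4 * Real.pi * u 0 T)) :=
    tendsto_hk_integral (R := R) (M := M) (a := s) (by linarith)
      (fun t h => H.cx ⟨hs.1.trans h.1, h.2.trans_lt ht.2⟩)
      (fun t h => H.van t ⟨hs.1.trans h.1, h.2.trans_lt ht.2⟩)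
      (fun x t h => H.lip x ⟨hs.1.trans h.1, h.2.trans_lt ht.2⟩ ht)
  have hle : ∫ x, u x s * φ x s ≤ 4 * Real.pi * u 0 T := by
    refine ge_of_tendsto hlim ?_
    filter_upwards [Ioo_mem_nhdsLT (by linarith : s < T)] with τ hτ
    have hτ' : τ ∈ Ico s T := ⟨hτ.1.le, hτ.2⟩
    have ck : Continuous fun x : E2 => hk (‖x‖ ^ 2) (T - τ) := by unfold hk; fun_prop
    refine (hmono τ hτ').trans (integral_mono (H.integrable_mul (φC τ hτ.2).continuous
      (hsub τ hτ')) (H.integrable_mul ck (hsub τ hτ')) fun x => ?_)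
    exact mul_le_mul_of_nonneg_left (trunc_le (hk_pos _ (sub_pos.2 hτ.2))) (hu x τ (hsub τ hτ'))
  have hsT : s < T := by linarith
  have hlow : ∫ x, u x s * ζ x ≤ ∫ x, 1728 * (u x s * φ x s) := by
    refine integral_mono (H.integrable_mul hζ hs)
      ((H.integrable_mul (φC s hsT).continuous hs).const_mul _) fun x => ?_
    have hux := hu x s hs
    by_cases hx : ‖x‖ ≤ 2
    · have e1 : T - s = 1 := by linarith
      have hk1 : hk (‖x‖ ^ 2) 1 ≤ 1 := by
        simpa using hk_le (‖x‖ ^ 2) (by positivity) one_pos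
      have hk2 : 1 / 3 ≤ hk (‖x‖ ^ 2) 1 := by
        unfold hk
        have h1 : Real.exp (-1) ≤ Real.exp (-(‖x‖ ^ 2 / (4 * 1))) := by
          rw [Real.exp_le_exp]; nlinarith [norm_nonneg x]
        have h2 : 1 / 3 ≤ Real.exp (-1) := by
          rw [Real.exp_neg, one_div]
          exact inv_anti₀ (Real.exp_pos _) (by linarith [Real.exp_one_lt_d9])
        simpa using h2.trans h1
      have h3 := trunc_ge hk2 hk1
      simp only [hφ, e1]
      have h4 := mul_le_mul_of_nonneg_left (hζ1 x) hux
      have h5 := mul_le_mul_of_nonneg_left h3 hux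
      linarith
    · simp only [hζz x (not_le.1 hx), mul_zero]
      exact mul_nonneg (by norm_num) (mul_nonneg hux (trunc_nonneg _))
  rw [integral_const_mul] at hlow
  linarith

/-- A globally defined nonnegative function solving `uₜ = Δu + u^p` in the cylinder of radius `r`. -/
structure PSol (p r : ℝ) (u u' : E2 → ℝ → ℝ) (a b R M : ℝ) : Prop where
  reg : GReg u u' a b R M
  nonneg : ∀ x, ∀ t ∈ Ioo a b, 0 ≤ u x t
  eq : ∀ x, ‖x‖ ≤ r → ∀ t ∈ Ioo a b, u' x t = lap (fun y => u y t) x + u x t ^ p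

section
variable {p r : ℝ} {u u' : E2 → ℝ → ℝ} {a b R M : ℝ}

lemma PSol.mono (S : PSol p r u u' a b R M) {a' b' r' : ℝ} (ha : a ≤ a') (hb : b' ≤ b)
    (hr : r' ≤ r) : PSol p r' u u' a' b' R M :=
  ⟨S.reg.mono ha hb, fun x t ht => S.nonneg x t (Ioo_subset_Ioo ha hb ht),
    fun x hx t ht => S.eq x (hx.trans hr) t (Ioo_subset_Ioo ha hb ht)⟩

lemma PSol.rpow_continuous (S : PSol p r u u' a b R M) {q : ℝ} (hq : 0 ≤ q) {t : ℝ}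
    (ht : t ∈ Ioo a b) : Continuous fun x => u x t ^ q :=
  (S.reg.cx ht).rpow_const fun _ => Or.inr hq

lemma PSol.rpow_integrable (S : PSol p r u u' a b R M) {q : ℝ} (hq : 0 < q) {t : ℝ}
    (ht : t ∈ Ioo a b) {φ : E2 → ℝ} (hφ : Continuous φ) : Integrable fun x => u x t ^ q * φ x :=
  VanishOff.integrable (R := R) (fun x hx => by
    simp [S.reg.van t ht x hx, Real.zero_rpow hq.ne']) ((S.rpow_continuous hq.le ht).mul hφ)

lemma PSol.rpow_le (S : PSol p r u u' a b R M) {q : ℝ} (hq : 0 ≤ q) {t : ℝ}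
    (ht : t ∈ Ioo a b) (x : E2) : u x t ^ q ≤ M ^ q :=
  Real.rpow_le_rpow (S.nonneg x t ht) ((le_abs_self _).trans (S.reg.bd x t ht)) hq

lemma PSol.rpow_integral_continuousOn (S : PSol p r u u' a b R M) {q : ℝ} (hq : 0 < q)
    {φ : E2 → ℝ} (hφ : Continuous φ) {ρ : ℝ} (hv : VanishOff ρ φ) :
    ContinuousOn (fun t => ∫ x, u x t ^ q * φ x) (Ioo a b) := by
  obtain ⟨K, hK⟩ := (isCompact_closedBall (0 : E2) ρ).exists_bound_of_continuousOn hφ.continuousOn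
  refine continuousOn_integral_of_vanish (R := ρ) (M := M ^ q * |K|)
    (fun t ht => (S.rpow_continuous hq.le ht).mul hφ) (fun x => ?_) (fun x t ht => ?_)
    (fun t ht => hv.mul_left _)
  · exact ((S.reg.ctv x).rpow_const fun _ _ => Or.inr hq.le).mul continuousOn_const
  · have h1 := S.rpow_le hq.le ht x
    have h0 := Real.rpow_nonneg (S.nonneg x t ht) q
    by_cases hx : ρ < ‖x‖
    · rw [hv x hx]; simp only [mul_zero, abs_zero]; have := h0.trans h1; positivity
    · rw [abs_mul, abs_of_nonneg h0]
      have := hK x (by simpa using hx)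
      exact mul_le_mul h1 (this.trans (le_abs_self _)) (abs_nonneg _) (h0.trans h1)

lemma PSol.integral_eq (S : PSol p r u u' a b R M) (hp : 0 < p) {φ : E2 → ℝ} (hφ : ContDiff ℝ 2 φ)
    (hv : VanishOff r φ) {t : ℝ} (ht : t ∈ Ioo a b) :
    ∫ x, u' x t * φ x = (∫ x, u x t * lap φ x) + ∫ x, u x t ^ p * φ x := by
  rw [← S.reg.green hφ ht, ← integral_add (S.reg.integrable_lap_mul hφ.continuous ht)
    (S.rpow_integrable hp ht hφ.continuous)]
  refine integral_congr_ae (ae_of_all _ fun x => ?_)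
  simp only
  by_cases hx : ‖x‖ ≤ r
  · rw [S.eq x hx t ht]; ring
  · simp [hv x (not_le.1 hx)]

end

/-- Young's inequality in the form used for test functions. -/
lemma mul_le_half_rpow {p C₀ : ℝ} (hp : 1 < p) (hC₀ : 0 < C₀) {k : ℕ} (hk : 2 * (1 / (p - 1)) ≤ k + 1)
    {q y : ℝ} (hq0 : 0 ≤ q) (hq1 : q ≤ 1) (hy : 0 ≤ y) :
    C₀ * q ^ (k + 1) * y ≤ 1 / 2 * (q ^ (k + 3) * y ^ p) + C₀ * (2 * C₀) ^ (1 / (p - 1)) := by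
  have hp1 : 0 < p - 1 := by linarith
  have hyp : y ^ p = y * y ^ (p - 1) := by
    rw [← Real.rpow_one_add' hy (by linarith)]; congr 1; ring
  have h0 : 0 ≤ y ^ (p - 1) := by positivity
  rcases le_total (2 * C₀) (q ^ 2 * y ^ (p - 1)) with h | h
  · have : C₀ * q ^ (k + 1) * y ≤ 1 / 2 * (q ^ (k + 3) * y ^ p) := by
      rw [hyp]
      calc C₀ * q ^ (k + 1) * y = 1 / 2 * (q ^ (k + 1) * y) * (2 * C₀) := by ring
        _ ≤ 1 / 2 * (q ^ (k + 1) * y) * (q ^ 2 * y ^ (p - 1)) := by gcongr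
        _ = _ := by ring
    have : 0 ≤ C₀ * (2 * C₀) ^ (1 / (p - 1)) := by positivity
    linarith
  · have h1 : q ^ (k + 1) * y ≤ (2 * C₀) ^ (1 / (p - 1)) := by
      rcases hq0.eq_or_lt with h2 | h2
      · subst h2; simp; positivity
      calc q ^ (k + 1) * y ≤ q ^ (2 * (1 / (p - 1))) * y := by
            gcongr
            rw [← Real.rpow_natCast]
            exact Real.rpow_le_rpow_of_exponent_ge h2 hq1 (by push_cast; exact hk)
        _ = (q ^ 2 * y ^ (p - 1)) ^ (1 / (p - 1)) := by
            rw [Real.mul_rpow (by positivity) h0, ← Real.rpow_mul hy, ← Real.rpow_natCast,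
              ← Real.rpow_mul hq0, mul_one_div_cancel hp1.ne', Real.rpow_one]
            norm_num
        _ ≤ _ := by gcongr
    have h2 : 0 ≤ 1 / 2 * (q ^ (k + 3) * y ^ p) := by positivity
    have := mul_le_mul_of_nonneg_left h1 hC₀.le
    linarith

/-- Universal bound for the space-time integral of `u ^ p`. -/
lemma exists_integral_rpow_le {p : ℝ} (hp : 1 < p) : ∃ C > 0, ∀ (u u' : E2 → ℝ → ℝ) (a b R M : ℝ),
    PSol p 4 u u' a b R M → a < -4 → 4 < b →
    ∫ τ in (-2)..2, ∫ x, u x τ ^ p * bump 1 8 x ≤ C := by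
  obtain ⟨k, hk⟩ := exists_nat_ge (2 * (1 / (p - 1)))
  have hp0 : 0 < p := by linarith
  set m : ℝ := k + 3 with hm
  set C₀ : ℝ := m + 4 * m ^ 2 / 16 with hC₀
  have hmp : 0 < m := by positivity
  have hC₀p : 0 < C₀ := by positivity
  set C₁ : ℝ := C₀ * (2 * C₀) ^ (1 / (p - 1)) with hC₁
  have hC₁p : 0 < C₁ := by positivity
  set ψ : E2 → ℝ := bump (k + 3) (4 ^ 2) with hψ
  have ψC : ContDiff ℝ 2 ψ := bump_contDiff k _
  have ψV : VanishOff 4 ψ := bump_vanish (k + 3) (by omega) (by norm_num)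
  set ξ : E2 → ℝ := fun x => 2 * bump 1 (6 ^ 2) x with hξ
  have ξc : Continuous ξ := (bump_continuous _ _).const_mul 2 
  have ξi : Integrable ξ := VanishOff.integrable (R := 6)
    ((bump_vanish 1 (by norm_num) (by norm_num)).mul_left (fun _ => 2)) ξc
  have ξ0 : ∀ x, 0 ≤ ξ x := fun x => mul_nonneg zero_le_two (bump_nonneg _ _ _)
  have ξ1 : ∀ x, ‖x‖ ≤ 4 → 1 ≤ ξ x := fun x hx => by
    have := le_bump 1 (ρ := 6 ^ 2) (r := 16) (by norm_num) (by norm_num) (x := x)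
      (by nlinarith [norm_nonneg x])
    simp only [hξ]; norm_num at this ⊢; linarith
  set X := ∫ x, ξ x with hX
  have hX0 : 0 ≤ X := integral_nonneg ξ0
  refine ⟨(2 * (4 / 3)) ^ (k + 3) * (16 * (C₁ * X)) + 1, by positivity, ?_⟩
  intro u u' a b R M S ha hb
  set η : ℝ → ℝ := fun t => max (1 - t ^ 2 / 16) 0 ^ (k + 3) with hη
  set η' : ℝ → ℝ := fun t => m * max (1 - t ^ 2 / 16) 0 ^ (k + 2) * (-(t / 8)) with hη'
  have ηd : ∀ t, HasDerivAt η (η' t) t := fun t => by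
    have h := (hasDerivAt_pos_pow (k + 1) (1 - t ^ 2 / 16)).comp t
      (((hasDerivAt_pow 2 t).div_const 16).const_sub 1)
    exact h.congr_deriv (by simp only [hη', hm]; push_cast; ring)
  have ηc : Continuous η := by fun_prop
  have hsub : Icc (-4 : ℝ) 4 ⊆ Ioo a b := fun t ht => ⟨ha.trans_le ht.1, ht.2.trans_lt hb⟩
  have cP : ContinuousOn (fun t => ∫ x, u x t ^ p * ψ x) (Icc (-4) 4) :=
    (S.rpow_integral_continuousOn hp0 ψC.continuous ψV).mono hsub
  have main := integral_le_sub_of_hasDerivAt (s := -4) (t := 4) (by norm_num)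
    (f := fun t => η t * ∫ x, u x t * ψ x)
    (f' := fun t => η' t * (∫ x, u x t * ψ x) + η t * ∫ x, u' x t * ψ x)
    (g := fun t => 1 / 2 * (η t * ∫ x, u x t ^ p * ψ x) - C₁ * X)
    (fun t ht => (ηd t).mul (S.reg.hasDerivAt_integral_const ψC.continuous (hsub ht)))
    (by fun_prop) (fun t ht => ?_)
  · have e0 : η 4 = 0 ∧ η (-4) = 0 := by constructor <;> simp [hη] <;> norm_num
    have ci : IntervalIntegrable (fun t => 1 / 2 * (η t * ∫ x, u x t ^ p * ψ x)) volume (-4) 4 :=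
      ContinuousOn.intervalIntegrable_of_Icc (by norm_num) (by fun_prop)
    rw [intervalIntegral.integral_sub ci (by simp), intervalIntegral.integral_const_mul, e0.1, e0.2]
      at main
    simp at main
    have nn : ∀ t ∈ Icc (-4 : ℝ) 4, 0 ≤ ∫ x, u x t ^ p * ψ x := fun t ht =>
      integral_nonneg fun x => mul_nonneg (Real.rpow_nonneg (S.nonneg x t (hsub ht)) _)
        (bump_nonneg _ _ _)
    have ηn : ∀ t, 0 ≤ η t := fun t => by simp only [hη]; positivity
    have s1 : ∫ τ in (-2)..2, ∫ x, u x τ ^ p * bump 1 8 x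
        ≤ ∫ τ in (-2)..2, (2 * (4 / 3)) ^ (k + 3) * (η τ * ∫ x, u x τ ^ p * ψ x) := by
      have hsub2 : Icc (-2 : ℝ) 2 ⊆ Icc (-4) 4 := Icc_subset_Icc (by norm_num) (by norm_num)
      have b1 : VanishOff 3 (bump 1 8) := fun x hx => by
        have : 1 - ‖x‖ ^ 2 / 8 ≤ 0 := by nlinarith
        simp [bump, this]
      refine intervalIntegral.integral_mono_on (by norm_num) ?_ ?_ fun t ht => ?_
      · exact ((S.rpow_integral_continuousOn hp0 (bump_continuous 1 8) b1).mono
          (hsub2.trans hsub)).intervalIntegrable_of_Icc (by norm_num)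
      · refine ContinuousOn.intervalIntegrable_of_Icc (by norm_num) ?_
        have := cP.mono hsub2
        fun_prop
      · have hη1 : (3 / 4 : ℝ) ^ (k + 3) ≤ η t := by
          refine pow_le_pow_left₀ (by norm_num) (le_max_of_le_left ?_) _
          nlinarith [ht.1, ht.2]
        have hψ1 : ∫ x, u x t ^ p * bump 1 8 x ≤ 2 ^ (k + 3) * ∫ x, u x t ^ p * ψ x := by
          rw [← integral_const_mul]
          refine integral_mono (S.rpow_integrable hp0 (hsub (hsub2 ht)) (bump_continuous _ _))
            ((S.rpow_integrable hp0 (hsub (hsub2 ht)) ψC.continuous).const_mul _) fun x => ?_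
          have u0 := Real.rpow_nonneg (S.nonneg x t (hsub (hsub2 ht))) p
          have : bump 1 8 x ≤ 2 ^ (k + 3) * ψ x := by
            by_cases hx : ‖x‖ ^ 2 ≤ 8
            · have h := le_bump (k + 3) (ρ := 4 ^ 2) (r := 8) (by norm_num) (by norm_num) hx
              have h2 : (2 : ℝ) ^ (k + 3) * (1 - 8 / 4 ^ 2) ^ (k + 3) = 1 := by
                rw [← mul_pow]; norm_num
              calc bump 1 8 x ≤ 1 := bump_le_one _ (by norm_num) _
                _ = (2 : ℝ) ^ (k + 3) * (1 - 8 / 4 ^ 2) ^ (k + 3) := h2.symm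
                _ ≤ _ := by gcongr
            · have : 1 - ‖x‖ ^ 2 / 8 ≤ 0 := by linarith
              simp only [bump, max_eq_right this]
              simp only [pow_one]
              exact mul_nonneg (by positivity) (bump_nonneg _ _ _)
          calc _ ≤ u x t ^ p * (2 ^ (k + 3) * ψ x) := mul_le_mul_of_nonneg_left this u0
            _ = _ := by ring
        refine hψ1.trans ?_
        have n1 := nn t (hsub2 ht)
        calc _ = 2 ^ (k + 3) * ((4 / 3 : ℝ) ^ (k + 3) * (3 / 4) ^ (k + 3)
              * ∫ x, u x t ^ p * ψ x) := by rw [← mul_pow]; norm_num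
          _ ≤ 2 ^ (k + 3) * ((4 / 3 : ℝ) ^ (k + 3) * η t * ∫ x, u x t ^ p * ψ x) := by gcongr
          _ = _ := by rw [mul_pow]; ring
    have s2 : ∫ τ in (-2)..2, η τ * ∫ x, u x τ ^ p * ψ x
        ≤ ∫ τ in (-4)..4, η τ * ∫ x, u x τ ^ p * ψ x := by
      refine intervalIntegral.integral_mono_interval (by norm_num) (by norm_num) (by norm_num) ?_
        (ContinuousOn.intervalIntegrable_of_Icc (by norm_num) (by fun_prop))
      filter_upwards [ae_restrict_mem measurableSet_Ioc] with t ht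
      exact mul_nonneg (ηn t) (nn t ⟨ht.1.le, ht.2⟩)
    rw [intervalIntegral.integral_const_mul] at s1
    have s3 : (∫ τ in (-4)..4, η τ * ∫ x, u x τ ^ p * ψ x) ≤ 16 * (C₁ * X) := by linarith
    have s4 := mul_le_mul_of_nonneg_left (s2.trans s3)
      (by positivity : (0 : ℝ) ≤ (2 * (4 / 3)) ^ (k + 3))
    linarith
  · have hab := hsub ht
    rw [S.integral_eq hp0 ψC ψV hab]
    have i1 := S.reg.integrable_mul ψC.continuous hab
    have i2 := S.reg.integrable_mul (continuous_lap ψC) hab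
    have i3 := S.rpow_integrable hp0 hab ψC.continuous
    have ij : Integrable fun x => η' t * (u x t * ψ x) + η t * (u x t * lap ψ x) :=
      (i1.const_mul _).add (i2.const_mul _)
    have key : ∫ x, -(η' t * (u x t * ψ x) + η t * (u x t * lap ψ x))
        ≤ ∫ x, (1 / 2 * (η t * (u x t ^ p * ψ x)) + C₁ * ξ x) := by
      refine integral_mono ij.neg (((i3.const_mul _).const_mul _).add (ξi.const_mul _)) fun x => ?_
      have u0 := S.nonneg x t hab
      by_cases hx : ‖x‖ ≤ 4
      · set qt := max (1 - t ^ 2 / 16) 0 with hqt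
        set qx := max (1 - ‖x‖ ^ 2 / 4 ^ 2) 0 with hqx
        have qt0 : 0 ≤ qt := le_max_right _ _
        have qx0 : 0 ≤ qx := le_max_right _ _
        have qt1 : qt ≤ 1 := max_le (by nlinarith [sq_nonneg t]) zero_le_one
        have qx1 : qx ≤ 1 := max_le (by nlinarith [sq_nonneg ‖x‖]) zero_le_one
        have a1 : |η' t| ≤ m * qt ^ (k + 1) := by
          have h0 : η' t = m * qt ^ (k + 2) * (-(t / 8)) := rfl
          rw [h0, abs_mul, abs_mul, abs_neg, abs_of_pos hmp, abs_pow, abs_of_nonneg qt0]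
          have h1 : |t / 8| ≤ 1 := by rw [abs_le]; constructor <;> linarith [ht.1, ht.2]
          calc m * qt ^ (k + 2) * |t / 8| ≤ m * qt ^ (k + 1) * 1 := by
                have := pow_le_pow_of_le_one qt0 qt1 (by omega : k + 1 ≤ k + 2)
                gcongr
            _ = _ := mul_one _
        have a2 : ψ x ≤ qx ^ (k + 1) := by
          simp only [hψ, bump]
          exact pow_le_pow_of_le_one qx0 qx1 (by omega)
        have a3 : |lap ψ x| ≤ 4 * m ^ 2 / 16 * qx ^ (k + 1) := by
          have := abs_lap_bump_le k (ρ := 4 ^ 2) (by norm_num) x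
          refine this.trans (le_of_eq ?_)
          simp only [bump, hm, ← hqx]; norm_num
        have a4 : η t ≤ qt ^ (k + 1) := pow_le_pow_of_le_one qt0 qt1 (by omega)
        have ηn : 0 ≤ η t := by simp only [hη]; positivity
        have ψn : 0 ≤ ψ x := bump_nonneg _ _ _
        have A : -(η' t * ψ x + η t * lap ψ x) ≤ C₀ * (qt * qx) ^ (k + 1) := by
          have h1 : -(η' t * ψ x) ≤ m * qt ^ (k + 1) * qx ^ (k + 1) := by
            rw [← neg_mul]
            exact mul_le_mul ((neg_le_abs _).trans a1) a2 ψn (by positivity)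
          have h2 : -(η t * lap ψ x) ≤ qt ^ (k + 1) * (4 * m ^ 2 / 16 * qx ^ (k + 1)) := by
            rw [← mul_neg]
            calc _ ≤ η t * |lap ψ x| := mul_le_mul_of_nonneg_left (neg_le_abs _) ηn
              _ ≤ _ := mul_le_mul a4 a3 (abs_nonneg _) (by positivity)
          rw [mul_pow]; simp only [hC₀]; linarith
        have Y := mul_le_half_rpow hp hC₀p (k := k) (by linarith) (mul_nonneg qt0 qx0)
          (mul_le_one₀ qt1 qx0 qx1) u0
        have e : (qt * qx) ^ (k + 3) = η t * ψ x := by simp only [hη, hψ, bump, mul_pow]; rfl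
        rw [e] at Y
        have B := mul_le_mul_of_nonneg_right A u0
        have D := mul_le_mul_of_nonneg_left (ξ1 x hx) hC₁p.le
        simp only; linarith
      · have z1 := ψV x (not_le.1 hx)
        have z2 := ψV.lap x (not_le.1 hx)
        simp only [z1, z2, mul_zero, add_zero, neg_zero, zero_add]
        exact mul_nonneg hC₁p.le (ξ0 x)
    rw [integral_neg, integral_add (i1.const_mul _) (i2.const_mul _), integral_const_mul,
      integral_const_mul, integral_add ((i3.const_mul _).const_mul _) (ξi.const_mul _),
      integral_const_mul, integral_const_mul, integral_const_mul] at key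
    linarith

lemma gd_mul_left {f g h : E2 → ℝ} (hf : ContDiff ℝ 2 f) (hg : ContDiff ℝ 2 g) (x : E2) :
    gd (fun y => f y * g y) h x = f x * gd g h x + g x * gd f h x := by
  simp only [gd, pd_mul (hf.diffAt x) (hg.diffAt x), Finset.mul_sum, ← Finset.sum_add_distrib]
  exact Finset.sum_congr rfl fun i _ => by ring

lemma gd_self_nonneg (f : E2 → ℝ) (x : E2) : 0 ≤ gd f f x :=
  Finset.sum_nonneg fun _ _ => mul_self_nonneg _

/-- Difference of two Dirichlet energies. -/
lemma integral_gd_sub {R : ℝ} {φ v w : E2 → ℝ} (hφ : ContDiff ℝ 2 φ) (hv : ContDiff ℝ 2 v)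
    (hw : ContDiff ℝ 2 w) (hR : VanishOff R φ) :
    1 / 2 * (∫ x, φ x * gd w w x) - 1 / 2 * (∫ x, φ x * gd v v x)
      = ∫ x, (w x - v x) * (-(1 / 2) * (lap w x + lap v x) * φ x - gd φ v x
          + 1 / 4 * (w x - v x) * lap φ x) := by
  set z : E2 → ℝ := fun y => w y - v y with hz
  have zc : ContDiff ℝ 2 z := hw.sub hv
  have c1 := (continuous_gd hw hw); have c2 := continuous_gd hv hv
  have c3 := continuous_gd zc hv; have c4 := continuous_gd zc zc
  have c5 := continuous_gd hφ hv; have c6 := continuous_lap hφ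
  have c7 := continuous_lap hw; have c8 := continuous_lap hv
  have c9 := zc.continuous; have c0 := hφ.continuous
  have i1 : Integrable fun x => φ x * gd w w x := (hR.mul_right _).integrable (c0.mul c1)
  have i2 : Integrable fun x => φ x * gd v v x := (hR.mul_right _).integrable (c0.mul c2)
  have i3 : Integrable fun x => φ x * gd z v x := (hR.mul_right _).integrable (c0.mul c3)
  have i4 : Integrable fun x => φ x * gd z z x := (hR.mul_right _).integrable (c0.mul c4)
  have e1 : (∫ x, φ x * gd w w x) - (∫ x, φ x * gd v v x)
      = 2 * (∫ x, φ x * gd z v x) + ∫ x, φ x * gd z z x := by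
    rw [← integral_sub i1 i2, ← integral_const_mul, ← integral_add (i3.const_mul 2) i4]
    refine integral_congr_ae (ae_of_all _ fun x => ?_)
    simp only [hz, gd_sub_left hw hv, gd_comm (f := w) (g := fun y => w y - v y),
      gd_comm (f := v) (g := fun y => w y - v y)]
    rw [gd_comm (f := v) (g := w)]; ring
  have i5 : Integrable fun x => z x * φ x * lap v x :=
    VanishOff.integrable (R := R) ((hR.mul_left z).mul_right _) ((c9.mul c0).mul c8)
  have i6 : Integrable fun x => z x * gd φ v x :=
    VanishOff.integrable (R := R) ((hR.gd v).mul_left z) (c9.mul c5)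
  have e2 : ∫ x, φ x * gd z v x = -(∫ x, z x * φ x * lap v x) - ∫ x, z x * gd φ v x := by
    rw [integral_mul_lap (φ := fun x => z x * φ x) (zc.mul hφ) hv (hR.mul_left z), neg_neg]
    simp only [gd_mul_left zc hφ]
    rw [integral_add i6 i3]; ring
  have e3 := integral_gd_self_mul hφ zc hR
  have i7 : Integrable fun x => -(φ x * (z x * lap z x)) + 1 / 2 * (z x * z x * lap φ x) := by
    refine VanishOff.integrable (R := R) (fun x hx => ?_) ?_
    · simp [hR x hx, hR.lap x hx]
    · have := continuous_lap zc; fun_prop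
  calc _ = 1 / 2 * ((∫ x, φ x * gd w w x) - (∫ x, φ x * gd v v x)) := by ring
    _ = -(∫ x, z x * φ x * lap v x) - (∫ x, z x * gd φ v x)
        + 1 / 2 * ∫ x, -(φ x * (z x * lap z x)) + 1 / 2 * (z x * z x * lap φ x) := by
          rw [e1, e2, e3]; ring
    _ = ∫ x, (-(z x * φ x * lap v x) - z x * gd φ v x
        + 1 / 2 * (-(φ x * (z x * lap z x)) + 1 / 2 * (z x * z x * lap φ x))) := by
          have i8 : Integrable fun x => -(z x * φ x * lap v x) := i5.neg
          have i9 : Integrable fun x => -(z x * φ x * lap v x) - z x * gd φ v x := i8.sub i6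
          rw [integral_add i9 (i7.const_mul _), integral_sub i8 i6, integral_neg,
            integral_const_mul]
    _ = _ := by
          refine integral_congr_ae (ae_of_all _ fun x => ?_)
          simp only [hz, lap_sub hw hv]; ring

lemma GReg.sq {v v' : E2 → ℝ → ℝ} {a b R M : ℝ} (h : GReg v v' a b R M) :
    GReg (fun x t => v x t * v x t) (fun x t => 2 * (v x t * v' x t)) a b R (2 * (M * M)) where
  c2 t ht := (h.c2 t ht).mul (h.c2 t ht)
  c0 t ht := ((h.cx ht).mul (h.c0 t ht)).const_mul 2 
  der x t ht := ((h.der x t ht).mul (h.der x t ht)).congr_deriv (by ring)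
  ct x := ((h.ctv x).mul (h.ct x)).const_mul 2
  bd x t ht := by
    have h1 := h.bd x t ht
    have h0 := abs_nonneg (v x t)
    rw [abs_mul]; nlinarith
  bd' x t ht := by
    have h1 := h.bd x t ht
    have h0 := abs_nonneg (v x t)
    have h2 := h.bd' x t ht
    rw [abs_mul, abs_mul, abs_two]
    have := mul_le_mul h1 h2 (abs_nonneg _) (h0.trans h1)
    linarith
  van t ht := (h.van t ht).mul_left _
  van' t ht := ((h.van' t ht).mul_left _).mul_left _

lemma GReg.continuousOn_integral' {v v' : E2 → ℝ → ℝ} {a b R M : ℝ} (h : GReg v v' a b R M)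
    {φ : E2 → ℝ} (hφ : Continuous φ) :
    ContinuousOn (fun t => ∫ x, v' x t * φ x) (Ioo a b) := by
  obtain ⟨K, hK⟩ := (isCompact_closedBall (0 : E2) R).exists_bound_of_continuousOn hφ.continuousOn
  refine continuousOn_integral_of_vanish (R := R) (M := M * |K|)
    (fun t ht => (h.c0 t ht).mul hφ) (fun x => (h.ct x).mul continuousOn_const)
    (fun x t ht => ?_) (fun t ht => (h.van' t ht).mul_right _)
  have h1 := h.bd' x t ht
  by_cases hx : R < ‖x‖
  · have := h.van' t ht x hx
    simp only at this
    rw [this]; simp only [zero_mul, abs_zero]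
    exact mul_nonneg ((abs_nonneg _).trans h1) (abs_nonneg _)
  · rw [abs_mul]
    have := hK x (by simpa using hx)
    exact mul_le_mul h1 (this.trans (le_abs_self _)) (abs_nonneg _) ((abs_nonneg _).trans h1)

section
variable {p r : ℝ} {u u' : E2 → ℝ → ℝ} {a b R M : ℝ}

lemma PSol.integral_gd (S : PSol p r u u' a b R M) (hp : 1 < p) {φ : E2 → ℝ} (hφ : ContDiff ℝ 2 φ)
    (hv : VanishOff r φ) {t : ℝ} (ht : t ∈ Ioo a b) :
    ∫ x, φ x * gd (fun y => u y t) (fun y => u y t) x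
      = -(1 / 2) * (∫ x, 2 * (u x t * u' x t) * φ x) + (∫ x, u x t ^ (p + 1) * φ x)
        + 1 / 2 * ∫ x, u x t * u x t * lap φ x := by
  have i1 := S.reg.sq.integrable_mul' hφ.continuous ht
  have i2 := S.rpow_integrable (q := p + 1) (by linarith) ht hφ.continuous
  have i3 := S.reg.sq.integrable_mul (continuous_lap hφ) ht
  have i4 : Integrable fun x => -(1 / 2) * (2 * (u x t * u' x t) * φ x) + u x t ^ (p + 1) * φ x :=
    (i1.const_mul _).add i2
  rw [integral_gd_self_mul hφ (S.reg.c2 t ht) hv, ← integral_const_mul, ← integral_const_mul,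
    ← integral_add (i1.const_mul _) i2, ← integral_add i4 (i3.const_mul _)]
  refine integral_congr_ae (ae_of_all _ fun x => ?_)
  simp only
  by_cases hx : ‖x‖ ≤ r
  · rw [S.eq x hx t ht, Real.rpow_add_one' (S.nonneg x t ht) (by linarith)]; ring
  · simp [hv x (not_le.1 hx)]

lemma PSol.continuousOn_gd (S : PSol p r u u' a b R M) (hp : 1 < p) {φ : E2 → ℝ}
    (hφ : ContDiff ℝ 2 φ) (hv : VanishOff r φ) :
    ContinuousOn (fun t => ∫ x, φ x * gd (fun y => u y t) (fun y => u y t) x) (Ioo a b) := by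
  have c1 := S.reg.sq.continuousOn_integral' hφ.continuous
  have c2 := S.rpow_integral_continuousOn (q := p + 1) (by linarith) hφ.continuous hv
  have c3 := S.reg.sq.continuousOn_integral (continuous_lap hφ)
  exact (((c1.const_mul _).add c2).add (c3.const_mul _)).congr fun t ht => S.integral_gd hp hφ hv ht

lemma PSol.hasDerivAt_gd (S : PSol p r u u' a b R M) (hp : 1 < p) {φ : E2 → ℝ}
    (hφ : ContDiff ℝ 2 φ) (hv : VanishOff r φ) {t : ℝ} (ht : t ∈ Ioo a b) :
    HasDerivAt (fun τ => 1 / 2 * ∫ x, φ x * gd (fun y => u y τ) (fun y => u y τ) x)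
      (∫ x, u' x t * (-((u' x t - u x t ^ p) * φ x) - gd φ (fun y => u y t) x)) t := by
  have hp0 : 0 < p := by linarith
  have hM0 : 0 ≤ M := (abs_nonneg _).trans (S.reg.bd 0 t ht)
  set L : E2 → ℝ := fun x => lap (fun y => u y t) x with hL
  set k : E2 → ℝ → ℝ := fun x τ => -(1 / 2) * ((u' x τ - u x τ ^ p) + L x) * φ x
    - gd φ (fun y => u y t) x + 1 / 4 * (u x τ - u x t) * lap φ x with hk
  have cL : Continuous L := continuous_lap (S.reg.c2 t ht)
  have cG := continuous_gd hφ (S.reg.c2 t ht)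
  have cl := continuous_lap hφ
  have cφ := hφ.continuous
  have ev : ∀ᶠ τ in 𝓝 t, τ ∈ Ioo a b := Ioo_mem_nhds ht.1 ht.2
  have kv : ∀ τ, VanishOff r fun x => k x τ := fun τ x hx => by
    simp [hk, hv x hx, (hv.gd _) x hx, hv.lap x hx]
  have ck : ∀ τ ∈ Ioo a b, Continuous fun x => k x τ := fun τ hτ => by
    have h1 := S.reg.c0 τ hτ
    have h2 := S.rpow_continuous hp0.le hτ
    have h3 := S.reg.cx hτ
    have h4 := S.reg.cx ht
    fun_prop
  obtain ⟨B₁, hB₁⟩ := (isCompact_closedBall (0 : E2) r).exists_bound_of_continuousOn cφ.continuousOn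
  obtain ⟨B₂, hB₂⟩ := (isCompact_closedBall (0 : E2) r).exists_bound_of_continuousOn cL.continuousOn
  obtain ⟨B₃, hB₃⟩ := (isCompact_closedBall (0 : E2) r).exists_bound_of_continuousOn cG.continuousOn
  obtain ⟨B₄, hB₄⟩ := (isCompact_closedBall (0 : E2) r).exists_bound_of_continuousOn cl.continuousOn
  have kb : ∃ K ≥ 0, ∀ τ ∈ Ioo a b, ∀ x, |k x τ| ≤ K := by
    refine ⟨1 / 2 * (M + M ^ p + |B₂|) * |B₁| + |B₃| + 1 / 4 * (M + M) * |B₄|, by positivity,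
      fun τ hτ x => ?_⟩
    by_cases hx : ‖x‖ ≤ r
    · have q : x ∈ Metric.closedBall (0 : E2) r := by simpa using hx
      have b1 : |φ x| ≤ |B₁| := (hB₁ x q).trans (le_abs_self _)
      have b2 : |L x| ≤ |B₂| := (hB₂ x q).trans (le_abs_self _)
      have b3 : |gd φ (fun y => u y t) x| ≤ |B₃| := (hB₃ x q).trans (le_abs_self _)
      have b4 : |lap φ x| ≤ |B₄| := (hB₄ x q).trans (le_abs_self _)
      have b5 := S.reg.bd' x τ hτ
      have b6 : |u x τ ^ p| ≤ M ^ p := by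
        rw [abs_of_nonneg (Real.rpow_nonneg (S.nonneg x τ hτ) _)]; exact S.rpow_le hp0.le hτ x
      have b7 := S.reg.bd x τ hτ
      have b8 := S.reg.bd x t ht
      refine (abs_add_le _ _).trans (add_le_add ((abs_sub _ _).trans (add_le_add ?_ b3)) ?_)
      · rw [abs_mul, abs_mul, abs_neg, abs_of_pos (by norm_num : (0 : ℝ) < 1 / 2)]
        have : |u' x τ - u x τ ^ p + L x| ≤ M + M ^ p + |B₂| :=
          (abs_add_le _ _).trans (add_le_add ((abs_sub _ _).trans (add_le_add b5 b6)) b2)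
        gcongr
      · rw [abs_mul, abs_mul, abs_of_pos (by norm_num : (0 : ℝ) < 1 / 4)]
        have : |u x τ - u x t| ≤ M + M := (abs_sub _ _).trans (add_le_add b7 b8)
        gcongr
    · rw [show k x τ = 0 from kv τ x (not_le.1 hx)]; simp only [abs_zero]; positivity
  obtain ⟨K, hK0, hK⟩ := kb
  have key : HasDerivAt (fun τ => ∫ x, (u x τ - u x t) * k x τ) (∫ x, u' x t * k x t) t := by
    refine hasDerivAt_integral_of_vanish (R := r) (M := M * K) ?_ ((S.reg.c0 t ht).mul (ck t ht))
      (fun x => ?_) ?_ (Eventually.of_forall fun τ => (kv τ).mul_left _)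
    · filter_upwards [ev] with τ hτ
      exact ((S.reg.cx hτ).sub (S.reg.cx ht)).mul (ck τ hτ)
    · have cu' : ContinuousAt (u' x) t := (S.reg.ct x).continuousAt (Ioo_mem_nhds ht.1 ht.2)
      have cu : ContinuousAt (u x) t := (S.reg.der x t ht).continuousAt
      have cup : ContinuousAt (fun τ => u x τ ^ p) t := cu.rpow_const (Or.inr hp0.le)
      have ckt : ContinuousAt (k x) t := by simp only [hk]; fun_prop
      have hw := S.reg.der x t ht
      rw [hasDerivAt_iff_tendsto_slope] at hw ⊢
      refine (hw.mul (ckt.tendsto.mono_left nhdsWithin_le_nhds)).congr fun τ => ?_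
      simp only [slope_def_field]; ring
    · filter_upwards [ev] with τ hτ x
      simp only [sub_self, zero_mul, sub_zero]
      rw [abs_mul, mul_right_comm]
      exact mul_le_mul (S.reg.lip x hτ ht) (hK τ hτ x) (abs_nonneg _) (by positivity)
  have e1 : (∫ x, u' x t * k x t)
      = ∫ x, u' x t * (-((u' x t - u x t ^ p) * φ x) - gd φ (fun y => u y t) x) := by
    refine integral_congr_ae (ae_of_all _ fun x => ?_)
    simp only [hk]
    by_cases hx : ‖x‖ ≤ r
    · have := S.eq x hx t ht
      rw [show L x = u' x t - u x t ^ p by simp only [hL]; linarith]; ring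
    · simp [hv x (not_le.1 hx)]
  rw [e1] at key
  refine (key.add_const (1 / 2 * ∫ x, φ x * gd (fun y => u y t) (fun y => u y t) x)
    ).congr_of_eventuallyEq ?_
  filter_upwards [ev] with τ hτ
  have := integral_gd_sub hφ (S.reg.c2 t ht) (S.reg.c2 τ hτ) hv
  rw [← sub_eq_iff_eq_add, this]
  refine integral_congr_ae (ae_of_all _ fun x => ?_)
  simp only [hk]
  by_cases hx : ‖x‖ ≤ r
  · rw [S.eq x hx τ hτ]; simp only [hL]; ring
  · simp [hv x (not_le.1 hx)]

lemma PSol.hasDerivAt_rpow (S : PSol p r u u' a b R M) {q : ℝ} (hq : 1 ≤ q) {φ : E2 → ℝ}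
    (hφ : Continuous φ) {t : ℝ} (ht : t ∈ Ioo a b) :
    HasDerivAt (fun τ => ∫ x, u x τ ^ q * φ x) (∫ x, u' x t * q * u x t ^ (q - 1) * φ x) t := by
  have hM0 : 0 ≤ M := (abs_nonneg _).trans (S.reg.bd 0 t ht)
  obtain ⟨K, hK⟩ := (isCompact_closedBall (0 : E2) R).exists_bound_of_continuousOn hφ.continuousOn
  have ev : ∀ᶠ τ in 𝓝 t, τ ∈ Ioo a b := Ioo_mem_nhds ht.1 ht.2
  have hd : ∀ x, ∀ τ ∈ Ioo a b, HasDerivAt (fun τ => u x τ ^ q * φ x)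
      (u' x τ * q * u x τ ^ (q - 1) * φ x) τ := fun x τ hτ =>
    ((S.reg.der x τ hτ).rpow_const (Or.inr hq)).mul_const _
  have hv : ∀ τ ∈ Ioo a b, VanishOff R fun x => u x τ ^ q * φ x := fun τ hτ x hx => by
    have := S.reg.van τ hτ x hx
    simp only at this
    simp only [this]; rw [Real.zero_rpow (by linarith), zero_mul]
  refine hasDerivAt_integral_of_vanish (R := R) (M := M * q * M ^ (q - 1) * |K|) ?_ ?_
    (fun x => hd x t ht) ?_ ?_
  · filter_upwards [ev] with τ hτ
    exact (S.rpow_continuous (by linarith) hτ).mul hφ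
  · exact (((S.reg.c0 t ht).mul_const q).mul (S.rpow_continuous (by linarith) ht)).mul hφ
  · filter_upwards [ev] with τ hτ x
    by_cases hx : ‖x‖ ≤ R
    · refine abs_sub_le_of_hasDerivAt (hd x) (fun σ hσ => ?_) hτ ht
      have h1 := S.reg.bd' x σ hσ
      have h2 := S.rpow_le (q := q - 1) (by linarith) hσ x
      have h3 : |φ x| ≤ |K| := (hK x (by simpa using hx)).trans (le_abs_self _)
      have h4 := Real.rpow_nonneg (S.nonneg x σ hσ) (q - 1)
      rw [abs_mul, abs_mul, abs_mul, abs_of_nonneg h4, abs_of_nonneg (by linarith : 0 ≤ q)]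
      gcongr
    · rw [show u x τ ^ q * φ x = 0 from hv τ hτ x (not_le.1 hx),
        show u x t ^ q * φ x = 0 from hv t ht x (not_le.1 hx), sub_self, abs_zero]
      positivity
  · filter_upwards [ev] with τ hτ
    exact hv τ hτ

end

lemma bump_vanish_eight (m : ℕ) (hm : m ≠ 0) : VanishOff 3 (bump m 8) := fun x hx => by
  have : 1 - ‖x‖ ^ 2 / 8 ≤ 0 := by nlinarith
  simp [bump, this, hm]

lemma bump_vanish_four (m : ℕ) (hm : m ≠ 0) : VanishOff 2 (bump m 4) := by
  have := bump_vanish m hm (R := 2) (by norm_num)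
  norm_num at this; exact this

lemma VanishOff.mono {R R' : ℝ} {f : E2 → ℝ} (h : VanishOff R f) (hR : R ≤ R') : VanishOff R' f :=
  fun x hx => h x (hR.trans_lt hx)

lemma bump_four_le (x : E2) : bump 3 4 x ≤ bump 3 8 x := by
  unfold bump
  gcongr 2
  have : 0 ≤ ‖x‖ ^ 2 := by positivity
  linarith

lemma gd_bump_sq_le (v : E2 → ℝ) (x : E2) :
    gd (bump 3 4) v x ^ 2 ≤ 72 * bump 3 4 x * bump 3 8 x * gd v v x := by
  have h := (bump_profile 0 4).gd_sq_le v x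
  have hg := gd_self_nonneg v x
  have e : (fun x : E2 => max (1 - ‖x‖ ^ 2 / 4) 0 ^ (0 + 3)) = bump 3 4 := rfl
  rw [e] at h
  refine h.trans (mul_le_mul_of_nonneg_right ?_ hg)
  simp only [bump]
  rcases le_or_gt (‖x‖ ^ 2) 4 with h4 | h4
  · have q0 : 0 ≤ 1 - ‖x‖ ^ 2 / 4 := by linarith
    have q2 : (1 / 2 : ℝ) ≤ 1 - ‖x‖ ^ 2 / 8 := by linarith
    rw [max_eq_left q0, max_eq_left (by linarith)]
    have hx : 0 ≤ ‖x‖ ^ 2 := by positivity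
    have q1 : 1 - ‖x‖ ^ 2 / 4 ≤ 1 := by linarith
    generalize ‖x‖ ^ 2 = s at *
    have h8 : (1 / 2 : ℝ) ^ 3 ≤ (1 - s / 8) ^ 3 := by gcongr
    have h3 : 0 ≤ (1 - s / 4) ^ 3 := by positivity
    calc 4 * s * (((0 : ℕ) + 3) * (1 - s / 4) ^ (0 + 2) * -(1 / 4)) ^ 2
        = 9 / 4 * s * (1 - s / 4) * (1 - s / 4) ^ 3 := by push_cast; ring
      _ ≤ 9 / 4 * 4 * 1 * (1 - s / 4) ^ 3 := by gcongr
      _ = 72 * (1 - s / 4) ^ 3 * (1 / 2) ^ 3 := by ring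
      _ ≤ _ := by gcongr
  · rw [max_eq_right (by linarith : 1 - ‖x‖ ^ 2 / 4 ≤ 0)]; norm_num

section
variable {p : ℝ} {u u' : E2 → ℝ → ℝ} {a b R M : ℝ}

/-- The localised Dirichlet energy. -/
noncomputable def dirEnergy (u : E2 → ℝ → ℝ) (t : ℝ) : ℝ :=
  ∫ x, bump 3 8 x * gd (fun y => u y t) (fun y => u y t) x

lemma PSol.dirEnergy_continuousOn (S : PSol p 3 u u' a b R M) (hp : 1 < p) :
    ContinuousOn (dirEnergy u) (Ioo a b) :=
  S.continuousOn_gd hp (bump_contDiff 0 8) (bump_vanish_eight 3 (by norm_num))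

lemma PSol.dirEnergy_integral_le_sub (S : PSol p 3 u u' a b R M) (hp : 1 < p) {s t : ℝ} (hs : a < s)
    (hst : s ≤ t) (ht : t < b) :
    ∫ τ in s..t, dirEnergy u τ ≤ 1 / 2 * ((∫ x, u x s * u x s * bump 3 8 x)
        - ∫ x, u x t * u x t * bump 3 8 x)
      + ∫ τ in s..t, ((∫ x, u x τ ^ (p + 1) * bump 3 8 x)
        + 1 / 2 * ∫ x, u x τ * u x τ * lap (bump 3 8) x) := by
  have hφ : ContDiff ℝ 2 (bump 3 8) := bump_contDiff 0 8
  have hv := bump_vanish_eight 3 (by norm_num)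
  have hsub : Icc s t ⊆ Ioo a b := fun τ hτ => ⟨hs.trans_le hτ.1, hτ.2.trans_lt ht⟩
  have cg := (S.dirEnergy_continuousOn hp).mono hsub
  have c2 := (S.rpow_integral_continuousOn (q := p + 1) (by linarith) hφ.continuous hv).mono hsub
  have c3 := (S.reg.sq.continuousOn_integral (continuous_lap hφ)).mono hsub
  have cK : ContinuousOn (fun τ => (∫ x, u x τ ^ (p + 1) * bump 3 8 x)
        + 1 / 2 * ∫ x, u x τ * u x τ * lap (bump 3 8) x) (Icc s t) := c2.add (c3.const_mul _)
  have h := integral_le_sub_of_hasDerivAt hst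
    (f := fun τ => -(1 / 2) * ∫ x, u x τ * u x τ * bump 3 8 x)
    (f' := fun τ => -(1 / 2) * ∫ x, 2 * (u x τ * u' x τ) * bump 3 8 x)
    (g := fun τ => dirEnergy u τ - ((∫ x, u x τ ^ (p + 1) * bump 3 8 x)
        + 1 / 2 * ∫ x, u x τ * u x τ * lap (bump 3 8) x))
    (fun τ hτ => (S.reg.sq.hasDerivAt_integral_const hφ.continuous (hsub hτ)).const_mul _)
    (cg.sub cK) (fun τ hτ => by
      simp only [dirEnergy]
      rw [S.integral_gd hp hφ hv (hsub hτ)]; linarith)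
  rw [intervalIntegral.integral_sub (cg.intervalIntegrable_of_Icc hst)
    (cK.intervalIntegrable_of_Icc hst)] at h
  linarith

lemma PSol.dirEnergy_integral_le (S : PSol p 3 u u' a b R M) (hp : 1 < p) {s t : ℝ} (hs : a < s)
    (hst : s ≤ t) (ht : t < b) :
    ∫ τ in s..t, dirEnergy u τ ≤ 1 / 2 * (∫ x, u x s * u x s * bump 3 8 x)
      + ∫ τ in s..t, ((∫ x, u x τ ^ (p + 1) * bump 3 8 x)
        + 1 / 2 * ∫ x, u x τ * u x τ * lap (bump 3 8) x) := by
  have h0 : 0 ≤ ∫ x, u x t * u x t * bump 3 8 x :=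
    integral_nonneg fun x => mul_nonneg (mul_self_nonneg _) (bump_nonneg _ _ _)
  linarith [S.dirEnergy_integral_le_sub hp hs hst ht]

lemma PSol.derivSq_continuousOn (S : PSol p 3 u u' a b R M) :
    ContinuousOn (fun τ => ∫ x, u' x τ * u' x τ * bump 3 4 x) (Ioo a b) := by
  refine continuousOn_integral_of_vanish (F := fun x τ => u' x τ * u' x τ * bump 3 4 x)
    (R := 2) (M := M * M * 1)
    (fun τ hτ => ((S.reg.c0 τ hτ).mul (S.reg.c0 τ hτ)).mul (bump_continuous _ _))
    (fun x => ((S.reg.ct x).mul (S.reg.ct x)).mul continuousOn_const) (fun x τ hτ => ?_)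
    fun τ hτ => (bump_vanish_four 3 (by norm_num)).mul_left _
  have hM0 : 0 ≤ M := (abs_nonneg _).trans (S.reg.bd 0 τ hτ)
  have h1 := S.reg.bd' x τ hτ
  rw [abs_mul, abs_mul, abs_of_nonneg (bump_nonneg _ _ _)]
  have := bump_le_one 3 (ρ := 4) (by norm_num) x
  have := bump_nonneg 3 4 x
  gcongr

/-- The localised energy inequality. -/
lemma PSol.integral_deriv_sq_le (S : PSol p 3 u u' a b R M) (hp : 1 < p) {s t : ℝ} (hs : a < s)
    (hst : s ≤ t) (ht : t < b) :
    ∫ τ in s..t, ∫ x, u' x τ * u' x τ * bump 3 4 x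
      ≤ dirEnergy u s + (∫ x, u x t ^ (p + 1) * bump 3 8 x) + 72 * ∫ τ in s..t, dirEnergy u τ := by
  have hφ : ContDiff ℝ 2 (bump 3 4) := bump_contDiff 0 4
  have hv : VanishOff 3 (bump 3 4) := (bump_vanish_four 3 (by norm_num)).mono (by norm_num)
  have hφ8 : ContDiff ℝ 2 (bump 3 8) := bump_contDiff 0 8
  have hv8 := bump_vanish_eight 3 (by norm_num)
  have hsub : Icc s t ⊆ Ioo a b := fun τ hτ => ⟨hs.trans_le hτ.1, hτ.2.trans_lt ht⟩
  have hM0 : 0 ≤ M := (abs_nonneg _).trans (S.reg.bd 0 s (hsub ⟨le_rfl, hst⟩))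
  have cg := (S.dirEnergy_continuousOn hp).mono hsub
  have cI : ContinuousOn (fun τ => ∫ x, u' x τ * u' x τ * bump 3 4 x) (Icc s t) :=
    S.derivSq_continuousOn.mono hsub
  have i1 : ∀ τ ∈ Icc s t, Integrable fun x => u' x τ * u' x τ * bump 3 4 x := fun τ hτ =>
    (hv.mul_left _).integrable
      (((S.reg.c0 τ (hsub hτ)).mul (S.reg.c0 τ (hsub hτ))).mul hφ.continuous)
  have i2 : ∀ τ ∈ Icc s t,
      Integrable fun x => bump 3 8 x * gd (fun y => u y τ) (fun y => u y τ) x := fun τ hτ =>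
    (hv8.mul_right _).integrable (hφ8.continuous.mul
      (continuous_gd (S.reg.c2 τ (hsub hτ)) (S.reg.c2 τ (hsub hτ))))
  have hp1 : 0 < p + 1 := by linarith
  have h := sub_le_integral_of_hasDerivAt hst
    (f := fun τ => (1 / 2 * ∫ x, bump 3 4 x * gd (fun y => u y τ) (fun y => u y τ) x)
      - 1 / (p + 1) * ∫ x, u x τ ^ (p + 1) * bump 3 4 x)
    (f' := fun τ => (∫ x, u' x τ * (-((u' x τ - u x τ ^ p) * bump 3 4 x)
        - gd (bump 3 4) (fun y => u y τ) x))
      - 1 / (p + 1) * ∫ x, u' x τ * (p + 1) * u x τ ^ (p + 1 - 1) * bump 3 4 x)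
    (g := fun τ => 36 * dirEnergy u τ - 1 / 2 * ∫ x, u' x τ * u' x τ * bump 3 4 x)
    (fun τ hτ => (S.hasDerivAt_gd hp hφ hv (hsub hτ)).sub
      ((S.hasDerivAt_rpow (by linarith) hφ.continuous (hsub hτ)).const_mul _))
    ((cg.const_mul _).sub (cI.const_mul _)) (fun τ hτ => by
      have hτ' := hsub hτ
      have cu' := S.reg.c0 τ hτ'
      have cup := S.rpow_continuous (q := p + 1 - 1) (by linarith) hτ'
      have cgd := continuous_gd hφ (S.reg.c2 τ hτ')
      have cup' := S.rpow_continuous (q := p) (by linarith) hτ'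
      have cb := hφ.continuous
      have j1 : Integrable fun x => u' x τ * (-((u' x τ - u x τ ^ p) * bump 3 4 x)
          - gd (bump 3 4) (fun y => u y τ) x) :=
        VanishOff.integrable (R := 3) (fun x hx => by simp [hv x hx, (hv.gd _) x hx]) (by fun_prop)
      have j2 : Integrable fun x => u' x τ * (p + 1) * u x τ ^ (p + 1 - 1) * bump 3 4 x :=
        VanishOff.integrable (R := 3) (hv.mul_left _) (by fun_prop)
      simp only [dirEnergy]
      rw [← integral_const_mul, ← integral_sub j1 (j2.const_mul _), ← integral_const_mul,
        ← integral_const_mul, ← integral_sub ((i2 τ hτ).const_mul _) ((i1 τ hτ).const_mul _)]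
      refine integral_mono (j1.sub (j2.const_mul _))
        (((i2 τ hτ).const_mul _).sub ((i1 τ hτ).const_mul _)) fun x => ?_
      simp only [add_sub_cancel_right]
      have hB := gd_bump_sq_le (fun y => u y τ) x
      have b4 := bump_nonneg 3 4 x
      have b8 := bump_nonneg 3 8 x
      have hg := gd_self_nonneg (fun y => u y τ) x
      set A := u' x τ
      set B := gd (bump 3 4) (fun y => u y τ) x
      set G := gd (fun y => u y τ) (fun y => u y τ) x
      have key : |A * B| ≤ 1 / 2 * (A * A * bump 3 4 x) + 36 * (bump 3 8 x * G) := by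
        have n1 : 0 ≤ A * A * bump 3 4 x := mul_nonneg (mul_self_nonneg _) b4
        have n2 : 0 ≤ bump 3 8 x * G := mul_nonneg b8 hg
        refine abs_le_of_sq_le_sq ?_ (by positivity)
        have h1 : (A * B) ^ 2 ≤ 72 * ((A * A * bump 3 4 x) * (bump 3 8 x * G)) := by
          have := mul_le_mul_of_nonneg_left hB (mul_self_nonneg A)
          calc (A * B) ^ 2 = A * A * B ^ 2 := by ring
            _ ≤ _ := this
            _ = _ := by ring
        nlinarith [sq_nonneg (1 / 2 * (A * A * bump 3 4 x) - 36 * (bump 3 8 x * G))]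
      have := neg_le_abs (A * B)
      have e : 1 / (p + 1) * (A * (p + 1) * u x τ ^ p * bump 3 4 x)
          = A * u x τ ^ p * bump 3 4 x := by field_simp
      rw [e]
      linarith)
  rw [intervalIntegral.integral_sub ((cg.const_mul _).intervalIntegrable_of_Icc hst)
    ((cI.const_mul _).intervalIntegrable_of_Icc hst), intervalIntegral.integral_const_mul,
    intervalIntegral.integral_const_mul] at h
  have hs' : s ∈ Icc s t := ⟨le_rfl, hst⟩
  have ht' : t ∈ Icc s t := ⟨hst, le_rfl⟩
  have m1 : ∫ x, bump 3 4 x * gd (fun y => u y s) (fun y => u y s) x ≤ dirEnergy u s := by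
    refine integral_mono ((hv.mul_right _).integrable (hφ.continuous.mul
      (continuous_gd (S.reg.c2 s (hsub hs')) (S.reg.c2 s (hsub hs'))))) (i2 s hs') fun x => ?_
    exact mul_le_mul_of_nonneg_right (bump_four_le x) (gd_self_nonneg _ _)
  have m2 : 0 ≤ ∫ x, bump 3 4 x * gd (fun y => u y t) (fun y => u y t) x :=
    integral_nonneg fun x => mul_nonneg (bump_nonneg _ _ _) (gd_self_nonneg _ _)
  have m3 : 0 ≤ ∫ x, u x s ^ (p + 1) * bump 3 4 x := integral_nonneg fun x =>
    mul_nonneg (Real.rpow_nonneg (S.nonneg x s (hsub hs')) _) (bump_nonneg _ _ _)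
  have m4 : ∫ x, u x t ^ (p + 1) * bump 3 4 x ≤ ∫ x, u x t ^ (p + 1) * bump 3 8 x := by
    refine integral_mono (S.rpow_integrable hp1 (hsub ht') hφ.continuous)
      (S.rpow_integrable hp1 (hsub ht') hφ8.continuous) fun x => ?_
    exact mul_le_mul_of_nonneg_left (bump_four_le x) (Real.rpow_nonneg (S.nonneg x t (hsub ht')) _)
  have m5 : 0 ≤ ∫ x, u x t ^ (p + 1) * bump 3 4 x := integral_nonneg fun x =>
    mul_nonneg (Real.rpow_nonneg (S.nonneg x t (hsub ht')) _) (bump_nonneg _ _ _)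
  have hq : 1 / (p + 1) ≤ 1 / 2 := one_div_le_one_div_of_le (by norm_num) (by linarith)
  have hq0 : 0 < 1 / (p + 1) := by positivity
  have m6 := mul_nonneg hq0.le m3
  have m7 := mul_le_mul_of_nonneg_right hq m5
  linarith

end

lemma integral_le_integral_of_subinterval {f : ℝ → ℝ} {a b c d : ℝ} (hac : a ≤ c) (hcd : c ≤ d)
    (hdb : d ≤ b) (hf : ContinuousOn f (Icc a b)) (h0 : ∀ t ∈ Icc a b, 0 ≤ f t) :
    ∫ t in c..d, f t ≤ ∫ t in a..b, f t := by
  have hab : a ≤ b := hac.trans (hcd.trans hdb)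
  refine intervalIntegral.integral_mono_interval hac hcd hdb ?_ (hf.intervalIntegrable_of_Icc hab)
  filter_upwards [ae_restrict_mem measurableSet_Ioc] with t ht
  exact h0 t ⟨ht.1.le, ht.2⟩

/-- Universal bound for the space-time integral of `uₜ²` in terms of the supremum of `u`. -/
lemma exists_integral_deriv_sq_le {p : ℝ} (hp : 1 < p) : ∃ C > 0,
    ∀ (u u' : E2 → ℝ → ℝ) (a b R M N : ℝ), PSol p 4 u u' a b R M → a < -4 → 4 < b → 1 ≤ N →
    (∀ x, ‖x‖ ≤ 3 → ∀ t ∈ Icc (-2 : ℝ) 2, u x t ≤ N) →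
    ∫ τ in (-1)..1, ∫ x, u' x τ * u' x τ * bump 3 4 x ≤ C * N := by
  obtain ⟨C₀, hC₀, h₀⟩ := exists_integral_rpow_le hp
  have hY : VanishOff 3 (bump 1 8) := bump_vanish_eight 1 (by norm_num)
  have cY := bump_continuous 1 8
  have iY : Integrable (bump 1 8) := hY.integrable cY
  set V := ∫ x, bump 1 8 x with hV
  have hV0 : 0 ≤ V := integral_nonneg fun x => bump_nonneg _ _ _
  set C₁ := 1 / 2 * (V + 2 * C₀) + (13 / 4 * C₀ + 9 / 4 * (4 * V)) with hC₁
  refine ⟨2 * C₁ + C₀ + 72 * C₁, by positivity, ?_⟩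
  intro u u' a b R M N S ha hb hN hu
  have hp0 : 0 < p := by linarith
  have S3 : PSol p 3 u u' a b R M := S.mono le_rfl le_rfl (by norm_num)
  have hsub : Icc (-2 : ℝ) 2 ⊆ Ioo a b := fun t ht =>
    ⟨by linarith [ht.1], by linarith [ht.2]⟩
  set Q : ℝ → ℝ := fun t => ∫ x, u x t ^ p * bump 1 8 x with hQ
  have cQ : ContinuousOn Q (Icc (-2) 2) :=
    (S.rpow_integral_continuousOn hp0 cY hY).mono hsub
  have Q0 : ∀ t ∈ Icc (-2 : ℝ) 2, 0 ≤ Q t := fun t ht => integral_nonneg fun x =>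
    mul_nonneg (Real.rpow_nonneg (S.nonneg x t (hsub ht)) _) (bump_nonneg _ _ _)
  have hQI : ∫ t in (-2)..2, Q t ≤ C₀ := h₀ u u' a b R M S ha hb
  have iu : ∀ t ∈ Icc (-2 : ℝ) 2, Integrable fun x => u x t ^ p * bump 1 8 x := fun t ht =>
    S.rpow_integrable hp0 (hsub ht) cY
  have sq_le : ∀ x, ‖x‖ ≤ 3 → ∀ t ∈ Icc (-2 : ℝ) 2, u x t * u x t ≤ N * (1 + u x t ^ p) := by
    intro x hx t ht
    have u0 := S.nonneg x t (hsub ht)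
    have uN := hu x hx t ht
    have up := Real.rpow_nonneg u0 p
    rcases le_total (u x t) 1 with h | h
    · nlinarith
    · have h1 := Real.self_le_rpow_of_one_le h hp.le
      calc u x t * u x t ≤ N * u x t := by gcongr
        _ ≤ N * (1 + u x t ^ p) := by gcongr; linarith
  have b31 : ∀ x, bump 3 8 x ≤ bump 1 8 x := fun x => by
    unfold bump
    refine pow_le_pow_of_le_one (le_max_right _ _) (max_le ?_ zero_le_one) (by norm_num)
    have : 0 ≤ ‖x‖ ^ 2 := by positivity
    linarith
  have hv8 := bump_vanish_eight 3 (by norm_num)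
  have hφ8 : ContDiff ℝ 2 (bump 3 8) := bump_contDiff 0 8
  have wsq : ∀ t ∈ Icc (-2 : ℝ) 2, ∀ (φ : E2 → ℝ), Continuous φ → VanishOff 3 φ → ∀ K : ℝ, 0 ≤ K →
      (∀ x, φ x ≤ K * bump 1 8 x) → ∫ x, u x t * u x t * φ x ≤ K * (N * (V + Q t)) := by
    intro t ht φ cφ vφ K hK hle
    have : Integrable fun x => bump 1 8 x + u x t ^ p * bump 1 8 x := iY.add (iu t ht)
    calc ∫ x, u x t * u x t * φ x ≤ ∫ x, K * (N * (bump 1 8 x + u x t ^ p * bump 1 8 x)) := by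
          refine integral_mono (S.reg.sq.integrable_mul cφ (hsub ht))
            ((this.const_mul _).const_mul _) fun x => ?_
          have bn := bump_nonneg 1 8 x
          by_cases hx : ‖x‖ ≤ 3
          · have h1 := sq_le x hx t ht
            have h0 : 0 ≤ u x t * u x t := mul_self_nonneg _
            calc u x t * u x t * φ x ≤ u x t * u x t * (K * bump 1 8 x) := by gcongr; exact hle x
              _ ≤ N * (1 + u x t ^ p) * (K * bump 1 8 x) := by gcongr
              _ = _ := by ring
          · have u0 := Real.rpow_nonneg (S.nonneg x t (hsub ht)) p
            simp only [vφ x (not_le.1 hx), mul_zero]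
            positivity
      _ = _ := by rw [integral_const_mul, integral_const_mul, integral_add iY (iu t ht)]
  have hP : ∀ t ∈ Icc (-2 : ℝ) 2, ∫ x, u x t ^ (p + 1) * bump 3 8 x ≤ N * Q t := by
    intro t ht
    rw [hQ, ← integral_const_mul]
    refine integral_mono (S.rpow_integrable (by linarith) (hsub ht) hφ8.continuous)
      ((iu t ht).const_mul _) fun x => ?_
    have u0 := S.nonneg x t (hsub ht)
    have up := Real.rpow_nonneg u0 p
    have bn := bump_nonneg 3 8 x
    have bn1 := bump_nonneg 1 8 x
    by_cases hx : ‖x‖ ≤ 3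
    · have h1 := hu x hx t ht
      simp only
      rw [Real.rpow_add_one' u0 (by linarith)]
      calc u x t ^ p * u x t * bump 3 8 x ≤ u x t ^ p * N * bump 1 8 x := by
            gcongr; exact b31 x
        _ = _ := by ring
    · simp only [hv8 x (not_le.1 hx), mul_zero]; positivity
  have hf : ∀ t ∈ Icc (-2 : ℝ) 2, ∫ x, u x t * u x t * bump 3 8 x ≤ N * (V + Q t) := fun t ht => by
    have := wsq t ht _ hφ8.continuous hv8 1 zero_le_one (fun x => by rw [one_mul]; exact b31 x)
    rwa [one_mul] at this
  have hl : ∀ t ∈ Icc (-2 : ℝ) 2,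
      ∫ x, u x t * u x t * lap (bump 3 8) x ≤ 9 / 2 * (N * (V + Q t)) := fun t ht => by
    refine wsq t ht _ (continuous_lap hφ8) hv8.lap _ (by norm_num) fun x => ?_
    have := (le_abs_self _).trans (abs_lap_bump_le 0 (ρ := 8) (by norm_num) x)
    norm_num at this; exact this
  have cg : ContinuousOn (dirEnergy u) (Icc (-2) 2) := (S3.dirEnergy_continuousOn hp).mono hsub
  have g0 : ∀ t, 0 ≤ dirEnergy u t := fun t =>
    integral_nonneg fun x => mul_nonneg (bump_nonneg _ _ _) (gd_self_nonneg _ _)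
  obtain ⟨s₀, hs₀, hs₀'⟩ := exists_mul_le_integral (f := Q) (a := -2) (b := -3 / 2) (by norm_num)
    (cQ.mono (Icc_subset_Icc le_rfl (by norm_num)))
  have q1 : ∫ t in (-2)..(-3 / 2), Q t ≤ ∫ t in (-2)..2, Q t :=
    integral_le_integral_of_subinterval le_rfl (by norm_num) (by norm_num) cQ Q0
  have hs2 : s₀ ∈ Icc (-2 : ℝ) 2 := ⟨hs₀.1, by linarith [hs₀.2]⟩
  have hs3 : Icc s₀ 2 ⊆ Icc (-2 : ℝ) 2 := Icc_subset_Icc hs2.1 le_rfl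
  have G : ∫ τ in s₀..2, dirEnergy u τ ≤ C₁ * N := by
    have h1 := S3.dirEnergy_integral_le hp (s := s₀) (t := 2) (by linarith [hs2.1]) hs2.2 (by linarith)
    have h2 : ∫ τ in s₀..2, ((∫ x, u x τ ^ (p + 1) * bump 3 8 x)
        + 1 / 2 * ∫ x, u x τ * u x τ * lap (bump 3 8) x)
        ≤ ∫ τ in s₀..2, (N * (13 / 4) * Q τ + 9 / 4 * N * V) := by
      refine intervalIntegral.integral_mono_on hs2.2 ?_ ?_ fun t ht => ?_
      · refine ContinuousOn.intervalIntegrable_of_Icc hs2.2 (ContinuousOn.mono ?_ (hs3.trans hsub))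
        exact (S3.rpow_integral_continuousOn (q := p + 1) (by linarith) hφ8.continuous hv8).add
          ((S.reg.sq.continuousOn_integral (continuous_lap hφ8)).const_mul _)
      · refine ContinuousOn.intervalIntegrable_of_Icc hs2.2 ?_
        have := cQ.mono hs3
        fun_prop
      · have := hP t (hs3 ht)
        have := hl t (hs3 ht)
        linarith
    have iQ : IntervalIntegrable Q volume s₀ 2 := (cQ.mono hs3).intervalIntegrable_of_Icc hs2.2
    rw [intervalIntegral.integral_add (iQ.const_mul _) (by simp), intervalIntegral.integral_const_mul,
      intervalIntegral.integral_const, smul_eq_mul] at h2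
    have h3 : ∫ t in s₀..2, Q t ≤ ∫ t in (-2)..2, Q t :=
      integral_le_integral_of_subinterval hs2.1 hs2.2 le_rfl cQ Q0
    have h4 := hf s₀ hs2
    have h5 : N * (13 / 4) * (∫ t in s₀..2, Q t) ≤ N * (13 / 4) * C₀ := by
      gcongr; exact h3.trans hQI
    have h6 : (2 - s₀) * (9 / 4 * N * V) ≤ 4 * (9 / 4 * N * V) := by
      gcongr; linarith [hs2.1]
    have h7 : N * (V + Q s₀) ≤ N * (V + 2 * C₀) := by gcongr; linarith
    simp only [hC₁]; linarith
  obtain ⟨s₁, hs₁, hs₁'⟩ := exists_mul_le_integral (f := dirEnergy u) (a := -3 / 2) (b := -1)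
    (by norm_num) (cg.mono (Icc_subset_Icc (by norm_num) (by norm_num)))
  have g1 : ∫ t in (-3 / 2)..(-1), dirEnergy u t ≤ ∫ t in s₀..2, dirEnergy u t :=
    integral_le_integral_of_subinterval hs₀.2 (by norm_num) (by norm_num) (cg.mono hs3)
      fun t _ => g0 t
  obtain ⟨t₁, ht₁, ht₁'⟩ := exists_mul_le_integral (f := Q) (a := 1) (b := 2) (by norm_num)
    (cQ.mono (Icc_subset_Icc (by norm_num) le_rfl))
  have q2 : ∫ t in (1)..2, Q t ≤ ∫ t in (-2)..2, Q t :=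
    integral_le_integral_of_subinterval (by norm_num) (by norm_num) le_rfl cQ Q0
  have hst : s₁ ≤ t₁ := by linarith [hs₁.2, ht₁.1]
  have E := S3.integral_deriv_sq_le hp (s := s₁) (t := t₁) (by linarith [hs₁.1]) hst
    (by linarith [ht₁.2])
  have g2 : ∫ t in s₁..t₁, dirEnergy u t ≤ ∫ t in s₀..2, dirEnergy u t :=
    integral_le_integral_of_subinterval (by linarith [hs₀.2, hs₁.1]) hst ht₁.2 (cg.mono hs3)
      fun t _ => g0 t
  have hsub1 : Icc s₁ t₁ ⊆ Ioo a b := (Icc_subset_Icc (by linarith [hs₁.1]) ht₁.2).trans hsub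
  have F : ∫ τ in (-1)..1, ∫ x, u' x τ * u' x τ * bump 3 4 x
      ≤ ∫ τ in s₁..t₁, ∫ x, u' x τ * u' x τ * bump 3 4 x :=
    integral_le_integral_of_subinterval hs₁.2 (by norm_num) ht₁.1
      (S3.derivSq_continuousOn.mono hsub1)
      fun t _ => integral_nonneg fun x => mul_nonneg (mul_self_nonneg _) (bump_nonneg _ _ _)
  have h8 := hP t₁ ⟨by linarith [ht₁.1], ht₁.2⟩
  have h9 : N * Q t₁ ≤ N * C₀ := by gcongr; linarith
  nlinarith

lemma wt_vanish : VanishOff 2 wt := fun x hx => by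
  have : 2 - ‖x‖ ^ 2 ≤ 0 := by nlinarith
  simp [wt, this]

/-- A bounded solution with small `Lᵖ` energy is at most `1/2` at the end point. -/
lemma exists_energy_threshold {p L : ℝ} (hp : 1 < p) (hL : 1 ≤ L) : ∃ E₀ > 0,
    ∀ (v v' : E2 → ℝ → ℝ) (a b R M ρ : ℝ) (φ : E2 → ℝ), PSol p 1 v v' a b R M → a < -1 → 0 < b →
    (∀ x, ‖x‖ ≤ 1 → ∀ t ∈ Ioo a b, v x t ≤ L) → Continuous φ → VanishOff ρ φ → (∀ x, 0 ≤ φ x) →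
    (∀ x, wt x ≤ 16 * φ x) → ∫ t in (-1)..0, ∫ x, v x t ^ p * φ x ≤ E₀ → v 0 0 ≤ 1 / 2 := by
  obtain ⟨C₁, hC₁, hmv⟩ := exists_mv
  obtain ⟨Λ, hΛ⟩ : ∃ Λ, Λ = L ^ (p - 1) := ⟨_, rfl⟩
  have hΛ0 : 0 ≤ Λ := hΛ ▸ by positivity
  have iW : Integrable wt := wt_vanish.integrable wt_continuous
  obtain ⟨W, hW⟩ : ∃ W, W = ∫ x, wt x := ⟨_, rfl⟩
  have hW0 : 0 ≤ W := hW ▸ integral_nonneg wt_nonneg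
  obtain ⟨ε, hε0, e1⟩ : ∃ ε > 0, Real.exp Λ * (2 + C₁) * ε * W ≤ 1 / 4 := by
    refine ⟨1 / (4 * Real.exp Λ * (2 + C₁) * (W + 1)), by positivity, ?_⟩
    have h1 : Real.exp Λ * (2 + C₁) * (1 / (4 * Real.exp Λ * (2 + C₁) * (W + 1))) * (W + 1)
        = 1 / 4 := by field_simp
    have h2 : 0 ≤ Real.exp Λ * (2 + C₁) * (1 / (4 * Real.exp Λ * (2 + C₁) * (W + 1))) := by
      positivity
    linarith
  obtain ⟨K, hK⟩ : ∃ K, K = ε ^ (1 - p) := ⟨_, rfl⟩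
  have hK0 : 0 < K := hK ▸ by positivity
  obtain ⟨E₀, hE₀, e2⟩ : ∃ E₀ > 0, Real.exp Λ * (64 + 16 * C₁) * K * E₀ = 1 / 4 :=
    ⟨1 / (4 * Real.exp Λ * (64 + 16 * C₁) * K), by positivity, by field_simp⟩
  refine ⟨E₀, hE₀, ?_⟩
  intro v v' a b R M ρ φ S ha hb hvL cφ vφ φ0 hwt hE
  have hp0 : 0 < p := by linarith
  have hsub : Icc (-1 : ℝ) 0 ⊆ Ioo a b := fun t ht => ⟨ha.trans_le ht.1, ht.2.trans_lt hb⟩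
  obtain ⟨F, hF⟩ : ∃ F : ℝ → ℝ, F = fun t => ∫ x, v x t ^ p * φ x := ⟨_, rfl⟩
  have hE : ∫ t in (-1)..0, F t ≤ E₀ := hF ▸ hE
  have cF : ContinuousOn F (Icc (-1) 0) := hF ▸ (S.rpow_integral_continuousOn hp0 cφ vφ).mono hsub
  have F0 : ∀ t ∈ Icc (-1 : ℝ) 0, 0 ≤ F t := fun t ht => hF ▸ integral_nonneg fun x =>
    mul_nonneg (Real.rpow_nonneg (S.nonneg x t (hsub ht)) _) (φ0 x)
  have hY : ∀ x, ∀ t ∈ Icc (-1 : ℝ) 0, v x t ≤ ε + K * v x t ^ p := fun x t ht => by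
    have v0 := S.nonneg x t (hsub ht)
    have vp := Real.rpow_nonneg v0 p
    rcases le_total (v x t) ε with h | h
    · nlinarith
    · have vpos : 0 < v x t := hε0.trans_le h
      have h1 : v x t ^ (1 - p) ≤ K := hK ▸ Real.rpow_le_rpow_of_nonpos hε0 h (by linarith)
      have h2 : v x t = v x t ^ (1 - p) * v x t ^ p := by
        rw [← Real.rpow_add vpos]; simp
      nlinarith
  have hI : ∀ t ∈ Icc (-1 : ℝ) 0, ∫ x, v x t * wt x ≤ ε * W + 16 * K * F t := fun t ht => by
    have i1 := S.rpow_integrable hp0 (hsub ht) cφ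
    calc ∫ x, v x t * wt x ≤ ∫ x, (ε * wt x + 16 * K * (v x t ^ p * φ x)) := by
          refine integral_mono (S.reg.integrable_mul wt_continuous (hsub ht))
            ((iW.const_mul _).add (i1.const_mul _)) fun x => ?_
          have vp := Real.rpow_nonneg (S.nonneg x t (hsub ht)) p
          have w0 := wt_nonneg x
          calc v x t * wt x ≤ (ε + K * v x t ^ p) * wt x := by gcongr; exact hY x t ht
            _ = ε * wt x + K * v x t ^ p * wt x := by ring
            _ ≤ ε * wt x + K * v x t ^ p * (16 * φ x) := by gcongr; exact hwt x
            _ = _ := by ring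
      _ = _ := by rw [integral_add (iW.const_mul _) (i1.const_mul _), integral_const_mul,
            integral_const_mul, hF, hW]
  obtain ⟨s, hs, hs'⟩ := exists_mul_le_integral (f := F) (a := -1) (b := -1 / 2) (by norm_num)
    (cF.mono (Icc_subset_Icc le_rfl (by norm_num)))
  have q1 : ∫ t in (-1)..(-1 / 2), F t ≤ ∫ t in (-1)..0, F t :=
    integral_le_integral_of_subinterval le_rfl (by norm_num) (by norm_num) cF F0
  have hs0 : s < 0 := by linarith [hs.2]
  have hs2 : s ∈ Icc (-1 : ℝ) 0 := ⟨hs.1, hs0.le⟩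
  have hs3 : Icc s 0 ⊆ Icc (-1 : ℝ) 0 := Icc_subset_Icc hs.1 le_rfl
  have mv := (hmv v v' a b R M Λ 0 s 0 S.reg S.nonneg hΛ0 le_rfl (fun x hx t ht => by
    rw [S.eq x hx t ht, add_zero]
    have v0 := S.nonneg x t ht
    have h1 : v x t ^ p = v x t ^ (p - 1) * v x t := by
      rw [← Real.rpow_add_one' v0 (by linarith)]; congr 1; ring
    have h2 : v x t ^ (p - 1) ≤ Λ := hΛ ▸ Real.rpow_le_rpow v0 (hvL x hx t ht) (by linarith)
    rw [h1]; gcongr) (hsub hs2) (hsub ⟨by norm_num, le_rfl⟩) hs0 (by linarith [hs.1])).2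
  have hint : ∫ τ in s..0, (0 + C₁ * ∫ x, v x τ * wt x) ≤ C₁ * (ε * W + 16 * K * E₀) := by
    have : ∫ τ in s..0, (0 + C₁ * ∫ x, v x τ * wt x)
        ≤ ∫ τ in s..0, (C₁ * (ε * W) + C₁ * (16 * K) * F τ) := by
      refine intervalIntegral.integral_mono_on hs0.le ?_ ?_ fun t ht => ?_
      · have := (S.reg.continuousOn_integral wt_continuous).mono (hs3.trans hsub)
        exact ContinuousOn.intervalIntegrable_of_Icc hs0.le (by fun_prop)
      · have := cF.mono hs3
        exact ContinuousOn.intervalIntegrable_of_Icc hs0.le (by fun_prop)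
      · have := mul_le_mul_of_nonneg_left (hI t (hs3 ht)) hC₁.le
        linarith
    refine this.trans ?_
    rw [intervalIntegral.integral_add (by simp)
      (((cF.mono hs3).intervalIntegrable_of_Icc hs0.le).const_mul _),
      intervalIntegral.integral_const, intervalIntegral.integral_const_mul, smul_eq_mul]
    have q2 : ∫ t in s..0, F t ≤ ∫ t in (-1)..0, F t :=
      integral_le_integral_of_subinterval hs.1 hs0.le le_rfl cF F0
    have q3 : C₁ * (16 * K) * (∫ t in s..0, F t) ≤ C₁ * (16 * K) * E₀ := by
      gcongr; exact q2.trans hE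
    have q4 : (0 - s) * (C₁ * (ε * W)) ≤ 1 * (C₁ * (ε * W)) := by gcongr; linarith [hs.1]
    linarith
  have hfirst : 1 / (0 - s) * (∫ x, v x s * wt x) ≤ 2 * (ε * W + 16 * K * (2 * E₀)) := by
    have h1 : 1 / (0 - s) ≤ 2 := by
      rw [div_le_iff₀ (by linarith)]; linarith [hs.2]
    have h2 : 0 ≤ ∫ x, v x s * wt x := integral_nonneg fun x =>
      mul_nonneg (S.nonneg x s (hsub hs2)) (wt_nonneg x)
    have h3 : F s ≤ 2 * E₀ := by linarith
    calc _ ≤ 2 * ∫ x, v x s * wt x := by gcongr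
      _ ≤ 2 * (ε * W + 16 * K * F s) := by gcongr; exact hI s hs2
      _ ≤ _ := by gcongr
  calc v 0 0 ≤ _ := mv
    _ ≤ Real.exp Λ * (2 * (ε * W + 16 * K * (2 * E₀)) + C₁ * (ε * W + 16 * K * E₀)) := by gcongr
    _ = Real.exp Λ * (2 + C₁) * ε * W + Real.exp Λ * (64 + 16 * C₁) * K * E₀ := by ring
    _ ≤ 1 / 2 := by linarith

/-- Logarithmic cut-off function. -/
noncomputable def logCut (A : ℝ) (x : E2) : ℝ := max (1 - Real.log (1 + ‖x‖ ^ 2) / A) 0 ^ 3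

lemma logCut_profile (A : ℝ) :
    Profile (fun s => max (1 - Real.log (1 + s) / A) 0 ^ 3)
      (fun s => 3 * max (1 - Real.log (1 + s) / A) 0 ^ 2 * (-(1 / (1 + s) / A)))
      (fun s => 3 * (2 * max (1 - Real.log (1 + s) / A) 0 * (-(1 / (1 + s) / A)))
          * (-(1 / (1 + s) / A))
        + 3 * max (1 - Real.log (1 + s) / A) 0 ^ 2 * (1 / (1 + s) ^ 2 / A)) where
  d1 s hs := by
    have h0 := (((hasDerivAt_id s).const_add 1).log (by simp only [id]; linarith)).div_const A
    have h := (hasDerivAt_pos_pow 1 (1 - Real.log (1 + s) / A)).comp s (h0.const_sub 1)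
    exact h.congr_deriv (by simp only [id]; push_cast; ring)
  d2 s hs := by
    have hs1 : (1 : ℝ) + s ≠ 0 := by linarith
    have h0 := (((hasDerivAt_id s).const_add 1).log (by simp only [id]; linarith)).div_const A
    have h := (hasDerivAt_pos_pow 0 (1 - Real.log (1 + s) / A)).comp s (h0.const_sub 1)
    have h1 := ((((hasDerivAt_id s).const_add 1).inv (by simp only [id]; linarith)).div_const A).neg
    have h2 := (h.const_mul 3).mul h1
    refine (h2.congr_of_eventuallyEq (Eventually.of_forall fun y => ?_)).congr_deriv ?_
    · simp [Function.comp]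
    · simp only [id, Function.comp, Pi.neg_apply, Pi.inv_apply]; push_cast; ring
  c := by
    have h1 : ContinuousOn (fun s : ℝ => Real.log (1 + s)) (Ioi (-1)) :=
      ContinuousOn.log (by fun_prop) fun s hs => by have := mem_Ioi.1 hs; linarith
    have h2 : ContinuousOn (fun s : ℝ => 1 / (1 + s)) (Ioi (-1)) :=
      ContinuousOn.div (by fun_prop) (by fun_prop) fun s hs => by have := mem_Ioi.1 hs; linarith
    have h3 : ContinuousOn (fun s : ℝ => 1 / (1 + s) ^ 2) (Ioi (-1)) :=
      ContinuousOn.div (by fun_prop) (by fun_prop) fun s hs => by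
        have := mem_Ioi.1 hs; have : 0 < 1 + s := by linarith
        positivity
    have h4 : ContinuousOn (fun s : ℝ => max (1 - Real.log (1 + s) / A) 0) (Ioi (-1)) :=
      (continuousOn_const.sub (h1.div_const A)).sup continuousOn_const
    fun_prop

lemma logCut_contDiff (A : ℝ) : ContDiff ℝ 2 (logCut A) := (logCut_profile A).contDiff

lemma logCut_nonneg (A : ℝ) (x : E2) : 0 ≤ logCut A x := by unfold logCut; positivity

lemma logCut_le_one {A : ℝ} (hA : 0 < A) (x : E2) : logCut A x ≤ 1 := by
  refine pow_le_one₀ (le_max_right _ _) (max_le ?_ zero_le_one)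
  have : 0 ≤ Real.log (1 + ‖x‖ ^ 2) / A :=
    div_nonneg (Real.log_nonneg (by nlinarith [sq_nonneg ‖x‖])) hA.le
  linarith

lemma logCut_vanish {A : ℝ} (hA : 0 < A) : VanishOff (Real.exp A) (logCut A) := fun x hx => by
  have h1 : Real.exp A ≤ 1 + ‖x‖ ^ 2 := by
    nlinarith [sq_nonneg (‖x‖ - 1), norm_nonneg x]
  have h2 : A ≤ Real.log (1 + ‖x‖ ^ 2) := by
    rw [Real.le_log_iff_exp_le (by positivity)]; exact h1
  have h3 : 1 - Real.log (1 + ‖x‖ ^ 2) / A ≤ 0 := by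
    rw [sub_nonpos, le_div_iff₀ hA]; linarith
  simp [logCut, h3]

lemma wt_le_logCut {A : ℝ} (hA : 4 ≤ A) (x : E2) : wt x ≤ 16 * logCut A x := by
  unfold wt
  rcases le_or_gt (‖x‖ ^ 2) 2 with h | h
  · have h1 : Real.log (1 + ‖x‖ ^ 2) ≤ 2 :=
      (Real.log_le_sub_one_of_pos (by positivity)).trans (by linarith)
    have h2 : (1 / 2 : ℝ) ≤ max (1 - Real.log (1 + ‖x‖ ^ 2) / A) 0 := by
      refine le_max_of_le_left ?_
      have : Real.log (1 + ‖x‖ ^ 2) / A ≤ 1 / 2 := by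
        rw [div_le_iff₀ (by linarith)]; linarith
      linarith
    have h3 : (1 / 2 : ℝ) ^ 3 ≤ logCut A x := by unfold logCut; gcongr
    refine max_le ?_ ?_ <;> nlinarith [sq_nonneg ‖x‖]
  · rw [max_eq_right (by linarith)]
    have := logCut_nonneg A x
    positivity

lemma neg_lap_logCut_le {A : ℝ} (hA : 0 < A) (x : E2) :
    -lap (logCut A) x ≤ 12 / A * (1 + ‖x‖ ^ 2) ^ (-(4 : ℝ) / 2) := by
  have h := (logCut_profile A).lap x
  have e : (fun x : E2 => max (1 - Real.log (1 + ‖x‖ ^ 2) / A) 0 ^ 3) = logCut A := rfl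
  rw [e] at h
  rw [h]
  have hq0 : 0 ≤ max (1 - Real.log (1 + ‖x‖ ^ 2) / A) 0 := le_max_right _ _
  have hq1 : max (1 - Real.log (1 + ‖x‖ ^ 2) / A) 0 ≤ 1 := by
    refine max_le ?_ zero_le_one
    have : 0 ≤ Real.log (1 + ‖x‖ ^ 2) / A :=
      div_nonneg (Real.log_nonneg (by nlinarith [sq_nonneg ‖x‖])) hA.le
    linarith
  generalize max (1 - Real.log (1 + ‖x‖ ^ 2) / A) 0 = q at *
  have hs : 0 ≤ ‖x‖ ^ 2 := by positivity
  generalize ‖x‖ ^ 2 = s at *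
  have hs1 : 0 < 1 + s := by linarith
  have e2 : (1 + s) ^ (-(4 : ℝ) / 2) = 1 / (1 + s) ^ 2 := by
    rw [show -(4 : ℝ) / 2 = -((2 : ℕ) : ℝ) by norm_num, Real.rpow_neg hs1.le, Real.rpow_natCast,
      one_div]
  rw [e2]
  have e3 : -(4 * s * (3 * (2 * q * -(1 / (1 + s) / A)) * -(1 / (1 + s) / A)
      + 3 * q ^ 2 * (1 / (1 + s) ^ 2 / A)) + 4 * (3 * q ^ 2 * -(1 / (1 + s) / A)))
      = 12 / A * (1 / (1 + s) ^ 2) * q ^ 2 - 24 * s * q / (A ^ 2 * (1 + s) ^ 2) := by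
    field_simp; ring
  rw [e3]
  have h1 : 0 ≤ 24 * s * q / (A ^ 2 * (1 + s) ^ 2) := by positivity
  have h2 : 12 / A * (1 / (1 + s) ^ 2) * q ^ 2 ≤ 12 / A * (1 / (1 + s) ^ 2) * 1 := by
    gcongr; exact pow_le_one₀ hq0 hq1
  linarith

/-- Nonnegative classical solutions of `∂ₜu = Δu + u^p` on `Ω × (a, b)`, where
`u'` stands for the time derivative of `u`. -/
structure LSol (p : ℝ) (Ω : Set E2) (a b : ℝ) (u u' : E2 → ℝ → ℝ) : Prop where
  c2 : ∀ t ∈ Ioo a b, ContDiffOn ℝ 2 (fun x => u x t) Ω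
  der : ∀ x ∈ Ω, ∀ t ∈ Ioo a b, HasDerivAt (u x) (u' x t) t
  ct : ∀ x ∈ Ω, ContinuousOn (u' x) (Ioo a b)
  nonneg : ∀ x ∈ Ω, ∀ t ∈ Ioo a b, 0 ≤ u x t
  eq : ∀ x ∈ Ω, ∀ t ∈ Ioo a b, u' x t = lap (fun y => u y t) x + u x t ^ p

lemma LSol.mono {p : ℝ} {Ω Ω' : Set E2} {a b a' b' : ℝ} {u u' : E2 → ℝ → ℝ}
    (S : LSol p Ω a b u u') (hΩ : Ω' ⊆ Ω) (ha : a ≤ a') (hb : b' ≤ b) : LSol p Ω' a' b' u u' := by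
  have hs : Ioo a' b' ⊆ Ioo a b := Ioo_subset_Ioo ha hb
  exact ⟨fun t ht => (S.c2 t (hs ht)).mono hΩ, fun x hx t ht => S.der x (hΩ hx) t (hs ht),
    fun x hx => (S.ct x (hΩ hx)).mono hs, fun x hx t ht => S.nonneg x (hΩ hx) t (hs ht),
    fun x hx t ht => S.eq x (hΩ hx) t (hs ht)⟩

lemma pd_affine (κ : ℝ) (f : E2 → ℝ) (x₀ : E2) (l : ℝ) (i : Fin 2) (y : E2) :
    pd i (fun y => κ * f (x₀ + l • y)) y = κ * l * pd i f (x₀ + l • y) := by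
  have h1 : fderiv ℝ (fun y => κ * f (x₀ + l • y)) y
      = κ • fderiv ℝ (fun y => f (x₀ + l • y)) y := by
    have := congrFun (fderiv_const_smul_field (𝕜 := ℝ) κ (f := fun y : E2 => f (x₀ + l • y))) y
    exact this
  have h2 : fderiv ℝ (fun y => f (x₀ + l • y)) y = l • fderiv ℝ (fun z => f (x₀ + z)) (l • y) :=
    fderiv_comp_smul (f := fun z => f (x₀ + z)) l
  simp only [pd, h1, h2, fderiv_comp_add_left, _root_.smul_apply, smul_eq_mul]
  ring

lemma lap_affine (κ : ℝ) (f : E2 → ℝ) (x₀ : E2) (l : ℝ) (y : E2) :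
    lap (fun y => κ * f (x₀ + l • y)) y = κ * l ^ 2 * lap f (x₀ + l • y) := by
  have h : ∀ i, pd i (fun y => κ * f (x₀ + l • y)) = fun y => κ * l * pd i f (x₀ + l • y) :=
    fun i => by ext y; exact pd_affine κ f x₀ l i y
  simp only [lap_eq, h, pd_affine, Finset.mul_sum]
  refine Finset.sum_congr rfl fun i _ => by ring

/-- Parabolic rescaling of a solution. -/
lemma LSol.rescale {p : ℝ} (hp : 1 < p) {Ω Ω' : Set E2} {a b a' b' : ℝ} {u u' : E2 → ℝ → ℝ}
    (S : LSol p Ω a b u u') {l : ℝ} (hl : 0 < l) (x₀ : E2) (t₀ : ℝ)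
    (hΩ : ∀ y ∈ Ω', x₀ + l • y ∈ Ω)
    (hI : ∀ s ∈ Ioo a' b', t₀ + l ^ 2 * s ∈ Ioo a b) :
    LSol p Ω' a' b' (fun y s => l ^ (2 * (1 / (p - 1))) * u (x₀ + l • y) (t₀ + l ^ 2 * s))
      (fun y s => l ^ (2 * (1 / (p - 1))) * l ^ 2 * u' (x₀ + l • y) (t₀ + l ^ 2 * s)) where
  c2 s hs := by
    refine contDiffOn_const.mul ((S.c2 _ (hI s hs)).comp (f := fun y : E2 => x₀ + l • y)
      (by fun_prop) hΩ)
  der y hy s hs := by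
    have h0 : HasDerivAt (fun s : ℝ => t₀ + l ^ 2 * s) (l ^ 2) s := by
      have := ((hasDerivAt_id s).const_mul (l ^ 2)).const_add t₀
      exact this.congr_deriv (by ring)
    have h1 := (S.der _ (hΩ y hy) _ (hI s hs)).comp s h0
    have h2 := h1.const_mul (l ^ (2 * (1 / (p - 1))))
    exact h2.congr_deriv (by ring)
  ct y hy := continuousOn_const.mul ((S.ct _ (hΩ y hy)).comp (f := fun s : ℝ => t₀ + l ^ 2 * s)
      (by fun_prop) fun s hs => hI s hs)
  nonneg y hy s hs := mul_nonneg (by positivity) (S.nonneg _ (hΩ y hy) _ (hI s hs))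
  eq y hy s hs := by
    have h1 := lap_affine (l ^ (2 * (1 / (p - 1)))) (fun x => u x (t₀ + l ^ 2 * s)) x₀ l y
    have hp1 : p - 1 ≠ 0 := by linarith
    rw [S.eq _ (hΩ y hy) _ (hI s hs)]
    rw [h1, Real.mul_rpow (by positivity) (S.nonneg _ (hΩ y hy) _ (hI s hs)), ← Real.rpow_mul hl.le]
    have h2 : l ^ (2 * (1 / (p - 1)) * p) = l ^ (2 * (1 / (p - 1))) * l ^ 2 := by
      rw [← Real.rpow_natCast l 2, ← Real.rpow_add hl]
      congr 1; field_simp; push_cast; ring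
    rw [h2]; ring

lemma LSol.contDiffAt {p : ℝ} {Ω : Set E2} {a b : ℝ} {u u' : E2 → ℝ → ℝ} (S : LSol p Ω a b u u')
    (hΩ : IsOpen Ω) {x : E2} (hx : x ∈ Ω) {t : ℝ} (ht : t ∈ Ioo a b) :
    ContDiffAt ℝ 2 (fun x => u x t) x := (S.c2 t ht).contDiffAt (hΩ.mem_nhds hx)

lemma continuousOn_lap {f : E2 → ℝ} {Ω : Set E2} (hΩ : IsOpen Ω) (hf : ContDiffOn ℝ 2 f Ω) :
    ContinuousOn (lap f) Ω := by
  have h1 : ∀ i, ContDiffOn ℝ 1 (pd i f) Ω := fun i =>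
    (hf.fderiv_of_isOpen (m := 1) hΩ (by norm_num [one_add_one_eq_two])).clm_apply contDiffOn_const
  have h2 : ∀ i, ContDiffOn ℝ 0 (pd i (pd i f)) Ω := fun i =>
    ((h1 i).fderiv_of_isOpen (m := 0) hΩ (by norm_num)).clm_apply contDiffOn_const
  exact continuousOn_finsetSum _ fun i _ => (h2 i).continuousOn

lemma LSol.continuousOn_deriv {p : ℝ} (hp : 1 < p) {Ω : Set E2} {a b : ℝ} {u u' : E2 → ℝ → ℝ}
    (S : LSol p Ω a b u u') (hΩ : IsOpen Ω) {t : ℝ} (ht : t ∈ Ioo a b) :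
    ContinuousOn (fun x => u' x t) Ω := by
  have h := (continuousOn_lap hΩ (S.c2 t ht)).add
    ((S.c2 t ht).continuousOn.rpow_const (p := p) fun x _ => Or.inr (by linarith))
  exact h.congr fun x hx => S.eq x hx t ht

/-- A bounded function on a ball can be cut off to a globally defined function. -/
lemma exists_greg {r r' : ℝ} (hr : 0 < r) (hrr : r < r') {a b M : ℝ} {w w' : E2 → ℝ → ℝ}
    (c2 : ∀ t ∈ Ioo a b, ContDiffOn ℝ 2 (fun x => w x t) (Metric.ball 0 r'))
    (c0 : ∀ t ∈ Ioo a b, ContinuousOn (fun x => w' x t) (Metric.ball 0 r'))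
    (der : ∀ x ∈ Metric.ball (0 : E2) r', ∀ t ∈ Ioo a b, HasDerivAt (w x) (w' x t) t)
    (ct : ∀ x ∈ Metric.ball (0 : E2) r', ContinuousOn (w' x) (Ioo a b))
    (hM : ∀ x ∈ Metric.ball (0 : E2) r', ∀ t ∈ Ioo a b, |w x t| ≤ M)
    (hM' : ∀ x ∈ Metric.ball (0 : E2) r', ∀ t ∈ Ioo a b, |w' x t| ≤ M) :
    ∃ (χ : E2 → ℝ) (v v' : E2 → ℝ → ℝ), GReg v v' a b r' |M| ∧
      (∀ x, 0 ≤ χ x ∧ χ x ≤ 1) ∧ (∀ x, x ∉ Metric.ball (0 : E2) r' → χ x = 0) ∧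
      (∀ x t, v x t = χ x * w x t) ∧
      (∀ x, ‖x‖ ≤ r → ∀ t, v x t = w x t) ∧ (∀ x, ‖x‖ ≤ r → ∀ t, v' x t = w' x t) ∧
      ∀ x, ‖x‖ ≤ r → ∀ t, lap (fun y => v y t) x = lap (fun y => w y t) x := by
  obtain ⟨χ, hχ⟩ : ∃ χ : ContDiffBump (0 : E2), χ.rIn = r + (r' - r) / 3 ∧ 
      χ.rOut = r + 2 * (r' - r) / 3 :=
    ⟨⟨r + (r' - r) / 3, r + 2 * (r' - r) / 3, by linarith, by linarith⟩, rfl, rfl⟩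
  have one : ∀ x : E2, ‖x‖ < r + (r' - r) / 3 → χ x = 1 := fun x hx =>
    χ.one_of_mem_closedBall (by simpa [hχ.1] using hx.le)
  have zero : ∀ x : E2, r + 2 * (r' - r) / 3 ≤ ‖x‖ → χ x = 0 := fun x hx =>
    χ.zero_of_le_dist (by simpa [hχ.2] using hx)
  have ev : ∀ x : E2, x ∉ Metric.ball (0 : E2) r' → ∀ᶠ y in 𝓝 x, χ y = 0 := fun x hx => by
    have h : r + 2 * (r' - r) / 3 < ‖x‖ := by
      simp only [Metric.mem_ball, dist_zero_right, not_lt] at hx; linarith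
    filter_upwards [(isOpen_lt continuous_const continuous_norm).mem_nhds h] with y hy
      using zero y (le_of_lt hy)
  have le : ∀ x, |χ x| ≤ 1 := fun x => abs_le.2 ⟨by linarith [χ.nonneg (x := x)], χ.le_one⟩
  have bound : ∀ w : E2 → ℝ → ℝ, (∀ x ∈ Metric.ball (0 : E2) r', ∀ t ∈ Ioo a b, |w x t| ≤ M) →
      ∀ x, ∀ t ∈ Ioo a b, |χ x * w x t| ≤ |M| := fun w hw x t ht => by
    by_cases hx : x ∈ Metric.ball (0 : E2) r'
    · rw [abs_mul]
      calc _ ≤ 1 * |w x t| := by gcongr; exact le x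
        _ ≤ |M| := by rw [one_mul]; exact (hw x hx t ht).trans (le_abs_self M)
    · rw [(ev x hx).self_of_nhds]; simp
  have van : ∀ w : E2 → ℝ, VanishOff r' fun x => χ x * w x := fun w x hx => by
    simp only [zero x (by linarith), zero_mul]
  have near : ∀ x : E2, ‖x‖ ≤ r → ∀ t, (fun y => χ y * w y t) =ᶠ[𝓝 x] fun y => w y t :=
    fun x hx t => by
      have h : ‖x‖ < r + (r' - r) / 3 := by linarith
      filter_upwards [(isOpen_lt continuous_norm continuous_const).mem_nhds h] with y hy
      rw [one y hy, one_mul]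
  refine ⟨χ, fun x t => χ x * w x t, fun x t => χ x * w' x t, ⟨?_, ?_, ?_, ?_, bound w hM,
    bound w' hM', fun t _ => van _, fun t _ => van _⟩, fun x => ⟨χ.nonneg, χ.le_one⟩,
    fun x hx => (ev x hx).self_of_nhds, fun _ _ => rfl, ?_, ?_, fun x hx t => lap_congr (near x hx t)⟩
  · intro t ht
    rw [contDiff_iff_contDiffAt]
    intro x
    by_cases hx : x ∈ Metric.ball (0 : E2) r'
    · exact χ.contDiffAt.mul ((c2 t ht).contDiffAt (Metric.isOpen_ball.mem_nhds hx))
    · refine (contDiffAt_const (c := (0 : ℝ))).congr_of_eventuallyEq ?_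
      filter_upwards [ev x hx] with y hy using by rw [hy, zero_mul]
  · intro t ht
    rw [continuous_iff_continuousAt]
    intro x
    by_cases hx : x ∈ Metric.ball (0 : E2) r'
    · exact χ.continuous.continuousAt.mul ((c0 t ht).continuousAt (Metric.isOpen_ball.mem_nhds hx))
    · refine (continuousAt_const (y := (0 : ℝ))).congr ?_
      filter_upwards [ev x hx] with y hy using by rw [hy, zero_mul]
  · intro x t ht
    by_cases hx : x ∈ Metric.ball (0 : E2) r'
    · exact (der x hx t ht).const_mul _
    · have := (ev x hx).self_of_nhds
      simp only [this, zero_mul]; exact hasDerivAt_const _ _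
  · intro x
    by_cases hx : x ∈ Metric.ball (0 : E2) r'
    · exact continuousOn_const.mul (ct x hx)
    · have := (ev x hx).self_of_nhds
      simp only [this, zero_mul]; exact continuousOn_const
  · intro x hx t; simp only [one x (by linarith), one_mul]
  · intro x hx t; simp only [one x (by linarith), one_mul]

/-- A bounded solution on a ball can be cut off to a globally defined function. -/
lemma LSol.exists_psol {p : ℝ} (hp : 1 < p) {r r' : ℝ} (hr : 0 < r) (hrr : r < r') {a b M : ℝ}
    {u u' : E2 → ℝ → ℝ} (S : LSol p (Metric.ball 0 r') a b u u')
    (hM : ∀ x ∈ Metric.ball (0 : E2) r', ∀ t ∈ Ioo a b, |u x t| ≤ M)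
    (hM' : ∀ x ∈ Metric.ball (0 : E2) r', ∀ t ∈ Ioo a b, |u' x t| ≤ M) :
    ∃ v v' : E2 → ℝ → ℝ, PSol p r v v' a b r' |M| ∧
      (∀ x, ‖x‖ ≤ r → ∀ t, v x t = u x t) ∧ ∀ x, ‖x‖ ≤ r → ∀ t, v' x t = u' x t := by
  obtain ⟨χ, v, v', hv, h01, hz, he, h1, h2, h3⟩ := exists_greg hr hrr S.c2
    (fun t ht => S.continuousOn_deriv hp Metric.isOpen_ball ht) S.der S.ct hM hM'
  refine ⟨v, v', ⟨hv, fun x t ht => ?_, fun x hx t ht => ?_⟩, h1, h2⟩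
  · rw [he]
    by_cases hx : x ∈ Metric.ball (0 : E2) r'
    · exact mul_nonneg (h01 x).1 (S.nonneg x hx t ht)
    · simp [hz x hx]
  · rw [h1 x hx, h2 x hx, h3 x hx]
    exact S.eq x (by simp; linarith) t ht

/-- The weight controlling the Laplacian of `logCut`. -/
lemma integrable_logWeight : Integrable fun x : E2 => (1 + ‖x‖ ^ 2) ^ (-(4 : ℝ) / 2) :=
  integrable_rpow_neg_one_add_norm_sq (by norm_num)

lemma logCut_continuous (A : ℝ) : Continuous (logCut A) := (logCut_contDiff A).continuous

lemma PSol.integral_rpow_logCut_le {p ρ : ℝ} {v v' : E2 → ℝ → ℝ} {a b R M L A δ : ℝ} (hp : 1 < p)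
    (S : PSol p ρ v v' a b R M) (hL : 0 ≤ L) (hA : 0 < A) (hδ : 0 < δ) (hρ : Real.exp A ≤ ρ)
    {t : ℝ} (ht : t ∈ Ioo a b) (hv : ∀ x, ‖x‖ ≤ ρ → v x t ≤ L) :
    ∫ x, v x t ^ p * logCut A x ≤ 1 / δ * (∫ x, v' x t * v' x t * logCut A x)
      + δ * (∫ x, logCut A x) + L * (12 / A) * ∫ x : E2, (1 + ‖x‖ ^ 2) ^ (-(4 : ℝ) / 2) := by
  have hvan : VanishOff ρ (logCut A) := (logCut_vanish hA).mono hρ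
  have e := S.integral_eq (by linarith) (logCut_contDiff A) hvan ht
  have i1 : Integrable fun x => v' x t * v' x t * logCut A x :=
    (hvan.mul_left _).integrable (((S.reg.c0 t ht).mul (S.reg.c0 t ht)).mul (logCut_continuous A))
  have i2 : Integrable (logCut A) := hvan.integrable (logCut_continuous A)
  have h1 : ∫ x, v' x t * logCut A x
      ≤ 1 / δ * (∫ x, v' x t * v' x t * logCut A x) + δ * (∫ x, logCut A x) := by
    rw [← integral_const_mul, ← integral_const_mul, ← integral_add (i1.const_mul _) (i2.const_mul _)]
    refine integral_mono (S.reg.integrable_mul' (logCut_continuous A) ht)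
      ((i1.const_mul _).add (i2.const_mul _)) fun x => ?_
    have h : v' x t ≤ 1 / δ * (v' x t * v' x t) + δ := by
      rw [one_div, ← sub_nonneg]
      have : δ⁻¹ * (v' x t * v' x t) + δ - v' x t
        = δ⁻¹ * ((v' x t - δ / 2) ^ 2 + 3 / 4 * δ ^ 2) := by field_simp; ring
      rw [this]; positivity
    have := mul_le_mul_of_nonneg_right h (logCut_nonneg A x)
    simp only
    linarith
  have h2 : -∫ x, v x t * lap (logCut A) x
      ≤ L * (12 / A) * ∫ x : E2, (1 + ‖x‖ ^ 2) ^ (-(4 : ℝ) / 2) := by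
    rw [← integral_neg, ← integral_const_mul]
    have i3 : Integrable fun x => -(v x t * lap (logCut A) x) :=
      (S.reg.integrable_mul (continuous_lap (logCut_contDiff A)) ht).neg
    refine integral_mono i3 (integrable_logWeight.const_mul _) fun x => ?_
    have hw : 0 ≤ (1 + ‖x‖ ^ 2) ^ (-(4 : ℝ) / 2) := by positivity
    rcases le_or_gt ‖x‖ ρ with hx | hx
    · have v0 := S.nonneg x t ht
      calc -(v x t * lap (logCut A) x) = v x t * -lap (logCut A) x := by ring
        _ ≤ v x t * (12 / A * (1 + ‖x‖ ^ 2) ^ (-(4 : ℝ) / 2)) := by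
          gcongr; exact neg_lap_logCut_le hA x
        _ ≤ L * (12 / A * (1 + ‖x‖ ^ 2) ^ (-(4 : ℝ) / 2)) := by gcongr; exact hv x hx
        _ = _ := by ring
    · simp only [hvan.lap x hx, mul_zero, neg_zero]; positivity
  linarith

lemma PSol.integral_integral_rpow_logCut_le {p ρ : ℝ} {v v' : E2 → ℝ → ℝ} {a b R M L A δ : ℝ}
    (hp : 1 < p) (S : PSol p ρ v v' a b R M) (hL : 0 ≤ L) (hA : 0 < A) (hδ : 0 < δ)
    (hρ : Real.exp A ≤ ρ) (ha : a < -1) (hb : 0 < b)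
    (hv : ∀ x, ‖x‖ ≤ ρ → ∀ t ∈ Ioo a b, v x t ≤ L) {H : ℝ → ℝ} (hH : ContinuousOn H (Icc (-1) 0))
    (hH' : ∀ t ∈ Icc (-1 : ℝ) 0, ∫ x, v' x t * v' x t * logCut A x ≤ H t) :
    ∫ t in (-1)..0, ∫ x, v x t ^ p * logCut A x ≤ 1 / δ * (∫ t in (-1)..0, H t)
      + (δ * (∫ x, logCut A x) + L * (12 / A) * ∫ x : E2, (1 + ‖x‖ ^ 2) ^ (-(4 : ℝ) / 2)) := by
  have hsub : Icc (-1 : ℝ) 0 ⊆ Ioo a b := fun t ht => ⟨ha.trans_le ht.1, ht.2.trans_lt hb⟩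
  generalize hB : δ * (∫ x, logCut A x)
    + L * (12 / A) * ∫ x : E2, (1 + ‖x‖ ^ 2) ^ (-(4 : ℝ) / 2) = B
  have h1 : ∫ t in (-1)..0, ∫ x, v x t ^ p * logCut A x
      ≤ ∫ t in (-1)..0, (B + 1 / δ * H t) := by
    refine intervalIntegral.integral_mono_on (by norm_num) ?_ ?_ fun t ht => ?_
    · exact ((S.rpow_integral_continuousOn (by linarith) (logCut_continuous A)
        (logCut_vanish hA)).mono hsub).intervalIntegrable_of_Icc (by norm_num)
    · exact ContinuousOn.intervalIntegrable_of_Icc (by norm_num) (by fun_prop)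
    · have h1 := S.integral_rpow_logCut_le hp hL hA hδ hρ (hsub ht) fun x hx => hv x hx t (hsub ht)
      have h2 : 1 / δ * (∫ x, v' x t * v' x t * logCut A x) ≤ 1 / δ * H t := by
        gcongr; exact hH' t ht
      linarith
  refine h1.trans (le_of_eq ?_)
  rw [intervalIntegral.integral_add (by simp)
    ((hH.intervalIntegrable_of_Icc (by norm_num)).const_mul _), intervalIntegral.integral_const,
    intervalIntegral.integral_const_mul]
  simp; ring

lemma integral_derivSq_rescale_le {p ρ l κ A : ℝ} {U U' v v' : E2 → ℝ → ℝ}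
    {a b R M a' b' R' M' : ℝ} (S : PSol p 3 U U' a b R M) (V : PSol p ρ v v' a' b' R' M')
    (hl : 0 < l) (hA : 0 < A) (hlA : l * Real.exp A ≤ 1) {s : ℝ} (hs : s ∈ Ioo a' b')
    (hs' : l ^ 2 * s ∈ Ioo a b)
    (hv : ∀ y, ‖y‖ ≤ Real.exp A → v' y s = κ * l ^ 2 * U' (l • y) (l ^ 2 * s)) :
    ∫ y, v' y s * v' y s * logCut A y
      ≤ 3 * κ ^ 2 * l ^ 2 * ∫ x, U' x (l ^ 2 * s) * U' x (l ^ 2 * s) * bump 3 4 x := by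
  obtain ⟨g, hg⟩ : ∃ g : E2 → ℝ, g = fun x => U' x (l ^ 2 * s) * U' x (l ^ 2 * s) * bump 3 4 x :=
    ⟨_, rfl⟩
  have hcg : Continuous g := by
    rw [hg]; exact ((S.reg.c0 _ hs').mul (S.reg.c0 _ hs')).mul (bump_continuous 3 4)
  have hvg : VanishOff 2 g := by
    rw [hg]; exact (bump_vanish_four 3 (by norm_num)).mul_left _
  have ig : Integrable g := hvg.integrable hcg
  have g0 : ∀ x, 0 ≤ g x := fun x => by
    rw [hg]; exact mul_nonneg (mul_self_nonneg _) (bump_nonneg _ _ _)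
  have igl : Integrable fun y => g (l • y) := ig.comp_smul hl.ne'
  have h := Measure.integral_comp_smul (volume : Measure E2) g l
  rw [show Module.finrank ℝ E2 = 2 by simp [E2], abs_of_pos (by positivity), smul_eq_mul] at h
  have e : 3 * κ ^ 2 * l ^ 2 * ∫ x, U' x (l ^ 2 * s) * U' x (l ^ 2 * s) * bump 3 4 x
      = ∫ y, 3 * κ ^ 2 * l ^ 4 * g (l • y) := by
    rw [integral_const_mul, h, ← hg]; field_simp
  rw [e]
  refine integral_mono (((logCut_vanish hA).mul_left _).integrable
    (((V.reg.c0 s hs).mul (V.reg.c0 s hs)).mul (logCut_continuous A))) (igl.const_mul _) fun y => ?_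
  rcases le_or_gt ‖y‖ (Real.exp A) with hy | hy
  · have h1 : ‖l • y‖ ≤ 1 := by
      rw [norm_smul, Real.norm_of_nonneg hl.le]
      exact (mul_le_mul_of_nonneg_left hy hl.le).trans hlA
    have h2 : (3 / 4 : ℝ) ^ 3 ≤ bump 3 4 (l • y) := by
      unfold bump
      gcongr
      refine le_max_of_le_left ?_
      nlinarith [norm_nonneg (l • y)]
    have h3 : logCut A y ≤ 3 * bump 3 4 (l • y) := by
      have := logCut_le_one hA y; norm_num at h2; linarith
    simp only [hv y hy, hg]
    calc _ = (κ ^ 2 * l ^ 4 * (U' (l • y) (l ^ 2 * s)) ^ 2) * logCut A y := by ring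
      _ ≤ (κ ^ 2 * l ^ 4 * (U' (l • y) (l ^ 2 * s)) ^ 2) * (3 * bump 3 4 (l • y)) := by gcongr
      _ = _ := by ring
  · simp only [logCut_vanish hA y hy, mul_zero]
    have := g0 (l • y)
    positivity

/-- A solution on a fixed cylinder that is almost maximal at the centre is bounded there. -/
lemma exists_center_le {p L : ℝ} (hp : 1 < p) (hL : 1 ≤ L) : ∃ N₀ > 0,
    ∀ (u u' : E2 → ℝ → ℝ) (M : ℝ), LSol p (Metric.ball 0 5) (-25) 25 u u' →
    (∀ x ∈ Metric.ball (0 : E2) 5, ∀ t ∈ Ioo (-25 : ℝ) 25, |u x t| ≤ M) →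
    (∀ x ∈ Metric.ball (0 : E2) 5, ∀ t ∈ Ioo (-25 : ℝ) 25, |u' x t| ≤ M) →
    (∀ x ∈ Metric.ball (0 : E2) 5, ∀ t ∈ Ioo (-25 : ℝ) 25, u x t ≤ L * u 0 0) → u 0 0 ≤ N₀ := by
  obtain ⟨C, hC, hP⟩ := exists_integral_deriv_sq_le hp
  obtain ⟨E₀, hE₀, hE⟩ := exists_energy_threshold hp hL
  have hp1 : 0 < p - 1 := by linarith
  obtain ⟨J, hJ⟩ : ∃ J, J = ∫ x : E2, (1 + ‖x‖ ^ 2) ^ (-(4 : ℝ) / 2) := ⟨_, rfl⟩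
  have hJ0 : 0 ≤ J := hJ ▸ integral_nonneg fun x => by positivity
  obtain ⟨A, hA4, hA⟩ : ∃ A : ℝ, 4 ≤ A ∧ L * (12 / A) * J ≤ E₀ / 3 := by
    refine ⟨max 4 (36 * L * J / E₀), le_max_left _ _, ?_⟩
    have h1 : 36 * L * J / E₀ ≤ max 4 (36 * L * J / E₀) := le_max_right _ _
    have h2 : (0 : ℝ) < max 4 (36 * L * J / E₀) := lt_max_of_lt_left (by norm_num)
    generalize max 4 (36 * L * J / E₀) = A at *
    rw [div_le_iff₀ hE₀] at h1
    rw [mul_div_assoc', div_mul_eq_mul_div, div_le_iff₀ h2]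
    linarith
  have hA0 : 0 < A := by linarith
  obtain ⟨I, hI⟩ : ∃ I, I = ∫ x, logCut A x := ⟨_, rfl⟩
  have hI0 : 0 ≤ I := hI ▸ integral_nonneg fun x => logCut_nonneg A x
  obtain ⟨δ, hδ, hδI⟩ : ∃ δ > 0, δ * I ≤ E₀ / 3 := by
    refine ⟨E₀ / (3 * (I + 1)), by positivity, ?_⟩
    rw [div_mul_eq_mul_div, div_le_div_iff₀ (by positivity) (by norm_num)]
    nlinarith
  refine ⟨max (max 1 (9 * C * L / (δ * E₀))) (Real.exp A ^ (2 / (p - 1))),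
    by positivity, fun u u' M S hM hM' hmax => ?_⟩
  by_contra hN
  rw [not_le, max_lt_iff, max_lt_iff] at hN
  obtain ⟨N, hNe⟩ : ∃ N, N = u 0 0 := ⟨_, rfl⟩
  rw [← hNe] at hN hmax
  obtain ⟨⟨hN1, hN2⟩, hN3⟩ := hN
  have hN0 : 0 < N := by linarith
  obtain ⟨l, hl⟩ : ∃ l, l = N ^ (-((p - 1) / 2)) := ⟨_, rfl⟩
  have hl0 : 0 < l := hl ▸ by positivity
  have hl1 : l ≤ 1 := hl ▸ Real.rpow_le_one_of_one_le_of_nonpos hN1.le (by linarith)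
  have hlA : l * Real.exp A ≤ 1 := by
    have h1 : Real.exp A ≤ N ^ ((p - 1) / 2) := by
      have := Real.rpow_le_rpow (z := (p - 1) / 2) (by positivity) hN3.le (by linarith)
      rw [← Real.rpow_mul (by positivity), show 2 / (p - 1) * ((p - 1) / 2) = 1 by field_simp,
        Real.rpow_one] at this
      exact this
    calc l * Real.exp A ≤ l * N ^ ((p - 1) / 2) := by gcongr
      _ = 1 := by rw [hl, ← Real.rpow_add hN0]; simp
  have hκ : l ^ (2 * (1 / (p - 1))) = N⁻¹ := by
    rw [hl, ← Real.rpow_mul hN0.le, ← Real.rpow_neg_one]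
    congr 1; field_simp
  have hl2 : l ^ 2 ≤ 1 := pow_le_one₀ hl0.le hl1
  -- the solution at unit scale
  obtain ⟨U, U', PU, hU, hU'⟩ := S.exists_psol hp (r := 4) (by norm_num) (by norm_num) hM hM'
  have hUP := hP U U' _ _ _ _ (L * N) PU (by norm_num) (by norm_num) (by nlinarith)
    fun x hx t ht => by
      rw [hU x (by linarith)]
      exact hmax x (by simp; linarith) t ⟨by linarith [ht.1], by linarith [ht.2]⟩
  have PU3 := PU.mono (r' := 3) le_rfl le_rfl (by norm_num)
  have cG := PU3.derivSq_continuousOn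
  -- the rescaled solution
  have hmem : ∀ y ∈ Metric.ball (0 : E2) (5 / l), (0 : E2) + l • y ∈ Metric.ball (0 : E2) 5 :=
    fun y hy => by
      simp only [zero_add, Metric.mem_ball, dist_zero_right, norm_smul,
        Real.norm_of_nonneg hl0.le] at hy ⊢
      rwa [lt_div_iff₀' hl0] at hy
  have hmemt : ∀ s ∈ Ioo (-25 : ℝ) 25, 0 + l ^ 2 * s ∈ Ioo (-25 : ℝ) 25 := fun s hs => by
    have h0 : 0 < l ^ 2 := by positivity
    constructor <;> nlinarith [hs.1, hs.2]
  have T := S.rescale hp hl0 0 0 hmem hmemt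
  have hN1' : N⁻¹ ≤ 1 := inv_le_one_of_one_le₀ hN1.le
  have hNi : 0 < N⁻¹ := by positivity
  obtain ⟨v, v', PV, hv, hv'⟩ := T.exists_psol hp (r := 4 / l) (M := |M|) (by positivity)
    (by gcongr; norm_num)
    (fun y hy s hs => by
      rw [hκ, abs_mul, abs_of_pos hNi]
      have := mul_le_mul hN1' ((hM _ (hmem y hy) _ (hmemt s hs)).trans (le_abs_self M))
        (abs_nonneg _) zero_le_one
      rwa [one_mul] at this)
    (fun y hy s hs => by
      rw [hκ, abs_mul, abs_mul, abs_of_pos hNi, abs_of_nonneg (by positivity : 0 ≤ l ^ 2)]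
      have := mul_le_mul (mul_le_one₀ hN1' (by positivity) hl2)
        ((hM' _ (hmem y hy) _ (hmemt s hs)).trans (le_abs_self M)) (abs_nonneg _) zero_le_one
      rwa [one_mul] at this)
  have hvL : ∀ y, ‖y‖ ≤ 4 / l → ∀ t ∈ Ioo (-25 : ℝ) 25, v y t ≤ L := fun y hy t ht => by
    rw [hv y hy, hκ]
    have := hmax _ (hmem y (by simp; exact hy.trans_lt (by gcongr; norm_num))) _ (hmemt t ht)
    calc _ ≤ N⁻¹ * (L * N) := by gcongr
      _ = L := by field_simp
  have hρ : Real.exp A ≤ 4 / l := by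
    rw [le_div_iff₀ hl0]; linarith
  have h1l : 1 ≤ 4 / l := by rw [le_div_iff₀ hl0]; linarith
  have hsubl : MapsTo (fun s => l ^ 2 * s) (Icc (-1 : ℝ) 0) (Ioo (-25) 25) := fun s hs => by
    have := hmemt s ⟨by linarith [hs.1], by linarith [hs.2]⟩
    simpa using this
  obtain ⟨G, hG⟩ : ∃ G : ℝ → ℝ, G = fun t => ∫ x, U' x t * U' x t * bump 3 4 x := ⟨_, rfl⟩
  rw [← hG] at cG
  have hUP' : ∫ t in (-1)..1, G t ≤ C * (L * N) := by rw [hG]; exact hUP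
  have hfin := PV.integral_integral_rpow_logCut_le hp (by linarith) hA0 hδ hρ (by norm_num)
    (by norm_num) hvL (H := fun s => 3 * N⁻¹ ^ 2 * l ^ 2 * G (l ^ 2 * s))
    (continuousOn_const.mul (cG.comp (by fun_prop) hsubl))
    fun s hs => by
      rw [hG]
      refine integral_derivSq_rescale_le PU3 PV hl0 hA0 hlA ⟨by linarith [hs.1], by linarith [hs.2]⟩ (hsubl hs) fun y hy => ?_
      rw [hv' y (hy.trans hρ), hκ, zero_add, zero_add, hU']
      rw [norm_smul, Real.norm_of_nonneg hl0.le]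
      have := mul_le_mul_of_nonneg_left hy hl0.le
      linarith
  have hHint : ∫ s in (-1)..0, 3 * N⁻¹ ^ 2 * l ^ 2 * G (l ^ 2 * s) ≤ 3 * C * L * N⁻¹ := by
    have e : ∫ s in (-1)..0, 3 * N⁻¹ ^ 2 * l ^ 2 * G (l ^ 2 * s)
        = 3 * N⁻¹ ^ 2 * ∫ t in (l ^ 2 * (-1))..(l ^ 2 * 0), G t := by
      rw [← intervalIntegral.mul_integral_comp_mul_left, intervalIntegral.integral_const_mul]
      ring
    have h2 : ∫ t in (l ^ 2 * (-1))..(l ^ 2 * 0), G t ≤ ∫ t in (-1)..1, G t := by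
      refine integral_le_integral_of_subinterval (by linarith) (by nlinarith) (by norm_num)
        (cG.mono fun t ht => ⟨by linarith [ht.1], by linarith [ht.2]⟩) fun t _ => ?_
      rw [hG]
      exact integral_nonneg fun x => mul_nonneg (mul_self_nonneg _) (bump_nonneg _ _ _)
    rw [e]
    calc _ ≤ 3 * N⁻¹ ^ 2 * (C * (L * N)) := by gcongr; exact h2.trans hUP'
      _ = _ := by field_simp
  have hδN : 1 / δ * (3 * C * L * N⁻¹) ≤ E₀ / 3 := by
    rw [div_lt_iff₀ (by positivity)] at hN2
    have : 1 / δ * (3 * C * L * N⁻¹) = 3 * C * L / (δ * N) := by field_simp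
    rw [this, div_le_div_iff₀ (by positivity) (by norm_num)]
    nlinarith
  rw [← hI, ← hJ] at hfin
  have hδN' : 1 / δ * (∫ s in (-1)..0, 3 * N⁻¹ ^ 2 * l ^ 2 * G (l ^ 2 * s)) ≤ E₀ / 3 :=
    (mul_le_mul_of_nonneg_left hHint (by positivity)).trans hδN
  have hfin2 := hE v v' _ _ _ _ (Real.exp A) (logCut A) (PV.mono le_rfl le_rfl h1l) (by norm_num)
    (by norm_num) (fun y hy => hvL y (hy.trans h1l)) (logCut_continuous A) (logCut_vanish hA0)
    (logCut_nonneg A) (wt_le_logCut hA4) (by linarith)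
  rw [hv 0 (by simp; positivity), hκ] at hfin2
  simp only [smul_zero, mul_zero, add_zero, ← hNe] at hfin2
  rw [inv_mul_cancel₀ hN0.ne'] at hfin2
  norm_num at hfin2

/-- The bound `M` for `w` on a set is inherited by rescalings with factors at most one. -/
lemma abs_mul_le_abs_of_le_one {κ w M : ℝ} (hκ : 0 ≤ κ) (hκ1 : κ ≤ 1) (hw : |w| ≤ M) :
    |κ * w| ≤ |M| := by
  rw [abs_mul, abs_of_nonneg hκ]
  have := mul_le_mul hκ1 (hw.trans (le_abs_self M)) (abs_nonneg _) zero_le_one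
  rwa [one_mul] at this

lemma exists_almost_max {α : Type*} {Q : Set α} {f : α → ℝ} {q₀ : α} (h₀ : q₀ ∈ Q)
    (hpos : 0 < f q₀) {B : ℝ} (hB : ∀ q ∈ Q, f q ≤ B) : ∃ q ∈ Q, 0 < f q ∧ ∀ q' ∈ Q, f q' ≤ 2 * f q := by
  have hbdd : BddAbove (f '' Q) := ⟨B, by rintro _ ⟨q, hq, rfl⟩; exact hB q hq⟩
  have h1 : f q₀ ≤ sSup (f '' Q) := le_csSup hbdd ⟨q₀, h₀, rfl⟩
  obtain ⟨_, ⟨q, hq, rfl⟩, h2⟩ := exists_lt_of_lt_csSup (Set.Nonempty.image f ⟨q₀, h₀⟩)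
    (show sSup (f '' Q) / 2 < sSup (f '' Q) by linarith)
  refine ⟨q, hq, by linarith, fun q' hq' => ?_⟩
  have := le_csSup hbdd ⟨q', hq', rfl⟩
  linarith

/-- Parabolic distance to the boundary of the unit cylinder. -/
noncomputable def cylDist (q : E2 × ℝ) : ℝ := min (1 - ‖q.1‖) (1 - √|q.2|)

lemma cylDist_le_one (q : E2 × ℝ) : cylDist q ≤ 1 :=
  (min_le_left _ _).trans (by linarith [norm_nonneg q.1])

lemma lt_of_cylDist_pos {q : E2 × ℝ} (h : 0 < cylDist q) : ‖q.1‖ < 1 ∧ |q.2| < 1 := by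
  have h1 : √|q.2| < 1 := by linarith [h.trans_le (min_le_right _ _)]
  refine ⟨by linarith [h.trans_le (min_le_left _ _)], ?_⟩
  rw [Real.sqrt_lt' one_pos] at h1; simpa using h1

lemma half_cylDist_lt {q : E2 × ℝ} {l : ℝ} (hl : 0 < l) (hd : cylDist q = 10 * l)
    {y : E2} (hy : ‖y‖ < 5) {s : ℝ} (hs : |s| < 25) :
    cylDist q / 2 < cylDist (q.1 + l • y, q.2 + l ^ 2 * s) := by
  have h1 : cylDist q ≤ 1 - ‖q.1‖ := min_le_left _ _
  have h2 : cylDist q ≤ 1 - √|q.2| := min_le_right _ _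
  refine lt_min ?_ ?_
  · have h3 := norm_add_le q.1 (l • y)
    rw [norm_smul, Real.norm_of_nonneg hl.le] at h3
    have h4 : l * ‖y‖ < l * 5 := by gcongr
    linarith
  · have h3 : √|q.2 + l ^ 2 * s| ≤ √|q.2| + l * √|s| := by
      rw [Real.sqrt_le_left (by positivity)]
      have h5 := abs_add_le q.2 (l ^ 2 * s)
      rw [abs_mul, abs_of_pos (by positivity : 0 < l ^ 2)] at h5
      have h6 := Real.sq_sqrt (abs_nonneg q.2)
      have h7 := Real.sq_sqrt (abs_nonneg s)
      have h8 : 0 ≤ √|q.2| * (l * √|s|) := by positivity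
      nlinarith
    have h4 : √|s| < 5 := by rw [Real.sqrt_lt' (by norm_num)]; linarith
    have h5 : l * √|s| < l * 5 := by gcongr
    linarith

lemma exists_unit_cylinder_le {p : ℝ} (hp : 1 < p) : ∃ C > 0, ∀ (u u' : E2 → ℝ → ℝ) (M : ℝ),
    LSol p (Metric.ball 0 1) (-1) 1 u u' →
    (∀ x ∈ Metric.ball (0 : E2) 1, ∀ t ∈ Ioo (-1 : ℝ) 1, |u x t| ≤ M) →
    (∀ x ∈ Metric.ball (0 : E2) 1, ∀ t ∈ Ioo (-1 : ℝ) 1, |u' x t| ≤ M) → u 0 0 ≤ C := by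
  have hp1 : 0 < p - 1 := by linarith
  obtain ⟨γ, hγ⟩ : ∃ γ, γ = 2 * (1 / (p - 1)) := ⟨_, rfl⟩
  have hγ0 : 0 < γ := hγ ▸ by positivity
  have h2γ : 1 ≤ (2 : ℝ) ^ γ := Real.one_le_rpow (by norm_num) hγ0.le
  obtain ⟨N₀, hN₀, hN⟩ := exists_center_le hp (L := 2 * 2 ^ γ) (by linarith)
  refine ⟨2 * (10 ^ γ * N₀), by positivity, fun u u' M S hM hM' => ?_⟩
  rcases le_or_gt (u 0 0) 0 with h0 | h0
  · exact h0.trans (by positivity)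
  obtain ⟨Q, hQ⟩ : ∃ Q : Set (E2 × ℝ), Q = {q | 0 < cylDist q} := ⟨_, rfl⟩
  have mQ : ∀ q ∈ Q, q.1 ∈ Metric.ball (0 : E2) 1 ∧ q.2 ∈ Ioo (-1 : ℝ) 1 := fun q hq => by
    rw [hQ] at hq
    have := lt_of_cylDist_pos hq
    exact ⟨by simpa using this.1, abs_lt.1 this.2⟩
  have d00 : cylDist ((0 : E2), (0 : ℝ)) = 1 := by simp [cylDist]
  have Mpos : 0 ≤ M := (abs_nonneg _).trans (hM 0 (by simp) 0 (by simp))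
  obtain ⟨q, hq, hfq, hmax⟩ := exists_almost_max (Q := Q) (q₀ := ((0 : E2), (0 : ℝ)))
    (f := fun q => u q.1 q.2 * cylDist q ^ γ) (by rw [hQ]; simp [d00])
    (by simpa [d00] using h0) (B := M) fun q hq => by
      have h1 := (le_abs_self _).trans (hM _ (mQ q hq).1 _ (mQ q hq).2)
      have h2 : cylDist q ^ γ ≤ 1 := by
        rw [hQ] at hq
        exact Real.rpow_le_one (le_of_lt hq) (cylDist_le_one q) hγ0.le
      have h3 : 0 ≤ cylDist q ^ γ := by rw [hQ] at hq; exact Real.rpow_nonneg (le_of_lt hq) _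
      nlinarith
  have hdq : 0 < cylDist q := by rw [hQ] at hq; exact hq
  obtain ⟨l, hl⟩ : ∃ l, l = cylDist q / 10 := ⟨_, rfl⟩
  have hl0 : 0 < l := by rw [hl]; positivity
  have hd : cylDist q = 10 * l := by rw [hl]; ring
  have hl1 : l ≤ 1 := by rw [hl]; linarith [cylDist_le_one q]
  have hκ1 : l ^ γ ≤ 1 := Real.rpow_le_one hl0.le hl1 hγ0.le
  have hκ0 : 0 < l ^ γ := by positivity
  have hin : ∀ y ∈ Metric.ball (0 : E2) 5, ∀ s ∈ Ioo (-25 : ℝ) 25,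
      cylDist q / 2 < cylDist (q.1 + l • y, q.2 + l ^ 2 * s) := fun y hy s hs =>
    half_cylDist_lt hl0 hd (by simpa using hy) (abs_lt.2 hs)
  have hmem : ∀ y ∈ Metric.ball (0 : E2) 5, ∀ s ∈ Ioo (-25 : ℝ) 25,
      (q.1 + l • y, q.2 + l ^ 2 * s) ∈ Q := fun y hy s hs => by
    rw [hQ]; exact lt_trans (by positivity) (hin y hy s hs)
  have hmemx : ∀ y ∈ Metric.ball (0 : E2) 5, q.1 + l • y ∈ Metric.ball (0 : E2) 1 :=
    fun y hy => (mQ _ (hmem y hy 0 (by norm_num))).1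
  have hmemt : ∀ s ∈ Ioo (-25 : ℝ) 25, q.2 + l ^ 2 * s ∈ Ioo (-1 : ℝ) 1 :=
    fun s hs => (mQ _ (hmem 0 (by simp) s hs)).2
  have T := S.rescale hp hl0 q.1 q.2 hmemx hmemt
  rw [← hγ] at T
  have hl2 : l ^ 2 ≤ 1 := pow_le_one₀ hl0.le hl1
  have key := hN _ _ |M| T
    (fun y hy s hs => abs_mul_le_abs_of_le_one hκ0.le hκ1 (hM _ (hmemx y hy) _ (hmemt s hs)))
    (fun y hy s hs => abs_mul_le_abs_of_le_one (by positivity) (mul_le_one₀ hκ1 (by positivity) hl2)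
      (hM' _ (hmemx y hy) _ (hmemt s hs)))
    (fun y hy s hs => by
      have h1 := hmax _ (hmem y hy s hs)
      have h2 : (cylDist q / 2) ^ γ ≤ cylDist (q.1 + l • y, q.2 + l ^ 2 * s) ^ γ :=
        Real.rpow_le_rpow (by positivity) (hin y hy s hs).le hγ0.le
      have h3 := S.nonneg _ (hmemx y hy) _ (hmemt s hs)
      have h4 : u (q.1 + l • y) (q.2 + l ^ 2 * s) * (cylDist q / 2) ^ γ
          ≤ 2 * (u q.1 q.2 * cylDist q ^ γ) := (mul_le_mul_of_nonneg_left h2 h3).trans h1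
      rw [Real.div_rpow hdq.le (by norm_num), mul_div_assoc', div_le_iff₀ (by positivity)] at h4
      have h5 : u (q.1 + l • y) (q.2 + l ^ 2 * s) ≤ 2 * 2 ^ γ * u q.1 q.2 := by
        have h6 : 0 < cylDist q ^ γ := by positivity
        refine le_of_mul_le_mul_right ?_ h6
        linarith
      simp only [smul_zero, mul_zero, add_zero]
      calc _ ≤ l ^ γ * (2 * 2 ^ γ * u q.1 q.2) := by gcongr
        _ = _ := by ring)
  simp only [smul_zero, mul_zero, add_zero] at key
  have h1 := hmax ((0 : E2), (0 : ℝ)) (by rw [hQ]; simp [d00])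
  simp only [d00, Real.one_rpow, mul_one] at h1
  have h2 : u q.1 q.2 * cylDist q ^ γ ≤ 10 ^ γ * N₀ := by
    rw [hd, Real.mul_rpow (by norm_num) hl0.le]
    calc _ = 10 ^ γ * (l ^ γ * u q.1 q.2) := by ring
      _ ≤ _ := by gcongr
  linarith

/-- Universal bound at the centre of a parabolic cylinder for bounded solutions with bounded
time derivative. -/
lemma exists_cylinder_le {p : ℝ} (hp : 1 < p) : ∃ C > 0,
    ∀ (u u' : E2 → ℝ → ℝ) (M r : ℝ) (x₀ : E2) (t₀ : ℝ), 0 < r →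
    LSol p (Metric.ball x₀ r) (t₀ - r ^ 2) (t₀ + r ^ 2) u u' →
    (∀ x ∈ Metric.ball x₀ r, ∀ t ∈ Ioo (t₀ - r ^ 2) (t₀ + r ^ 2), |u x t| ≤ M) →
    (∀ x ∈ Metric.ball x₀ r, ∀ t ∈ Ioo (t₀ - r ^ 2) (t₀ + r ^ 2), |u' x t| ≤ M) →
    u x₀ t₀ ≤ C * r ^ (-(2 * (1 / (p - 1)))) := by
  obtain ⟨C, hC, h⟩ := exists_unit_cylinder_le hp
  refine ⟨C, hC, fun u u' M r x₀ t₀ hr S hM hM' => ?_⟩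
  have hx : ∀ y ∈ Metric.ball (0 : E2) 1, x₀ + r • y ∈ Metric.ball x₀ r := fun y hy => by
    simp only [Metric.mem_ball, dist_zero_right, dist_self_add_left, norm_smul,
      Real.norm_of_nonneg hr.le] at hy ⊢
    nlinarith
  have ht : ∀ s ∈ Ioo (-1 : ℝ) 1, t₀ + r ^ 2 * s ∈ Ioo (t₀ - r ^ 2) (t₀ + r ^ 2) := fun s hs => by
    have : 0 < r ^ 2 := by positivity
    constructor <;> nlinarith [hs.1, hs.2]
  have T := S.rescale hp hr x₀ t₀ hx ht
  generalize 2 * (1 / (p - 1)) = γ at T ⊢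
  have hκ : 0 < r ^ γ := by positivity
  have hM0 : 0 ≤ M := (abs_nonneg _).trans (hM _ (hx 0 (by simp)) _ (ht 0 (by simp)))
  have key := h _ _ (r ^ γ * M + r ^ γ * r ^ 2 * M) T (fun y hy s hs => by
      rw [abs_mul, abs_of_pos hκ]
      have := mul_le_mul_of_nonneg_left (hM _ (hx y hy) _ (ht s hs)) hκ.le
      have h2 : 0 ≤ r ^ γ * r ^ 2 * M := by positivity
      linarith) (fun y hy s hs => by
      rw [abs_mul, abs_of_pos (by positivity : 0 < r ^ γ * r ^ 2)]
      have := mul_le_mul_of_nonneg_left (hM' _ (hx y hy) _ (ht s hs))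
        (by positivity : 0 ≤ r ^ γ * r ^ 2)
      have h2 : 0 ≤ r ^ γ * M := by positivity
      linarith)
  simp only [smul_zero, mul_zero, add_zero] at key
  rw [Real.rpow_neg hr.le, ← div_eq_mul_inv, le_div_iff₀ hκ, mul_comm]
  exact key

/-- `u` and `u'` are bounded near `(x, t)`. -/
def LocBdd (u u' : E2 → ℝ → ℝ) (x : E2) (t : ℝ) : Prop :=
  ∃ M, ∀ᶠ q : E2 × ℝ in 𝓝 (x, t), |u q.1 q.2| ≤ M ∧ |u' q.1 q.2| ≤ M

lemma exists_bound_of_isCompact {u u' : E2 → ℝ → ℝ} {K : Set (E2 × ℝ)} (hK : IsCompact K)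
    (h : ∀ q ∈ K, LocBdd u u' q.1 q.2) :
    ∃ M, ∃ ε > 0, ∀ q ∈ Metric.thickening ε K, |u q.1 q.2| ≤ M ∧ |u' q.1 q.2| ≤ M := by
  have key : ∃ M, ∃ U, IsOpen U ∧ K ⊆ U ∧ ∀ q ∈ U, |u q.1 q.2| ≤ M ∧ |u' q.1 q.2| ≤ M := by
    refine hK.induction_on (p := fun K => ∃ M, ∃ U, IsOpen U ∧ K ⊆ U ∧
      ∀ q ∈ U, |u q.1 q.2| ≤ M ∧ |u' q.1 q.2| ≤ M) ⟨0, ∅, isOpen_empty, le_rfl, by simp⟩ ?_ ?_ ?_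
    · rintro s t hst ⟨M, U, h1, h2, h3⟩
      exact ⟨M, U, h1, hst.trans h2, h3⟩
    · rintro s t ⟨M, U, h1, h2, h3⟩ ⟨M', U', h1', h2', h3'⟩
      refine ⟨max M M', U ∪ U', h1.union h1', union_subset_union h2 h2', ?_⟩
      rintro q (hq | hq)
      · exact ⟨(h3 q hq).1.trans (le_max_left _ _), (h3 q hq).2.trans (le_max_left _ _)⟩
      · exact ⟨(h3' q hq).1.trans (le_max_right _ _), (h3' q hq).2.trans (le_max_right _ _)⟩
    · intro q hq
      obtain ⟨M, hM⟩ := h q hq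
      obtain ⟨U, hU, hUo, hqU⟩ := eventually_nhds_iff.1 hM
      exact ⟨U, mem_nhdsWithin_of_mem_nhds (hUo.mem_nhds hqU), M, U, hUo, le_rfl, hU⟩
  obtain ⟨M, U, hU, hKU, hM⟩ := key
  obtain ⟨ε, hε, h⟩ := hK.exists_thickening_subset_open hU hKU
  exact ⟨M, ε, hε, fun q hq => hM q (h hq)⟩

lemma exists_bound_of_locBdd {u u' : E2 → ℝ → ℝ} {x₀ : E2} {r a b : ℝ} (hab : a ≤ b)
    (h : ∀ x ∈ Metric.closedBall x₀ r, ∀ t ∈ Icc a b, LocBdd u u' x t) :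
    ∃ M, ∃ ε > 0, ∀ x ∈ Metric.closedBall x₀ r, ∀ t ∈ Ioo (a - ε) (b + ε),
      |u x t| ≤ M ∧ |u' x t| ≤ M := by
  obtain ⟨M, ε, hε, hM⟩ := exists_bound_of_isCompact
    ((isCompact_closedBall x₀ r).prod (isCompact_Icc (a := a) (b := b)))
    (fun q hq => h q.1 hq.1 q.2 hq.2)
  refine ⟨M, ε, hε, fun x hx t ht => hM (x, t) ?_⟩
  refine Metric.mem_thickening_iff.2 ⟨(x, max a (min t b)), ⟨hx, le_max_left _ _,
    max_le hab (min_le_right _ _)⟩, ?_⟩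
  rw [Prod.dist_eq, dist_self, Real.dist_eq, max_eq_right (abs_nonneg _), abs_lt]
  obtain ⟨h1, h2⟩ := ht
  rcases le_total t b with h | h
  · rw [min_eq_left h]
    rcases le_total a t with h' | h'
    · rw [max_eq_right h']; constructor <;> linarith
    · rw [max_eq_left h']; constructor <;> linarith
  · rw [min_eq_right h, max_eq_right hab]; constructor <;> linarith

lemma LocBdd.comp_affine {u u' : E2 → ℝ → ℝ} {x₀ y : E2} {t₀ l k s : ℝ} (c c' : ℝ)
    (h : LocBdd u u' (x₀ + l • y) (t₀ + k * s)) :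
    LocBdd (fun y s => c * u (x₀ + l • y) (t₀ + k * s))
      (fun y s => c' * u' (x₀ + l • y) (t₀ + k * s)) y s := by
  obtain ⟨M, hM⟩ := h
  have hc : Tendsto (fun q : E2 × ℝ => (x₀ + l • q.1, t₀ + k * q.2)) (𝓝 (y, s))
      (𝓝 (x₀ + l • y, t₀ + k * s)) := by
    have : Continuous fun q : E2 × ℝ => (x₀ + l • q.1, t₀ + k * q.2) := by fun_prop
    exact this.tendsto (y, s)
  refine ⟨max (|c| * M) (|c'| * M), ?_⟩
  filter_upwards [hc.eventually hM] with q hq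
  simp only [abs_mul]
  exact ⟨(mul_le_mul_of_nonneg_left hq.1 (abs_nonneg c)).trans (le_max_left _ _),
    (mul_le_mul_of_nonneg_left hq.2 (abs_nonneg c')).trans (le_max_right _ _)⟩

lemma LSol.translate {p : ℝ} (hp : 1 < p) {Ω Ω' : Set E2} {a b : ℝ} {u u' : E2 → ℝ → ℝ}
    (S : LSol p Ω a b u u') (x₀ : E2) (hΩ : ∀ y ∈ Ω', x₀ + y ∈ Ω) :
    LSol p Ω' a b (fun y s => u (x₀ + y) s) (fun y s => u' (x₀ + y) s) := by
  simpa using S.rescale hp one_pos x₀ 0 (Ω' := Ω') (a' := a) (b' := b) (by simpa using hΩ)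
    (by simp)

/-- The mass near the origin is controlled by the later value at a nearby point. -/
lemma LSol.integral_le_of_locBdd {p : ℝ} (hp : 1 < p) {v v' : E2 → ℝ → ℝ} {m τ : ℝ} {y₀ : E2}
    (S : LSol p (Metric.ball 0 8) (-4) 4 v v') (hτ : -4 < τ) (hτ' : τ + 1 < 4)
    (hy : ‖y₀‖ < 3 / 2) (hm : v y₀ (τ + 1) ≤ m)
    (h : ∀ t ∈ Icc τ (τ + 1), ∀ x ∈ Metric.ball (0 : E2) 8, LocBdd v v' x t) :
    ∫ x, v x τ * wt ((8 : ℝ) • x) ≤ 2 * (1728 * (4 * Real.pi) * m) := by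
  have hsub : Metric.closedBall y₀ 6 ⊆ Metric.ball (0 : E2) 8 := by
    intro x hx
    rw [Metric.mem_closedBall, dist_eq_norm] at hx
    rw [mem_ball_zero_iff]
    have := norm_sub_norm_le x y₀
    linarith
  obtain ⟨M, ε, hε, hM⟩ := exists_bound_of_locBdd (x₀ := y₀) (r := 6) (by linarith : τ ≤ τ + 1)
    fun x hx t ht => h t ht x (hsub hx)
  obtain ⟨δ, hδ, hδε, hδ1, hδ2⟩ : ∃ δ > 0, δ ≤ ε ∧ δ ≤ τ + 4 ∧ δ ≤ 4 - (τ + 1) :=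
    ⟨min ε (min (τ + 4) (4 - (τ + 1))), lt_min hε (lt_min (by linarith) (by linarith)),
      min_le_left _ _, (min_le_right _ _).trans (min_le_left _ _),
      (min_le_right _ _).trans (min_le_right _ _)⟩
  have hmem : ∀ y ∈ Metric.ball (0 : E2) 6, y₀ + y ∈ Metric.closedBall y₀ 6 := fun y hy => by
    simp at hy ⊢; exact hy.le
  have S1 := (S.mono (Ω' := Metric.ball 0 8) le_rfl (a' := τ - δ) (b' := τ + 1 + δ)
    (by linarith) (by linarith)).translate hp y₀ (Ω' := Metric.ball 0 6)
    (fun y hy => hsub (hmem y hy))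
  have ht : ∀ t ∈ Ioo (τ - δ) (τ + 1 + δ), t ∈ Ioo (τ - ε) (τ + 1 + ε) := fun t ht =>
    ⟨by linarith [ht.1], by linarith [ht.2]⟩
  obtain ⟨V, V', P, e1, e2⟩ := S1.exists_psol hp (r := 3) (by norm_num) (by norm_num)
    (fun x hx t hh => (hM _ (hmem x hx) t (ht t hh)).1)
    (fun x hx t hh => (hM _ (hmem x hx) t (ht t hh)).2)
  have hpos : ∀ x t, t ∈ Ioo (τ - δ) (τ + 1 + δ) → 0 ≤ V x t ^ p := fun x t ht =>
    Real.rpow_nonneg (P.nonneg x t ht) p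
  have hz : ∀ x : E2, 2 < ‖x‖ → wt ((8 : ℝ) • (y₀ + x)) = 0 := fun x hx => by
    refine wt_vanish _ ?_
    have := norm_sub_norm_le x (-y₀)
    rw [norm_neg, sub_neg_eq_add, add_comm x] at this
    rw [norm_smul, Real.norm_of_nonneg (by norm_num)]
    linarith
  have key := mass_le_value P.reg P.nonneg (s := τ) (ζ := fun z => wt ((8 : ℝ) • (y₀ + z)) / 2)
    (fun x hx t ht => by rw [P.eq x hx t ht]; linarith [hpos x t ht])
    ⟨by linarith, by linarith⟩ ⟨by linarith, by linarith⟩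
    (by have := wt_continuous; fun_prop)
    (fun x => by
      have : wt ((8 : ℝ) • (y₀ + x)) ≤ 2 := max_le (by nlinarith [norm_nonneg ((8 : ℝ) • (y₀ + x))])
        (by norm_num)
      linarith)
    (fun x hx => by
      simp only [hz x hx, zero_div])
  rw [e1 0 (by simp), add_zero] at key
  have e : ∫ x, v x τ * wt ((8 : ℝ) • x) = 2 * ∫ x, V x τ * (wt ((8 : ℝ) • (y₀ + x)) / 2) := by
    rw [← integral_const_mul, ← integral_add_left_eq_self _ y₀]
    refine integral_congr_ae (Eventually.of_forall fun x => ?_)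
    simp only
    by_cases hx : ‖x‖ ≤ 3
    · rw [e1 x hx]; ring
    · rw [hz x (by linarith)]; simp
  rw [e]
  have := Real.pi_pos
  have h2 : 1728 * (4 * Real.pi) * v y₀ (τ + 1) ≤ 1728 * (4 * Real.pi) * m := by gcongr
  linarith

lemma rpow_le_rpow_sub_one_mul {p x K : ℝ} (hp : 1 < p) (hx : 0 ≤ x) (hK : x ≤ K) :
    x ^ p ≤ K ^ (p - 1) * x := by
  have h : x ^ p = x ^ (p - 1) * x := by
    conv_lhs => rw [show p = (p - 1) + 1 by ring]
    rw [Real.rpow_add_one' hx (by linarith)]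
  rw [h]
  exact mul_le_mul_of_nonneg_right (Real.rpow_le_rpow hx hK (by linarith)) hx

lemma exists_le_of_locBdd {p : ℝ} (hp : 1 < p) : ∃ K > 0, ∀ v v' : E2 → ℝ → ℝ,
    LSol p (Metric.ball 0 8) (-4) 4 v v' →
    (∀ x, ‖x‖ < 1 → ∀ t ∈ Ioo (-4 : ℝ) 4, LocBdd v v' x t) →
    ∃ M, ∀ x ∈ Metric.closedBall (0 : E2) (1 / 2), ∀ t ∈ Icc (-2 : ℝ) 2,
      |v x t| ≤ M ∧ |v' x t| ≤ M ∧ v x t ≤ K := by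
  obtain ⟨C, hC, hA⟩ := exists_cylinder_le hp
  refine ⟨C * (1 / 4) ^ (-(2 * (1 / (p - 1)))), by positivity, fun v v' S h => ?_⟩
  obtain ⟨M, ε, hε, hM⟩ := exists_bound_of_locBdd (x₀ := (0 : E2)) (r := 3 / 4)
    (by norm_num : (-3 : ℝ) ≤ 3) fun x hx t ht => h x
      (by simp only [Metric.mem_closedBall, dist_zero_right] at hx; linarith) t
      ⟨by linarith [ht.1], by linarith [ht.2]⟩
  have hM' : ∀ x : E2, ‖x‖ ≤ 3 / 4 → ∀ t ∈ Icc (-3 : ℝ) 3, |v x t| ≤ M ∧ |v' x t| ≤ M :=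
    fun x hx t ht => hM x (by simpa using hx) t ⟨by linarith [ht.1], by linarith [ht.2]⟩
  refine ⟨M, fun x hx t ht => ?_⟩
  rw [Metric.mem_closedBall, dist_zero_right] at hx
  have hb : ∀ y ∈ Metric.ball x (1 / 4), ‖y‖ ≤ 3 / 4 := fun y hy => by
    rw [Metric.mem_ball, dist_eq_norm] at hy
    have := norm_sub_norm_le y x
    linarith
  have htt : ∀ s ∈ Ioo (t - (1 / 4) ^ 2) (t + (1 / 4) ^ 2), s ∈ Icc (-3 : ℝ) 3 := fun s hs =>
    ⟨by linarith [hs.1, ht.1], by linarith [hs.2, ht.2]⟩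
  obtain ⟨h1, h2⟩ := hM' x (by linarith) t ⟨by linarith [ht.1], by linarith [ht.2]⟩
  refine ⟨h1, h2, hA v v' M (1 / 4) x t (by norm_num) (S.mono ?_ ?_ ?_) ?_ ?_⟩
  · intro y hy
    rw [mem_ball_zero_iff]; linarith [hb y hy]
  · linarith [ht.1]
  · linarith [ht.2]
  · exact fun y hy s hs => (hM' y (hb y hy) s (htt s hs)).1
  · exact fun y hy s hs => (hM' y (hb y hy) s (htt s hs)).2

/-- A solution bounded by `m` on a nearby line, and either bounded by `m` or locally bounded at
each time, is bounded by a multiple of `m`. -/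
lemma exists_le_mul_of_le_on_line {p : ℝ} (hp : 1 < p) : ∃ C > 0,
    ∀ (v v' : E2 → ℝ → ℝ) (m : ℝ) (y₀ : E2), 0 ≤ m →
    LSol p (Metric.ball 0 8) (-4) 4 v v' → ‖y₀‖ < 3 / 2 →
    (∀ s ∈ Ioo (-4 : ℝ) 4, v y₀ s ≤ m) →
    (∀ x, ‖x‖ < 1 → ∀ t ∈ Ioo (-4 : ℝ) 4, LocBdd v v' x t) →
    (∀ t ∈ Ioo (-4 : ℝ) 4, (∀ x ∈ Metric.ball (0 : E2) 8, v x t ≤ m) ∨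
      ∀ x ∈ Metric.ball (0 : E2) 8, LocBdd v v' x t) →
    v 0 0 ≤ C * m := by
  obtain ⟨K, hK, hKb⟩ := exists_le_of_locBdd hp
  obtain ⟨C₁, hC₁, hmv⟩ := exists_mv
  obtain ⟨κ, hκ, hκ0⟩ : ∃ κ : ℝ, κ = (1 / 8) ^ (2 * (1 / (p - 1))) ∧ 0 < κ :=
    ⟨_, rfl, by positivity⟩
  obtain ⟨I, hI⟩ : ∃ I : ℝ, I = ∫ x, bump 3 (3 ^ 2) x := ⟨_, rfl⟩
  have hI0 : 0 ≤ I := by rw [hI]; exact integral_nonneg fun x => bump_nonneg _ _ _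
  obtain ⟨A, hA⟩ : ∃ A : ℝ, A = κ * (5 * Real.exp 192 * I + 64 * (2 * (1728 * (4 * Real.pi)))) :=
    ⟨_, rfl⟩
  have hpi := Real.pi_pos
  have hA0 : 0 < A := by rw [hA]; positivity
  refine ⟨Real.exp ((κ * K) ^ (p - 1)) * (A + C₁ * A) / κ, by positivity,
    fun v v' m y₀ hm S hy hline hloc halt => ?_⟩
  obtain ⟨M, hM⟩ := hKb v v' S hloc
  have hball : ∀ y ∈ Metric.ball (0 : E2) 4, (0 : E2) + (1 / 8 : ℝ) • y ∈
      Metric.closedBall (0 : E2) (1 / 2) := fun y hy => by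
    rw [mem_ball_zero_iff] at hy
    rw [zero_add, mem_closedBall_zero_iff, norm_smul, Real.norm_of_nonneg (by norm_num)]
    linarith
  have hball' : Metric.closedBall (0 : E2) (1 / 2) ⊆ Metric.ball (0 : E2) 8 := fun y hy => by
    rw [mem_closedBall_zero_iff] at hy
    rw [mem_ball_zero_iff]; linarith
  have htime : ∀ s ∈ Ioo (-128 : ℝ) 128, 0 + (1 / 8) ^ 2 * s ∈ Icc (-2 : ℝ) 2 := fun s hs =>
    ⟨by linarith [hs.1], by linarith [hs.2]⟩
  have S1 := S.rescale hp (l := 1 / 8) (by norm_num) 0 0 (Ω' := Metric.ball 0 4)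
    (a' := -128) (b' := 128) (fun y hy => hball' (hball y hy))
    (fun s hs => ⟨by linarith [(htime s hs).1], by linarith [(htime s hs).2]⟩)
  rw [← hκ] at S1
  obtain ⟨V, V', P, e1, -⟩ := S1.exists_psol hp (r := 3) (M := κ * |M|) (by norm_num) (by norm_num)
    (fun x hx t ht => by
      rw [abs_mul, abs_of_pos hκ0]
      exact mul_le_mul_of_nonneg_left ((hM _ (hball x hx) _ (htime t ht)).1.trans (le_abs_self M))
        hκ0.le)
    (fun x hx t ht => by
      rw [abs_mul, abs_of_pos (by positivity : 0 < κ * (1 / 8) ^ 2)]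
      have := (hM _ (hball x hx) _ (htime t ht)).2.1.trans (le_abs_self M)
      calc _ ≤ κ * (1 / 8) ^ 2 * |M| := by gcongr
        _ ≤ κ * 1 * |M| := by gcongr; norm_num
        _ = κ * |M| := by ring)
  simp only [zero_add] at e1
  have hVK : ∀ x, ‖x‖ ≤ 3 → ∀ t ∈ Ioo (-128 : ℝ) 128, V x t ≤ κ * K := fun x hx t ht => by
    rw [e1 x hx]
    have h1 := (hM _ (hball x (by rw [mem_ball_zero_iff]; linarith)) _ (htime t ht)).2.2
    rw [zero_add, zero_add] at h1
    exact mul_le_mul_of_nonneg_left h1 hκ0.le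
  have hVp : ∀ x t, t ∈ Ioo (-128 : ℝ) 128 → 0 ≤ V x t ^ p := fun x t ht =>
    Real.rpow_nonneg (P.nonneg x t ht) p
  have avg : ∀ s ∈ Icc (-1 : ℝ) 0, ∫ x, V x s * wt x ≤ A * m := by
    intro s hs
    have hsI : s ∈ Ioo (-128 : ℝ) 128 := ⟨by linarith [hs.1], by linarith [hs.2]⟩
    by_cases hb : ∃ b ∈ Icc ((1 / 8) ^ 2 * s) ((1 / 8) ^ 2 * s + 1),
        ∀ x ∈ Metric.ball (0 : E2) 8, v x b ≤ m
    · obtain ⟨b, hb, hbm⟩ := hb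
      have hbI : 64 * b ∈ Ioo (-128 : ℝ) 128 :=
        ⟨by linarith [hb.1, hs.1], by linarith [hb.2, hs.2]⟩
      have h1 := mass_le (r := 3) (by norm_num) P.reg P.nonneg
        (fun x hx t ht => by rw [P.eq x hx t ht]; linarith [hVp x t ht]) hsI hbI
        (by linarith [hb.1])
      have hv3 : VanishOff 3 (bump 3 (3 ^ 2)) := bump_vanish 3 (by norm_num) (by norm_num)
      have ib : Integrable (bump 3 (3 ^ 2)) := hv3.integrable (bump_continuous _ _)
      have h2 : ∫ x, V x (64 * b) * bump 3 (3 ^ 2) x ≤ κ * m * I := by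
        rw [hI, ← integral_const_mul]
        refine MeasureTheory.integral_mono (P.reg.integrable_mul (bump_continuous _ _) hbI)
          (ib.const_mul _) fun x => ?_
        simp only
        by_cases hx : ‖x‖ ≤ 3
        · refine mul_le_mul_of_nonneg_right ?_ (bump_nonneg _ _ _)
          rw [e1 x hx]
          refine mul_le_mul_of_nonneg_left ?_ hκ0.le
          rw [show (1 / 8 : ℝ) ^ 2 * (64 * b) = b by ring]
          refine hbm _ (hball' ?_)
          have := hball x (by rw [mem_ball_zero_iff]; linarith)
          rwa [zero_add] at this
        · rw [hv3 x (by linarith)]; simp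
      have h3 : ∫ x, V x s * wt x ≤ 5 * ∫ x, V x s * bump 3 (3 ^ 2) x := by
        rw [← integral_const_mul]
        refine MeasureTheory.integral_mono (P.reg.integrable_mul wt_continuous hsI)
          ((P.reg.integrable_mul (bump_continuous _ _) hsI).const_mul _) fun x => ?_
        simp only
        have h4 : wt x ≤ 5 * bump 3 (3 ^ 2) x := by
          by_cases hx : ‖x‖ ^ 2 ≤ 2
          · have h5 := le_bump 3 (ρ := 3 ^ 2) (r := 2) (by norm_num) (by norm_num) hx
            have h6 : wt x ≤ 2 := max_le (by linarith [sq_nonneg ‖x‖]) (by norm_num)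
            norm_num at h5 ⊢
            linarith
          · have : wt x = 0 := max_eq_right (by linarith)
            rw [this]; exact mul_nonneg (by norm_num) (bump_nonneg _ _ _)
        have := mul_le_mul_of_nonneg_left h4 (P.nonneg x s hsI)
        linarith
      have h5 : Real.exp (27 / 3 ^ 2 * (64 * b - s)) ≤ Real.exp 192 :=
        Real.exp_le_exp.2 (by linarith [hb.2])
      have h6 : Real.exp (27 / 3 ^ 2 * (64 * b - s)) * ∫ x, V x (64 * b) * bump 3 (3 ^ 2) x
          ≤ Real.exp 192 * (κ * m * I) :=
        mul_le_mul h5 h2 (integral_nonneg fun x => mul_nonneg (P.nonneg x _ hbI)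
          (bump_nonneg _ _ _)) (by positivity)
      have h7 : A * m = 5 * (Real.exp 192 * (κ * m * I))
          + κ * (64 * (2 * (1728 * (4 * Real.pi)))) * m := by rw [hA]; ring
      have h8 : 0 ≤ κ * (64 * (2 * (1728 * (4 * Real.pi)))) * m := by positivity
      have h9 := h1.trans h6
      linarith
    · have h1 := S.integral_le_of_locBdd hp (τ := (1 / 8) ^ 2 * s) (by linarith [hs.1])
        (by linarith [hs.2]) hy (hline _ ⟨by linarith [hs.1], by linarith [hs.2]⟩)
        (fun t ht => by
          refine (halt t ⟨by linarith [ht.1, hs.1], by linarith [ht.2, hs.2]⟩).resolve_left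
            fun h => hb ⟨t, ht, h⟩)
      have h2 := Measure.integral_comp_smul (volume : Measure E2)
        (fun x => v x ((1 / 8) ^ 2 * s) * wt ((8 : ℝ) • x)) (1 / 8 : ℝ)
      have h3 : ∫ x, V x s * wt x = κ * ∫ x : E2, v ((1 / 8 : ℝ) • x) ((1 / 8) ^ 2 * s) *
          wt ((8 : ℝ) • (1 / 8 : ℝ) • x) := by
        rw [← integral_const_mul]
        refine integral_congr_ae (Eventually.of_forall fun x => ?_)
        simp only
        rw [smul_smul, show (8 : ℝ) * (1 / 8) = 1 by norm_num, one_smul]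
        by_cases hx : ‖x‖ ≤ 3
        · rw [e1 x hx]; ring
        · rw [wt_vanish x (by linarith)]; simp
      rw [h3, h2]
      have h4 : |((1 / 8 : ℝ) ^ Module.finrank ℝ E2)⁻¹| = 64 := by
        simp; norm_num
      rw [h4, smul_eq_mul]
      have h7 : A * m = 5 * (Real.exp 192 * (κ * m * I))
          + κ * (64 * (2 * (1728 * (4 * Real.pi) * m))) := by rw [hA]; ring
      have h8 : 0 ≤ 5 * (Real.exp 192 * (κ * m * I)) := by positivity
      rw [h7]
      have := mul_le_mul_of_nonneg_left h1 (by positivity : 0 ≤ κ * 64)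
      linarith
  have h1 := (hmv V V' (-128) 128 4 _ ((κ * K) ^ (p - 1)) 0 (-1) 0 P.reg P.nonneg (by positivity)
    le_rfl (fun x hx t ht => by
      rw [P.eq x (by linarith) t ht]
      have := rpow_le_rpow_sub_one_mul hp (P.nonneg x t ht) (hVK x (by linarith) t ht)
      linarith) (by constructor <;> norm_num) (by constructor <;> norm_num) (by norm_num)
    (by norm_num)).2
  have h2 : ∫ τ in (-1 : ℝ)..0, (0 + C₁ * ∫ x, V x τ * wt x) ≤ C₁ * (A * m) := by
    have h3 := intervalIntegral.norm_integral_le_of_norm_le_const (a := (-1 : ℝ)) (b := 0)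
      (C := C₁ * (A * m)) (f := fun τ => 0 + C₁ * ∫ x, V x τ * wt x) (fun τ hτ => by
        rw [uIoc_of_le (by norm_num)] at hτ
        have h0 : 0 ≤ ∫ x, V x τ * wt x := integral_nonneg fun x =>
          mul_nonneg (P.nonneg x τ ⟨by linarith [hτ.1], by linarith [hτ.2]⟩) (wt_nonneg x)
        rw [Real.norm_of_nonneg (by positivity), zero_add]
        exact mul_le_mul_of_nonneg_left (avg τ ⟨hτ.1.le, hτ.2⟩) hC₁.le)
    have h4 := (le_abs_self _).trans h3
    norm_num at h4 ⊢
    exact h4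
  have h3 := avg (-1) (by constructor <;> norm_num)
  rw [e1 0 (by simp)] at h1
  simp only [smul_zero, mul_zero] at h1
  have h4 : Real.exp ((κ * K) ^ (p - 1)) * (1 / (0 - -1) * (∫ x, V x (-1) * wt x) +
      ∫ τ in (-1 : ℝ)..0, (0 + C₁ * ∫ x, V x τ * wt x))
      ≤ Real.exp ((κ * K) ^ (p - 1)) * (A * m + C₁ * (A * m)) := by
    refine mul_le_mul_of_nonneg_left ?_ (by positivity)
    norm_num at h3 h2 ⊢
    linarith
  rw [div_mul_eq_mul_div, le_div_iff₀ hκ0]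
  linarith

/-- If the set of points where `u` or `u'` is unbounded is contained in a product of sets on which
`u` is bounded, then `u` is bounded. -/
lemma LSol.exists_le_of_locBdd_or {p : ℝ} (hp : 1 < p) {u u' : E2 → ℝ → ℝ} {m : ℝ}
    (S : LSol p (Metric.ball 0 16) (-256) 256 u u')
    (h0 : ∀ s ∈ Ioo (-256 : ℝ) 256, u 0 s ≤ m)
    (h : ∀ x ∈ Metric.ball (0 : E2) 16, ∀ t ∈ Ioo (-256 : ℝ) 256, LocBdd u u' x t ∨
      ((∀ s ∈ Ioo (-256 : ℝ) 256, u x s ≤ m) ∧ ∀ y ∈ Metric.ball (0 : E2) 16, u y t ≤ m)) :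
    ∃ K, ∀ x ∈ Metric.ball (0 : E2) 1, ∀ t ∈ Ioo (-128 : ℝ) 128, u x t ≤ K := by
  obtain ⟨C, hC, hS⟩ := exists_le_mul_of_le_on_line hp
  obtain ⟨A, hA⟩ : ∃ A : Set E2, A = {x ∈ Metric.ball (0 : E2) 16 |
    ∀ s ∈ Ioo (-256 : ℝ) 256, u x s ≤ m} := ⟨_, rfl⟩
  have A0 : (0 : E2) ∈ A := by rw [hA]; exact ⟨by simp, h0⟩
  have hm : 0 ≤ m := (S.nonneg 0 (by simp) 0 (by norm_num)).trans (h0 0 (by norm_num))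
  refine ⟨m + C * m, fun x hx t ht => ?_⟩
  have hx' : ‖x‖ < 1 := by simpa using hx
  have hxB : x ∈ Metric.ball (0 : E2) 16 := by rw [mem_ball_zero_iff]; linarith
  have htI : t ∈ Ioo (-256 : ℝ) 256 := ⟨by linarith [ht.1], by linarith [ht.2]⟩
  have hCm : 0 ≤ C * m := by positivity
  rcases Metric.infDist_nonneg (x := x) (s := A) |>.eq_or_lt with hD | hD
  · have hcl : x ∈ closure A := (Metric.mem_closure_iff_infDist_zero ⟨0, A0⟩).2 hD.symm
    have hne : (𝓝[A] x).NeBot := mem_closure_iff_nhdsWithin_neBot.1 hcl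
    have hc : Tendsto (fun y => u y t) (𝓝[A] x) (𝓝 (u x t)) :=
      ((S.contDiffAt Metric.isOpen_ball hxB htI).continuousAt.tendsto).mono_left
        nhdsWithin_le_nhds
    have := le_of_tendsto hc (by
      filter_upwards [self_mem_nhdsWithin] with y hy
      rw [hA] at hy
      exact hy.2 t htI)
    linarith
  · obtain ⟨D, hDeq⟩ : ∃ D, D = Metric.infDist x A := ⟨_, rfl⟩
    rw [← hDeq] at hD
    have hD1 : D < 1 := by
      have := Metric.infDist_le_dist_of_mem (x := x) A0
      rw [dist_zero_right] at this
      linarith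
    obtain ⟨y, hyA, hy⟩ : ∃ y ∈ A, dist x y < 3 / 2 * D :=
      (Metric.infDist_lt_iff ⟨0, A0⟩).1 (by linarith)
    have hball : ∀ z : E2, ‖z‖ < 8 → x + D • z ∈ Metric.ball (0 : E2) 16 := fun z hz => by
      rw [mem_ball_zero_iff]
      have h1 := norm_add_le x (D • z)
      rw [norm_smul, Real.norm_of_nonneg hD.le] at h1
      nlinarith [norm_nonneg z]
    have htime : ∀ s ∈ Ioo (-4 : ℝ) 4, t + D ^ 2 * s ∈ Ioo (-256 : ℝ) 256 := fun s hs => by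
      have h1 : D ^ 2 < 1 := by nlinarith
      have h2 : 0 < D ^ 2 := by positivity
      have h3 := mul_lt_mul_of_pos_left hs.1 h2
      have h4 := mul_lt_mul_of_pos_left hs.2 h2
      constructor <;> linarith [ht.1, ht.2]
    obtain ⟨κ, hκ, hκ0⟩ : ∃ κ : ℝ, κ = D ^ (2 * (1 / (p - 1))) ∧ 0 < κ :=
      ⟨_, rfl, by positivity⟩
    have S1 := S.rescale hp hD x t (Ω' := Metric.ball 0 8) (a' := -4) (b' := 4)
      (fun z hz => hball z (by simpa using hz)) htime
    rw [← hκ] at S1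
    have key := hS _ _ (κ * m) (D⁻¹ • (y - x)) (by positivity) S1 ?_ ?_ ?_ ?_
    · simp only [smul_zero, add_zero, mul_zero] at key
      have : κ * u x t ≤ κ * (C * m) := by linarith
      have := le_of_mul_le_mul_left this hκ0
      linarith
    · rw [norm_smul, norm_inv, Real.norm_of_nonneg hD.le, ← dist_eq_norm, dist_comm,
        inv_mul_lt_iff₀ hD]
      linarith
    · intro s hs
      rw [smul_smul, mul_inv_cancel₀ hD.ne', one_smul, add_sub_cancel]
      rw [hA] at hyA
      exact mul_le_mul_of_nonneg_left (hyA.2 _ (htime s hs)) hκ0.le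
    · intro z hz s hs
      refine LocBdd.comp_affine _ _ ((h _ (hball z (by linarith)) _ (htime s hs)).resolve_right ?_)
      rintro ⟨h1, -⟩
      have h2 : x + D • z ∈ A := by rw [hA]; exact ⟨hball z (by linarith), h1⟩
      have h3 := Metric.infDist_le_dist_of_mem (x := x) h2
      rw [← hDeq, dist_self_add_right, norm_smul, Real.norm_of_nonneg hD.le] at h3
      nlinarith
    · intro s hs
      by_cases hb : ∀ y ∈ Metric.ball (0 : E2) 16, u y (t + D ^ 2 * s) ≤ m
      · left
        intro z hz
        exact mul_le_mul_of_nonneg_left (hb _ (hball z (by simpa using hz))) hκ0.le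
      · right
        intro z hz
        refine LocBdd.comp_affine _ _ ((h _ (hball z (by simpa using hz)) _
          (htime s hs)).resolve_right fun hh => hb hh.2)

lemma lap_const (c : ℝ) (y : E2) : lap (fun _ : E2 => c) y = 0 := by
  unfold lap
  simp

/-- A smooth approximation of the absolute value. -/
noncomputable def sabs (ε x : ℝ) : ℝ := √(x ^ 2 + ε ^ 2) - ε

lemma sabs_root_pos {ε : ℝ} (hε : 0 < ε) (x : ℝ) : 0 < √(x ^ 2 + ε ^ 2) :=
  Real.sqrt_pos.2 (by positivity)

lemma sabs_nonneg (ε x : ℝ) : 0 ≤ sabs ε x :=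
  sub_nonneg.2 (Real.le_sqrt_of_sq_le (by linarith [sq_nonneg x]))

lemma sabs_le_abs {ε : ℝ} (hε : 0 < ε) (x : ℝ) : sabs ε x ≤ |x| := by
  have : √(x ^ 2 + ε ^ 2) ≤ |x| + ε := by
    rw [Real.sqrt_le_left (by positivity)]
    nlinarith [sq_abs x, mul_nonneg (abs_nonneg x) hε.le]
  unfold sabs; linarith

lemma abs_le_sabs_add (ε x : ℝ) : |x| ≤ sabs ε x + ε := by
  unfold sabs
  rw [sub_add_cancel]
  exact Real.abs_le_sqrt (by linarith [sq_nonneg ε])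

lemma abs_div_root_le_one {ε : ℝ} (hε : 0 < ε) (x : ℝ) : |x / √(x ^ 2 + ε ^ 2)| ≤ 1 := by
  rw [abs_div, abs_of_pos (sabs_root_pos hε x), div_le_one (sabs_root_pos hε x)]
  exact Real.abs_le_sqrt (by linarith [sq_nonneg ε])

lemma hasDerivAt_sabs {ε : ℝ} (hε : 0 < ε) (x : ℝ) :
    HasDerivAt (sabs ε) (x / √(x ^ 2 + ε ^ 2)) x := by
  have h := (((hasDerivAt_pow 2 x).add_const (ε ^ 2)).sqrt
    (by positivity : x ^ 2 + ε ^ 2 ≠ 0)).sub_const ε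
  refine h.congr_deriv ?_
  have := (sabs_root_pos hε x).ne'
  field_simp
  norm_num

lemma contDiff_root {ε : ℝ} (hε : 0 < ε) {f : E2 → ℝ} (hf : ContDiff ℝ 2 f) :
    ContDiff ℝ 2 fun y => √(f y ^ 2 + ε ^ 2) :=
  ((hf.pow 2).add contDiff_const).sqrt fun _ => by positivity

lemma contDiff_sabs {ε : ℝ} (hε : 0 < ε) {f : E2 → ℝ} (hf : ContDiff ℝ 2 f) :
    ContDiff ℝ 2 fun y => sabs ε (f y) :=
  (contDiff_root hε hf).sub contDiff_const

/-- Kato's inequality. -/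
lemma mul_lap_le_lap_sabs {ε : ℝ} (hε : 0 < ε) {f : E2 → ℝ} (hf : ContDiff ℝ 2 f) (y : E2) :
    f y / √(f y ^ 2 + ε ^ 2) * lap f y ≤ lap (fun y => sabs ε (f y)) y := by
  obtain ⟨q, hq⟩ : ∃ q : E2 → ℝ, q = fun y => √(f y ^ 2 + ε ^ 2) := ⟨_, rfl⟩
  have cq : ContDiff ℝ 2 q := by rw [hq]; exact contDiff_root hε hf
  have hqq : ∀ y, q y * q y = f y * f y + ε ^ 2 := fun y => by
    rw [hq, ← sq]; simp only; rw [Real.sq_sqrt (by positivity)]; ring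
  have q0 : 0 < q y := by rw [hq]; exact sabs_root_pos hε _
  have e1 : lap (fun y => sabs ε (f y)) y = lap q y := by
    have h1 : (fun y => sabs ε (f y)) = fun y => q y - (fun _ => ε) y := by rw [hq]; rfl
    rw [h1, lap_sub cq contDiff_const, sub_eq_self, lap_const]
  have hf2 : ContDiff ℝ 2 fun y => f y * f y := hf.mul hf
  have hpd : ∀ i, q y * pd i q y = f y * pd i f y := fun i => by
    have h1 := pd_mul (cq.diffAt y) (cq.diffAt y) i
    have h2 := pd_mul (hf.diffAt y) (hf.diffAt y) i
    have h3 := pd_add (g := fun _ => ε ^ 2) (hf2.diffAt y) (by fun_prop) i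
    simp only [hqq] at h1
    rw [h1] at h3
    have h4 : pd i (fun _ => ε ^ 2) y = 0 := by simp [pd]
    rw [h2, h4] at h3
    linarith
  have hl : 2 * (q y * lap q y) + 2 * gd q q y = 2 * (f y * lap f y) + 2 * gd f f y := by
    have h1 := lap_mul cq cq y
    have h2 := lap_mul hf hf y
    have h3 := lap_add (g := fun _ => ε ^ 2) hf2 contDiff_const y
    simp only [hqq] at h1
    have h4 : lap (fun _ : E2 => ε ^ 2) y = 0 := lap_const _ y
    rw [h1, h2, h4] at h3
    linarith
  have hg : gd q q y ≤ gd f f y := by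
    refine Finset.sum_le_sum fun i _ => ?_
    have h1 : q y * q y * (pd i q y * pd i q y) = f y * f y * (pd i f y * pd i f y) := by
      have := hpd i
      calc _ = (q y * pd i q y) * (q y * pd i q y) := by ring
        _ = _ := by rw [this]; ring
    have h2 : f y * f y ≤ q y * q y := by rw [hqq]; linarith [sq_nonneg ε]
    have h3 := mul_le_mul_of_nonneg_right h2 (mul_self_nonneg (pd i f y))
    exact le_of_mul_le_mul_left (by linarith) (mul_pos q0 q0)
  rw [e1, show √(f y ^ 2 + ε ^ 2) = q y by rw [hq], div_mul_eq_mul_div, div_le_iff₀ q0]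
  linarith

section
variable {v v' : E2 → ℝ → ℝ} {a b R M : ℝ}

lemma GReg.sabs (h : GReg v v' a b R M) {ε : ℝ} (hε : 0 < ε) :
    GReg (fun x t => _root_.sabs ε (v x t)) (fun x t => v x t / √(v x t ^ 2 + ε ^ 2) * v' x t)
      a b R M where
  c2 t ht := contDiff_sabs hε (h.c2 t ht)
  c0 t ht := ((h.cx ht).div (((h.cx ht).pow 2).add continuous_const).sqrt
    fun x => (sabs_root_pos hε _).ne').mul (h.c0 t ht)
  der x t ht := (hasDerivAt_sabs hε (v x t)).comp t (h.der x t ht)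
  ct x := ((h.ctv x).div (((h.ctv x).pow 2).add continuousOn_const).sqrt
    fun t _ => (sabs_root_pos hε _).ne').mul (h.ct x)
  bd x t ht := by
    rw [abs_of_nonneg (sabs_nonneg ε _)]
    exact (sabs_le_abs hε _).trans (h.bd x t ht)
  bd' x t ht := by
    rw [abs_mul]
    calc _ ≤ 1 * |v' x t| :=
          mul_le_mul_of_nonneg_right (abs_div_root_le_one hε _) (abs_nonneg _)
      _ ≤ M := by rw [one_mul]; exact h.bd' x t ht
  van t ht x hx := by
    simp only [h.van t ht x hx, _root_.sabs]
    rw [zero_pow two_ne_zero, zero_add, Real.sqrt_sq hε.le, sub_self]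
  van' t ht x hx := by simp only [h.van' t ht x hx, mul_zero]

lemma GReg.sub_const (h : GReg v v' a b R M) {s : ℝ} (hs : s ∈ Ioo a b) (hM : 0 ≤ M) :
    GReg (fun x t => v x t - v x s) v' a b R (2 * M) where
  c2 t ht := (h.c2 t ht).sub (h.c2 s hs)
  c0 := h.c0
  der x t ht := (h.der x t ht).sub_const _
  ct := h.ct
  bd x t ht := (abs_sub _ _).trans (by linarith [h.bd x t ht, h.bd x s hs])
  bd' x t ht := (h.bd' x t ht).trans (by linarith)
  van t ht x hx := by simp only [h.van t ht x hx, h.van s hs x hx, sub_self]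
  van' := h.van'

lemma GReg.shift_sub (h : GReg v v' a b R M) {k : ℝ} (hk : 0 ≤ k) :
    GReg (fun x t => v x (t + k) - v x t) (fun x t => v' x (t + k) - v' x t) a (b - k) R
      (2 * M) := by
  have h1 : ∀ t ∈ Ioo a (b - k), t ∈ Ioo a b := fun t ht => ⟨ht.1, by linarith [ht.2]⟩
  have h2 : ∀ t ∈ Ioo a (b - k), t + k ∈ Ioo a b := fun t ht =>
    ⟨by linarith [ht.1], by linarith [ht.2]⟩
  refine ⟨fun t ht => (h.c2 _ (h2 t ht)).sub (h.c2 t (h1 t ht)),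
    fun t ht => (h.c0 _ (h2 t ht)).sub (h.c0 t (h1 t ht)), fun x t ht => ?_, fun x => ?_,
    fun x t ht => ?_, fun x t ht => ?_, fun t ht x hx => ?_, fun t ht x hx => ?_⟩
  · exact ((h.der x _ (h2 t ht)).comp_add_const t k).sub (h.der x t (h1 t ht))
  · exact ((h.ct x).comp (f := fun t => t + k) (by fun_prop) h2).sub ((h.ct x).mono h1)
  · exact (abs_sub _ _).trans (by linarith [h.bd x _ (h2 t ht), h.bd x t (h1 t ht)])
  · exact (abs_sub _ _).trans (by linarith [h.bd' x _ (h2 t ht), h.bd' x t (h1 t ht)])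
  · simp only [h.van _ (h2 t ht) x hx, h.van _ (h1 t ht) x hx, sub_self]
  · simp only [h.van' _ (h2 t ht) x hx, h.van' _ (h1 t ht) x hx, sub_self]

lemma wt_le_two (x : E2) : wt x ≤ 2 := max_le (by linarith [sq_nonneg ‖x‖]) (by norm_num)

lemma GReg.continuousOn_integral_abs (h : GReg v v' a b R M) :
    ContinuousOn (fun t => ∫ x, |v x t| * wt x) (Ioo a b) := by
  refine continuousOn_integral_of_vanish (F := fun x t => |v x t| * wt x) (R := R) (M := M * 2)
    (fun t ht => (h.cx ht).abs.mul wt_continuous) (fun x => (h.ctv x).abs.mul continuousOn_const)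
    (fun x t ht => ?_) (fun t ht x hx => ?_)
  · rw [abs_mul, abs_abs, abs_of_nonneg (wt_nonneg x)]
    exact mul_le_mul (h.bd x t ht) (wt_le_two x) (wt_nonneg x) ((abs_nonneg _).trans (h.bd x t ht))
  · simp only [h.van t ht x hx, abs_zero, zero_mul]

lemma GReg.continuousOn_integral_abs' (h : GReg v v' a b R M) :
    ContinuousOn (fun t => ∫ x, |v' x t| * wt x) (Ioo a b) := by
  refine continuousOn_integral_of_vanish (F := fun x t => |v' x t| * wt x) (R := R) (M := M * 2)
    (fun t ht => (h.c0 t ht).abs.mul wt_continuous) (fun x => (h.ct x).abs.mul continuousOn_const)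
    (fun x t ht => ?_) (fun t ht x hx => ?_)
  · rw [abs_mul, abs_abs, abs_of_nonneg (wt_nonneg x)]
    exact mul_le_mul (h.bd' x t ht) (wt_le_two x) (wt_nonneg x)
      ((abs_nonneg _).trans (h.bd' x t ht))
  · simp only [h.van' t ht x hx, abs_zero, zero_mul]

lemma GReg.integrable_abs (h : GReg v v' a b R M) {t : ℝ} (ht : t ∈ Ioo a b) :
    Integrable fun x => |v x t| * wt x := by
  simpa only [abs_mul, abs_of_nonneg (wt_nonneg _)] using (h.integrable_mul wt_continuous ht).abs

lemma GReg.integrable_abs' (h : GReg v v' a b R M) {t : ℝ} (ht : t ∈ Ioo a b) :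
    Integrable fun x => |v' x t| * wt x := by
  simpa only [abs_mul, abs_of_nonneg (wt_nonneg _)] using (h.integrable_mul' wt_continuous ht).abs

lemma GReg.integral_sabs_le (h : GReg v v' a b R M) {ε : ℝ} (hε : 0 < ε) {t : ℝ}
    (ht : t ∈ Ioo a b) : ∫ x, _root_.sabs ε (v x t) * wt x ≤ ∫ x, |v x t| * wt x :=
  MeasureTheory.integral_mono ((h.sabs hε).integrable_mul wt_continuous ht) (h.integrable_abs ht)
    fun x => mul_le_mul_of_nonneg_right (sabs_le_abs hε _) (wt_nonneg x)

/-- The increments of `v` are controlled by the integral of its time derivative. -/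
lemma GReg.integral_abs_sub_le (h : GReg v v' a b R M) {s t : ℝ} (hs : s ∈ Ioo a b)
    (ht : t ∈ Ioo a b) (hst : s ≤ t) :
    ∫ x, |v x t - v x s| * wt x ≤ ∫ τ in s..t, ∫ x, |v' x τ| * wt x := by
  have hM : 0 ≤ M := (abs_nonneg _).trans (h.bd 0 s hs)
  have hsub : ∀ τ ∈ Icc s t, τ ∈ Ioo a b := fun τ hτ =>
    ⟨hs.1.trans_le hτ.1, hτ.2.trans_lt ht.2⟩
  have g := h.sub_const hs hM
  obtain ⟨K, hK⟩ : ∃ K, K = ∫ x, wt x := ⟨_, rfl⟩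
  have iw : Integrable wt := wt_vanish.integrable wt_continuous
  have hcut : ∀ ε > 0, ∫ x, _root_.sabs ε (v x t - v x s) * wt x
      ≤ ∫ τ in s..t, ∫ x, |v' x τ| * wt x := fun ε hε => by
    have gs := g.sabs hε
    have key := sub_le_integral_of_hasDerivAt hst
      (fun τ hτ => gs.hasDerivAt_integral_const wt_continuous (hsub τ hτ))
      (h.continuousOn_integral_abs'.mono hsub) fun τ hτ => by
        refine MeasureTheory.integral_mono (gs.integrable_mul' wt_continuous (hsub τ hτ))
          (h.integrable_abs' (hsub τ hτ)) fun x => ?_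
        refine mul_le_mul_of_nonneg_right ((le_abs_self _).trans ?_) (wt_nonneg x)
        rw [abs_mul]
        calc _ ≤ 1 * |v' x τ| :=
              mul_le_mul_of_nonneg_right (abs_div_root_le_one hε _) (abs_nonneg _)
          _ = |v' x τ| := one_mul _
    have h0 : ∫ x, _root_.sabs ε (v x s - v x s) * wt x = 0 := by
      simp [_root_.sabs, Real.sqrt_sq hε.le]
    linarith
  refine le_of_forall_pos_le_add fun δ hδ => ?_
  have hK0 : 0 ≤ K := by rw [hK]; exact integral_nonneg wt_nonneg
  obtain ⟨ε, hε, hεK⟩ : ∃ ε > 0, ε * K ≤ δ := ⟨δ / (K + 1), by positivity, by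
    rw [div_mul_eq_mul_div, div_le_iff₀ (by positivity)]; nlinarith⟩
  have h1 : ∫ x, |v x t - v x s| * wt x
      ≤ ∫ x, (_root_.sabs ε (v x t - v x s) * wt x + ε * wt x) := by
    have ia := (g.sabs hε).integrable_mul wt_continuous ht
    refine MeasureTheory.integral_mono (g.integrable_abs ht) (ia.add (iw.const_mul ε)) fun x => ?_
    have := mul_le_mul_of_nonneg_right (abs_le_sabs_add ε (v x t - v x s)) (wt_nonneg x)
    simp only
    linarith
  rw [integral_add ((g.sabs hε).integrable_mul wt_continuous ht) (iw.const_mul ε),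
    integral_const_mul, ← hK] at h1
  linarith [hcut ε hε]

end

/-- Mean value inequalities for functions satisfying a heat inequality in absolute value. -/
lemma exists_mv_abs : ∃ C₁ > 0,
    ∀ (v v' : E2 → ℝ → ℝ) (a b R M Λ G s t : ℝ), GReg v v' a b R M → 0 ≤ Λ → 0 ≤ G →
      (∀ x, ‖x‖ ≤ 1 → ∀ t ∈ Ioo a b, |v' x t - lap (fun y => v y t) x| ≤ Λ * |v x t| + G) →
      s ∈ Ioo a b → t ∈ Ioo a b → s < t → t ≤ s + 1 →
      (∀ m, (∀ x, ‖x‖ ≤ 1 → |v x s| ≤ m) →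
        |v 0 t| ≤ Real.exp Λ * (m + ∫ τ in s..t, (G + C₁ * ∫ x, |v x τ| * wt x))) ∧
      |v 0 t| ≤ Real.exp Λ * (1 / (t - s) * (∫ x, |v x s| * wt x)
        + ∫ τ in s..t, (G + C₁ * ∫ x, |v x τ| * wt x)) := by
  obtain ⟨C₁, hC₁, hmv⟩ := exists_mv
  refine ⟨C₁, hC₁, fun v v' a b R M Λ G s t H hΛ hG he hs ht hst hst1 => ?_⟩
  have hsub : ∀ τ ∈ Icc s t, τ ∈ Ioo a b := fun τ hτ =>
    ⟨hs.1.trans_le hτ.1, hτ.2.trans_lt ht.2⟩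
  have cI : ContinuousOn (fun τ => ∫ x, |v x τ| * wt x) (Icc s t) :=
    H.continuousOn_integral_abs.mono hsub
  have hint : ∀ ε > 0, ∫ τ in s..t, (G + Λ * ε + C₁ * ∫ x, _root_.sabs ε (v x τ) * wt x)
      ≤ Λ * ε + ∫ τ in s..t, (G + C₁ * ∫ x, |v x τ| * wt x) := fun ε hε => by
    have cS : ContinuousOn (fun τ => ∫ x, _root_.sabs ε (v x τ) * wt x) (Icc s t) :=
      ((H.sabs hε).continuousOn_integral wt_continuous).mono hsub
    have i1 : IntervalIntegrable (fun τ => G + C₁ * ∫ x, |v x τ| * wt x) volume s t :=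
      ContinuousOn.intervalIntegrable_of_Icc hst.le (by fun_prop)
    have h1 : ∫ τ in s..t, (G + Λ * ε + C₁ * ∫ x, _root_.sabs ε (v x τ) * wt x)
        ≤ ∫ τ in s..t, (Λ * ε + (G + C₁ * ∫ x, |v x τ| * wt x)) := by
      refine intervalIntegral.integral_mono_on hst.le
        (ContinuousOn.intervalIntegrable_of_Icc hst.le (by fun_prop))
        (intervalIntegrable_const.add i1) fun τ hτ => ?_
      have := mul_le_mul_of_nonneg_left (H.integral_sabs_le hε (hsub τ hτ)) hC₁.le
      linarith
    rw [intervalIntegral.integral_add intervalIntegrable_const i1,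
      intervalIntegral.integral_const, smul_eq_mul] at h1
    have h2 : (t - s) * (Λ * ε) ≤ 1 * (Λ * ε) :=
      mul_le_mul_of_nonneg_right (by linarith) (by positivity)
    linarith
  have hf : ∀ ε > 0, ∀ x, ‖x‖ ≤ 1 → ∀ t ∈ Ioo a b, v x t / √(v x t ^ 2 + ε ^ 2) * v' x t
      ≤ lap (fun y => _root_.sabs ε (v y t)) x + Λ * _root_.sabs ε (v x t) + (G + Λ * ε) :=
    fun ε hε x hx t ht => by
      have h1 := mul_lap_le_lap_sabs hε (H.c2 t ht) x
      have h2 : v x t / √(v x t ^ 2 + ε ^ 2) * (v' x t - lap (fun y => v y t) x)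
          ≤ Λ * |v x t| + G := by
        refine (le_abs_self _).trans ?_
        rw [abs_mul]
        calc _ ≤ 1 * |v' x t - lap (fun y => v y t) x| :=
              mul_le_mul_of_nonneg_right (abs_div_root_le_one hε _) (abs_nonneg _)
          _ ≤ _ := by rw [one_mul]; exact he x hx t ht
      have h3 := mul_le_mul_of_nonneg_left (abs_le_sabs_add ε (v x t)) hΛ
      rw [mul_sub] at h2
      linarith
  have main : ∀ A, (∀ ε > 0, _root_.sabs ε (v 0 t) ≤ Real.exp Λ * (A +
      ∫ τ in s..t, (G + Λ * ε + C₁ * ∫ x, _root_.sabs ε (v x τ) * wt x))) →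
      |v 0 t| ≤ Real.exp Λ * (A + ∫ τ in s..t, (G + C₁ * ∫ x, |v x τ| * wt x)) := fun A hA => by
    refine le_of_forall_pos_le_add fun δ hδ => ?_
    have hp : 0 < 1 + Real.exp Λ * Λ := by positivity
    obtain ⟨ε, hε, hε2⟩ : ∃ ε > 0, ε * (1 + Real.exp Λ * Λ) = δ :=
      ⟨δ / (1 + Real.exp Λ * Λ), by positivity, div_mul_cancel₀ _ hp.ne'⟩
    have h1 := abs_le_sabs_add ε (v 0 t)
    have h2 := mul_le_mul_of_nonneg_left (hint ε hε) (Real.exp_pos Λ).le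
    have h3 := hA ε hε
    rw [mul_add] at h2 h3 ⊢
    linarith
  have raw := fun ε (hε : ε > 0) => hmv _ _ a b R M Λ (G + Λ * ε) s t (H.sabs hε)
    (fun x t _ => sabs_nonneg ε _) hΛ (by positivity) (hf ε hε) hs ht hst hst1
  refine ⟨fun m hm => main m fun ε hε => (raw ε hε).1 m fun x hx =>
    (sabs_le_abs hε _).trans (hm x hx), main _ fun ε hε => (raw ε hε).2.trans ?_⟩
  refine mul_le_mul_of_nonneg_left (add_le_add_left ?_ _) (Real.exp_pos Λ).le
  exact mul_le_mul_of_nonneg_left (H.integral_sabs_le hε hs)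
    (one_div_nonneg.2 (sub_nonneg.2 hst.le))

lemma lap_sub_of_contDiffAt {f g : E2 → ℝ} {x : E2} (hf : ContDiffAt ℝ 2 f x)
    (hg : ContDiffAt ℝ 2 g x) : lap (fun y => f y - g y) x = lap f x - lap g x := by
  have ev : ∀ {f : E2 → ℝ}, ContDiffAt ℝ 2 f x → ∀ᶠ y in 𝓝 x, DifferentiableAt ℝ f y :=
    fun h => (h.eventually (by simp)).mono fun y hy => hy.differentiableAt (by norm_num)
  have dd : ∀ {f : E2 → ℝ}, ContDiffAt ℝ 2 f x → ∀ i, DifferentiableAt ℝ (pd i f) x :=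
    fun h i => ((h.fderiv_right (m := 1) (by norm_num [one_add_one_eq_two])).clm_apply
      contDiffAt_const).differentiableAt (by norm_num)
  simp only [lap_eq]
  rw [← Finset.sum_sub_distrib]
  refine Finset.sum_congr rfl fun i _ => ?_
  rw [← pd_sub (dd hf i) (dd hg i)]
  refine pd_congr ?_ i
  filter_upwards [ev hf, ev hg] with y h1 h2
  exact pd_sub h1 h2 i

/-- A bounded solution whose time derivative is bounded at the initial time of an interval of
regularity is Lipschitz up to that time. -/
lemma exists_abs_sub_le {p : ℝ} (hp : 1 < p) (M m : ℝ) (hm : 0 ≤ m) : ∃ C > 0,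
    ∀ (v v' : E2 → ℝ → ℝ) (a c : ℝ), LSol p (Metric.ball 0 3) (-1) 1 v v' → -1 < a → c < 1 →
      (∀ x ∈ Metric.ball (0 : E2) 3, ∀ t ∈ Ioo (-1 : ℝ) 1, v x t ≤ M) →
      (∀ x ∈ Metric.ball (0 : E2) 3, |v' x a| ≤ m) →
      (∀ x ∈ Metric.ball (0 : E2) 3, ∀ t ∈ Ioo a c, LocBdd v v' x t) →
      ∀ τ ∈ Ioo a c, τ ≤ a + 1 → |v 0 τ - v 0 a| ≤ C * (τ - a) := by
  obtain ⟨C₁, hC₁, hmv⟩ := exists_mv_abs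
  obtain ⟨I, hI⟩ : ∃ I, I = ∫ x, wt x := ⟨_, rfl⟩
  have hI0 : 0 ≤ I := hI ▸ integral_nonneg wt_nonneg
  have iw : Integrable wt := wt_vanish.integrable wt_continuous
  refine ⟨m + |M| ^ p + C₁ * (|M| * I) + 1, by positivity,
    fun v v' a c S ha hc hM hm' hL τ hτ hτa => ?_⟩
  have haI : a ∈ Ioo (-1 : ℝ) 1 := ⟨ha, (hτ.1.trans hτ.2).trans hc⟩
  have hsub2 : Metric.ball (0 : E2) 2 ⊆ Metric.ball 0 3 := Metric.ball_subset_ball (by norm_num)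
  have habs : ∀ x ∈ Metric.ball (0 : E2) 3, ∀ t ∈ Ioo (-1 : ℝ) 1, |v x t - v x a| ≤ |M| :=
    fun x hx t ht => by
      have h1 := hM x hx t ht
      have h2 := S.nonneg x hx t ht
      have h3 := hM x hx a haI
      have h4 := S.nonneg x hx a haI
      rw [abs_of_nonneg (h2.trans h1), abs_le]
      constructor <;> linarith
  obtain ⟨F, hF⟩ : ∃ F : ℝ → ℝ, F = fun s => ∫ x in Metric.ball (0 : E2) 2,
    |v x s - v x a| * wt x := ⟨_, rfl⟩
  have cF : ∀ t ∈ Ioo (-1 : ℝ) 1, ContinuousOn (fun x => |v x t - v x a| * wt x)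
      (Metric.ball (0 : E2) 2) := fun t ht =>
    ((((S.c2 t ht).continuousOn.mono hsub2).sub
      ((S.c2 a haI).continuousOn.mono hsub2)).abs).mul wt_continuous.continuousOn
  have hle : ∀ x ∈ Metric.ball (0 : E2) 2, ∀ t ∈ Ioo (-1 : ℝ) 1,
      |v x t - v x a| * wt x ≤ |M| * wt x := fun x hx t ht =>
    mul_le_mul_of_nonneg_right (habs x (hsub2 hx) t ht) (wt_nonneg x)
  have hmF : ∀ t ∈ Ioo (-1 : ℝ) 1, AEStronglyMeasurable (fun x => |v x t - v x a| * wt x)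
      (volume.restrict (Metric.ball (0 : E2) 2)) := fun t ht =>
    (cF t ht).aestronglyMeasurable measurableSet_ball
  have iF : ∀ t ∈ Ioo (-1 : ℝ) 1, IntegrableOn (fun x => |v x t - v x a| * wt x)
      (Metric.ball (0 : E2) 2) := fun t ht => by
    refine Integrable.mono' (iw.const_mul |M|).integrableOn (hmF t ht) ?_
    refine (ae_restrict_iff' measurableSet_ball).2 (.of_forall fun x hx => ?_)
    rw [Real.norm_of_nonneg (mul_nonneg (abs_nonneg _) (wt_nonneg x))]
    exact hle x hx t ht
  have hnear : ∀ᶠ s in 𝓝[>] a, s ∈ Ioo a τ := Ioo_mem_nhdsGT hτ.1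
  have tF : Tendsto F (𝓝[>] a) (𝓝 0) := by
    have h : Tendsto F (𝓝[>] a) (𝓝 (∫ x in Metric.ball (0 : E2) 2, (0 : ℝ))) := by
      rw [hF]
      refine tendsto_integral_filter_of_dominated_convergence (fun x => |M| * wt x) ?_ ?_
        (iw.const_mul |M|).integrableOn ?_
      · filter_upwards [hnear] with s hs
        exact hmF s ⟨ha.trans hs.1, (hs.2.trans hτ.2).trans hc⟩
      · filter_upwards [hnear] with s hs
        refine (ae_restrict_iff' measurableSet_ball).2 (.of_forall fun x hx => ?_)
        rw [Real.norm_of_nonneg (mul_nonneg (abs_nonneg _) (wt_nonneg x))]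
        exact hle x hx s ⟨ha.trans hs.1, (hs.2.trans hτ.2).trans hc⟩
      · refine (ae_restrict_iff' measurableSet_ball).2 (.of_forall fun x hx => ?_)
        have h1 : ContinuousAt (v x) a := (S.der x (hsub2 hx) a haI).continuousAt
        have h2 : ContinuousAt (fun s => |v x s - v x a| * wt x) a := by fun_prop
        have h3 := h2.tendsto.mono_left (nhdsWithin_le_nhds (s := Ioi a))
        simpa using h3
    simpa using h
  obtain ⟨K, hK⟩ : ∃ K, K = m + |M| ^ p + C₁ * (|M| * I) := ⟨_, rfl⟩
  have hK0 : 0 ≤ K := by rw [hK]; positivity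
  have key : ∀ s ∈ Ioo a τ, |v 0 τ - v 0 a| ≤ 1 / (τ - s) * F s + (τ - s) * K := fun s hs => by
    have hcb : Metric.closedBall (0 : E2) 2 ⊆ Metric.ball 0 3 :=
      Metric.closedBall_subset_ball (by norm_num)
    obtain ⟨N, ε, hε, hN⟩ := exists_bound_of_locBdd (x₀ := (0 : E2)) (r := 2) hs.2.le
      fun x hx t ht => hL x (hcb hx) t ⟨hs.1.trans_le ht.1, ht.2.trans_lt hτ.2⟩
    obtain ⟨δ, hδ, hδε, hδ1, hδ2⟩ : ∃ δ > 0, δ ≤ ε ∧ δ ≤ s - a ∧ δ ≤ c - τ :=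
      ⟨min ε (min (s - a) (c - τ)), lt_min hε (lt_min (sub_pos.2 hs.1) (sub_pos.2 hτ.2)),
        min_le_left _ _, (min_le_right _ _).trans (min_le_left _ _),
        (min_le_right _ _).trans (min_le_right _ _)⟩
    have hJ : ∀ t ∈ Ioo (s - δ) (τ + δ), t ∈ Ioo (-1 : ℝ) 1 := fun t ht =>
      ⟨by linarith [ht.1], by linarith [ht.2]⟩
    have hJ' : ∀ t ∈ Ioo (s - δ) (τ + δ), t ∈ Ioo (s - ε) (τ + ε) := fun t ht =>
      ⟨by linarith [ht.1], by linarith [ht.2]⟩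
    obtain ⟨χ, W, W', g, h01, hχ0, hW, e1, e2, e3⟩ := exists_greg (r := 1) (r' := 2)
      (a := s - δ) (b := τ + δ) (M := max |M| N) (w := fun x t => v x t - v x a) (w' := v')
      one_pos (by norm_num)
      (fun t ht => ((S.c2 t (hJ t ht)).mono hsub2).sub ((S.c2 a haI).mono hsub2))
      (fun t ht => (S.continuousOn_deriv hp Metric.isOpen_ball (hJ t ht)).mono hsub2)
      (fun x hx t ht => (S.der x (hsub2 hx) t (hJ t ht)).sub_const _)
      (fun x hx => (S.ct x (hsub2 hx)).mono hJ)
      (fun x hx t ht => (habs x (hsub2 hx) t (hJ t ht)).trans (le_max_left _ _))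
      (fun x hx t ht => (hN x (Metric.ball_subset_closedBall hx) t (hJ' t ht)).2.trans
        (le_max_right _ _))
    have hWle : ∀ t ∈ Ioo (s - δ) (τ + δ), ∫ x, |W x t| * wt x ≤ F t := fun t ht => by
      have hz : ∀ x, x ∉ Metric.ball (0 : E2) 2 → |W x t| * wt x = 0 := fun x hx => by
        rw [hW, hχ0 x hx]; simp
      rw [← setIntegral_eq_integral_of_forall_compl_eq_zero hz, hF]
      refine setIntegral_mono_on (g.integrable_abs ht).integrableOn (iF t (hJ t ht))
        measurableSet_ball fun x hx => ?_
      refine mul_le_mul_of_nonneg_right ?_ (wt_nonneg x)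
      rw [hW, abs_mul, abs_of_nonneg (h01 x).1]
      exact mul_le_of_le_one_left (abs_nonneg _) (h01 x).2
    have hFle : ∀ t ∈ Ioo (s - δ) (τ + δ), F t ≤ |M| * I := fun t ht => by
      rw [hF, hI, ← integral_const_mul]
      refine (setIntegral_mono_on (iF t (hJ t ht)) (iw.const_mul |M|).integrableOn
        measurableSet_ball fun x hx => hle x hx t (hJ t ht)).trans ?_
      exact setIntegral_le_integral (iw.const_mul |M|)
        (.of_forall fun x => mul_nonneg (abs_nonneg _) (wt_nonneg x))
    have hsJ : s ∈ Ioo (s - δ) (τ + δ) := ⟨by linarith, by linarith [hs.2]⟩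
    have hτJ : τ ∈ Ioo (s - δ) (τ + δ) := ⟨by linarith [hs.2], by linarith⟩
    have h := (hmv W W' _ _ 2 _ 0 (m + |M| ^ p) s τ g le_rfl (by positivity) (fun x hx t ht => ?_)
      hsJ hτJ hs.2 (by linarith [hs.1])).2
    · rw [e1 0 (by simp), Real.exp_zero, one_mul] at h
      refine h.trans (add_le_add ?_ ?_)
      · exact mul_le_mul_of_nonneg_left (hWle s hsJ) (one_div_nonneg.2 (sub_nonneg.2 hs.2.le))
      · have hIcc : Icc s τ ⊆ Ioo (s - δ) (τ + δ) := fun t ht =>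
          ⟨by linarith [ht.1], by linarith [ht.2]⟩
        have c1 : ContinuousOn (fun t => ∫ x, |W x t| * wt x) (Icc s τ) :=
          g.continuousOn_integral_abs.mono hIcc
        have i1 : IntervalIntegrable (fun t => m + |M| ^ p + C₁ * ∫ x, |W x t| * wt x) volume s τ :=
          ContinuousOn.intervalIntegrable_of_Icc hs.2.le (by fun_prop)
        have h2 := intervalIntegral.integral_mono_on hs.2.le (g := fun _ => K) i1
          intervalIntegrable_const fun t ht => by
            have := mul_le_mul_of_nonneg_left
              ((hWle t (hIcc ht)).trans (hFle t (hIcc ht))) hC₁.le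
            linarith
        rwa [intervalIntegral.integral_const, smul_eq_mul] at h2
    · have hx3 : x ∈ Metric.ball (0 : E2) 3 := by simp; linarith
      have h1 := lap_sub_of_contDiffAt (S.contDiffAt Metric.isOpen_ball hx3 (hJ t ht))
        (S.contDiffAt Metric.isOpen_ball hx3 haI)
      rw [e2 x hx, e3 x hx, h1, zero_mul, zero_add]
      have h2 := S.eq x hx3 t (hJ t ht)
      have h3 := S.eq x hx3 a haI
      have pw : ∀ t ∈ Ioo (-1 : ℝ) 1, 0 ≤ v x t ^ p ∧ v x t ^ p ≤ |M| ^ p := fun t ht => by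
        have := S.nonneg x hx3 t ht
        exact ⟨Real.rpow_nonneg this p, Real.rpow_le_rpow this
          ((hM x hx3 t ht).trans (le_abs_self M)) (by linarith)⟩
      have h4 := pw t (hJ t ht)
      have h5 := pw a haI
      have h6 := abs_le.1 (hm' x hx3)
      rw [abs_le]
      constructor <;> linarith [h6.1, h6.2]
  have hlim : Tendsto (fun s => 1 / (τ - s) * F s + (τ - s) * K) (𝓝[>] a)
      (𝓝 (1 / (τ - a) * 0 + (τ - a) * K)) := by
    have h1 : Tendsto (fun s => τ - s) (𝓝[>] a) (𝓝 (τ - a)) :=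
      ((continuous_const.sub continuous_id).tendsto a).mono_left nhdsWithin_le_nhds
    exact ((tendsto_const_nhds.div h1 (sub_pos.2 hτ.1).ne').mul tF).add (h1.mul_const K)
  have := ge_of_tendsto hlim (hnear.mono key)
  rw [← hK]
  nlinarith [sub_pos.2 hτ.1]

lemma integral_mul_le_of_le_on {f φ : E2 → ℝ} {B ρ : ℝ} (hφ : VanishOff ρ φ) (cφ : Continuous φ)
    (hf : ∀ x, ‖x‖ ≤ ρ → |f x| ≤ B) : ∫ x, f x * φ x ≤ B * ∫ x, |φ x| := by
  have i1 : Integrable fun x => |φ x| := (hφ.integrable cφ).abs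
  rw [← integral_const_mul]
  by_cases hi : Integrable fun x => f x * φ x
  · refine MeasureTheory.integral_mono hi (i1.const_mul B) fun x => ?_
    by_cases hx : ‖x‖ ≤ ρ
    · refine (le_abs_self _).trans ?_
      rw [abs_mul]
      exact mul_le_mul_of_nonneg_right (hf x hx) (abs_nonneg _)
    · simp [hφ x (not_le.1 hx)]
  · rw [integral_undef hi]
    refine integral_nonneg fun x => ?_
    by_cases hx : ‖x‖ ≤ ρ
    · exact mul_nonneg ((abs_nonneg _).trans (hf x hx)) (abs_nonneg _)
    · simp [hφ x (not_le.1 hx)]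

/-- A bounded solution which is Lipschitz up to the initial time has `uₜ` bounded in `L²`. -/
lemma exists_integral_deriv_sq_le_of_lip {p : ℝ} (hp : 1 < p) {M L : ℝ} (hM0 : 0 ≤ M) 
    (hL0 : 0 ≤ L) : ∃ C > 0, ∀ (V V' : E2 → ℝ → ℝ) (a b R N s h t : ℝ), PSol p 3 V V' a b R N →
      (∀ x, ‖x‖ ≤ 3 → ∀ t ∈ Ioo a b, V x t ≤ M) → 0 < h →
      (∀ x, ‖x‖ ≤ 3 → |V x s - V x (s + h)| ≤ L * h) → a < s → s + h ≤ t → t < b → t ≤ s + 2 →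
      ∫ τ in (s + h)..t, ∫ x, V' x τ * V' x τ * bump 3 4 x ≤ C := by
  have hφ : ContDiff ℝ 2 (bump 3 8) := bump_contDiff 0 8
  have cφ := hφ.continuous
  have hv := bump_vanish_eight 3 (by norm_num)
  have iφ : Integrable (bump 3 8) := hv.integrable cφ
  obtain ⟨B0, hB0⟩ : ∃ B, B = ∫ x, |bump 3 8 x| := ⟨_, rfl⟩
  obtain ⟨B1, hB1⟩ : ∃ B, B = ∫ x, |lap (bump 3 8) x| := ⟨_, rfl⟩
  have B00 : 0 ≤ B0 := hB0 ▸ integral_nonneg fun x => abs_nonneg _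
  have B10 : 0 ≤ B1 := hB1 ▸ integral_nonneg fun x => abs_nonneg _
  obtain ⟨K, hK⟩ : ∃ K, K = M ^ (p + 1) * B0 + 1 / 2 * (M * M * B1) := ⟨_, rfl⟩
  have hK0 : 0 ≤ K := by rw [hK]; positivity
  refine ⟨(L * M * B0 + K) + M ^ (p + 1) * B0 + 72 * (1 / 2 * (M * M * B0) + 2 * K) + 1,
    by positivity, fun V V' a b R N s h t S hM hh hL hs hst ht hts => ?_⟩
  have hsub : Icc s t ⊆ Ioo a b := fun τ hτ => ⟨hs.trans_le hτ.1, hτ.2.trans_lt ht⟩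
  have sq : ∀ τ ∈ Ioo a b, ∀ x, ‖x‖ ≤ 3 → |V x τ * V x τ| ≤ M * M := fun τ hτ x hx => by
    rw [abs_mul_self]
    have := S.nonneg x τ hτ
    have := hM x hx τ hτ
    gcongr
  have pw : ∀ τ ∈ Ioo a b, ∀ x, ‖x‖ ≤ 3 → |V x τ ^ (p + 1)| ≤ M ^ (p + 1) := fun τ hτ x hx => by
    have := S.nonneg x τ hτ
    rw [abs_of_nonneg (Real.rpow_nonneg this _)]
    exact Real.rpow_le_rpow this (hM x hx τ hτ) (by linarith)
  have hpow : ∀ τ ∈ Ioo a b, ∫ x, V x τ ^ (p + 1) * bump 3 8 x ≤ M ^ (p + 1) * B0 := fun τ hτ =>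
    hB0 ▸ integral_mul_le_of_le_on hv cφ (pw τ hτ)
  have hsq : ∀ τ ∈ Ioo a b, ∫ x, V x τ * V x τ * bump 3 8 x ≤ M * M * B0 := fun τ hτ =>
    hB0 ▸ integral_mul_le_of_le_on hv cφ (sq τ hτ)
  have hker : ∀ τ ∈ Ioo a b, (∫ x, V x τ ^ (p + 1) * bump 3 8 x)
      + 1 / 2 * ∫ x, V x τ * V x τ * lap (bump 3 8) x ≤ K := fun τ hτ => by
    have h2 : ∫ x, V x τ * V x τ * lap (bump 3 8) x ≤ M * M * B1 :=
      hB1 ▸ integral_mul_le_of_le_on hv.lap (continuous_lap hφ) (sq τ hτ)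
    linarith [hpow τ hτ]
  have hint : ∀ c ∈ Icc s t, ∀ d ∈ Icc c t, ∫ τ in c..d, ((∫ x, V x τ ^ (p + 1) * bump 3 8 x)
      + 1 / 2 * ∫ x, V x τ * V x τ * lap (bump 3 8) x) ≤ (d - c) * K := fun c hc d hd => by
    have hcd : Icc c d ⊆ Ioo a b := (Icc_subset_Icc hc.1 hd.2).trans hsub
    have c2 := (S.rpow_integral_continuousOn (q := p + 1) (by linarith) cφ hv).mono hcd
    have c3 := (S.reg.sq.continuousOn_integral (continuous_lap hφ)).mono hcd
    have cK : ContinuousOn (fun τ => (∫ x, V x τ ^ (p + 1) * bump 3 8 x)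
        + 1 / 2 * ∫ x, V x τ * V x τ * lap (bump 3 8) x) (Icc c d) := c2.add (c3.const_mul _)
    have h1 := intervalIntegral.integral_mono_on hd.1 (μ := volume) (g := fun _ => K)
      (cK.intervalIntegrable_of_Icc hd.1) intervalIntegrable_const fun τ hτ => hker τ (hcd hτ)
    rwa [intervalIntegral.integral_const, smul_eq_mul] at h1
  have hsI : s ∈ Icc s t := ⟨le_rfl, by linarith⟩
  have hshI : s + h ∈ Icc s t := ⟨by linarith, hst⟩
  have hdiff : (∫ x, V x s * V x s * bump 3 8 x) - ∫ x, V x (s + h) * V x (s + h) * bump 3 8 x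
      ≤ L * h * (2 * M) * B0 := by
    rw [← integral_sub (S.reg.sq.integrable_mul cφ (hsub hsI))
      (S.reg.sq.integrable_mul cφ (hsub hshI))]
    simp only [← sub_mul]
    rw [hB0]
    refine integral_mul_le_of_le_on hv cφ fun x hx => ?_
    rw [mul_self_sub_mul_self, mul_comm, abs_mul]
    have h1 := S.nonneg x s (hsub hsI)
    have h2 := S.nonneg x _ (hsub hshI)
    have h3 := hM x hx s (hsub hsI)
    have h4 := hM x hx _ (hsub hshI)
    refine mul_le_mul (hL x hx) ?_ (abs_nonneg _) (by positivity)
    rw [abs_of_nonneg (add_nonneg h1 h2)]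
    linarith
  have cg : ContinuousOn (dirEnergy V) (Icc s t) := (S.dirEnergy_continuousOn hp).mono hsub
  obtain ⟨s₁, hs₁, hle⟩ := exists_mul_le_integral hshI.1 (cg.mono (Icc_subset_Icc le_rfl hst))
  have hs₁t : s₁ ∈ Icc s t := ⟨hs₁.1, hs₁.2.trans hst⟩
  have e1 := S.dirEnergy_integral_le_sub hp hs hshI.1 (hsub hshI).2
  have e2 : dirEnergy V s₁ ≤ L * M * B0 + K := by
    have := hint s hsI (s + h) hshI
    rw [add_sub_cancel_left] at this hle
    refine le_of_mul_le_mul_right ?_ hh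
    linarith
  have e3 := S.dirEnergy_integral_le hp (hsub hs₁t).1 hs₁t.2 ht
  have e4 := hint s₁ hs₁t t ⟨hs₁t.2, le_rfl⟩
  have e5 : (t - s₁) * K ≤ 2 * K := mul_le_mul_of_nonneg_right (by linarith [hs₁.1]) hK0
  have e6 := S.integral_deriv_sq_le hp (hsub hs₁t).1 hs₁t.2 ht
  have e7 := integral_le_integral_of_subinterval (f := fun τ => ∫ x, V' x τ * V' x τ * bump 3 4 x)
    hs₁.2 hst le_rfl (S.derivSq_continuousOn.mono ((Icc_subset_Icc hs₁.1 le_rfl).trans hsub))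
    fun τ _ => integral_nonneg fun x => mul_nonneg (mul_self_nonneg _) (bump_nonneg _ _ _)
  have e8 := hsq s₁ (hsub hs₁t)
  have e9 := hpow t (hsub ⟨hsI.2, le_rfl⟩)
  linarith

lemma abs_rpow_sub_rpow_le {p : ℝ} (hp : 1 < p) {M x y : ℝ} (hx : x ∈ Icc 0 M)
    (hy : y ∈ Icc 0 M) : |x ^ p - y ^ p| ≤ p * M ^ (p - 1) * |x - y| := by
  refine (convex_Icc 0 M).norm_image_sub_le_of_norm_hasDerivWithin_le (f := fun x : ℝ => x ^ p)
    (f' := fun x => p * x ^ (p - 1))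
    (fun x _ => (Real.hasDerivAt_rpow_const (Or.inr hp.le)).hasDerivWithinAt) (fun x hx => ?_) hy hx
  have h0 : 0 ≤ x ^ (p - 1) := Real.rpow_nonneg hx.1 _
  rw [Real.norm_of_nonneg (by positivity)]
  exact mul_le_mul_of_nonneg_left (Real.rpow_le_rpow hx.1 hx.2 (by linarith)) (by linarith)

lemma integral_integral_window_le_of_continuous {f : ℝ → ℝ} (hf : Continuous f) (h0 : ∀ t, 0 ≤ f t)
    {s t h : ℝ} (hst : s ≤ t) (hh : 0 ≤ h) :
    ∫ τ in s..t, ∫ σ in τ..(τ + h), f σ ≤ h * ∫ σ in s..(t + h), f σ := by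
  obtain ⟨F, hF⟩ : ∃ F : ℝ → ℝ, F = fun τ => ∫ σ in s..τ, f σ := ⟨_, rfl⟩
  have ii : ∀ a b, IntervalIntegrable f volume a b := fun a b => hf.intervalIntegrable a b
  have cF : Continuous F := hF ▸ intervalIntegral.continuous_primitive ii s
  have iF : ∀ a b, IntervalIntegrable F volume a b := fun a b => cF.intervalIntegrable a b
  have e1 : ∀ τ, ∫ σ in τ..(τ + h), f σ = F (τ + h) - F τ := fun τ => by
    rw [hF]; exact (intervalIntegral.integral_interval_sub_left (ii _ _) (ii _ _)).symm
  simp only [e1]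
  have i2 : IntervalIntegrable (fun τ => F (τ + h)) volume s t :=
    (cF.comp (continuous_add_const h)).intervalIntegrable _ _
  rw [intervalIntegral.integral_sub i2 (iF _ _), intervalIntegral.integral_comp_add_right F h,
    intervalIntegral.integral_interval_sub_interval_comm (iF _ _) (iF _ _) (iF _ _),
    intervalIntegral.integral_symm s (s + h), intervalIntegral.integral_symm t (t + h)]
  have h1 : 0 ≤ ∫ τ in s..(s + h), F τ :=
    intervalIntegral.integral_nonneg (by linarith) fun τ hτ => by
      rw [hF]; exact intervalIntegral.integral_nonneg hτ.1 fun σ _ => h0 σ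
  have h2 : ∫ τ in t..(t + h), F τ ≤ ∫ τ in t..(t + h), F (t + h) :=
    intervalIntegral.integral_mono_on (by linarith) (iF _ _) intervalIntegrable_const
      fun τ hτ => by
        rw [hF]
        exact integral_le_integral_of_subinterval le_rfl (by linarith [hτ.1]) hτ.2
          hf.continuousOn fun t _ => h0 t
  rw [intervalIntegral.integral_const, smul_eq_mul, add_sub_cancel_left] at h2
  rw [hF] at h1 h2 ⊢
  simp only at h1 h2 ⊢
  linarith

lemma integral_integral_window_le {f : ℝ → ℝ} {s t h : ℝ} (hst : s ≤ t) (hh : 0 ≤ h)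
    (hf : ContinuousOn f (Icc s (t + h))) (h0 : ∀ t, 0 ≤ f t) :
    ContinuousOn (fun τ => ∫ σ in τ..(τ + h), f σ) (Icc s t) ∧
      ∫ τ in s..t, ∫ σ in τ..(τ + h), f σ ≤ h * ∫ σ in s..(t + h), f σ := by
  have hsth : s ≤ t + h := by linarith
  obtain ⟨g, hg⟩ : ∃ g : ℝ → ℝ, g = IccExtend hsth ((Icc s (t + h)).domRestrict f) := ⟨_, rfl⟩
  have cg : Continuous g := hg ▸ (continuousOn_iff_continuous_domRestrict.1 hf).Icc_extend'
  have e : ∀ σ ∈ Icc s (t + h), f σ = g σ := fun σ hσ => by rw [hg, IccExtend_of_mem _ _ hσ]; rfl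
  have e1 : ∀ τ ∈ Icc s t, ∫ σ in τ..(τ + h), f σ = ∫ σ in τ..(τ + h), g σ := fun τ hτ =>
    intervalIntegral.integral_congr fun σ hσ => by
      rw [uIcc_of_le (by linarith)] at hσ
      exact e σ ⟨hτ.1.trans hσ.1, hσ.2.trans (by linarith [hτ.2])⟩
  constructor
  · refine ContinuousOn.congr ?_ e1
    have h1 : ∀ τ, ∫ σ in τ..(τ + h), g σ = (∫ σ in s..(τ + h), g σ) - ∫ σ in s..τ, g σ := fun τ =>
      (intervalIntegral.integral_interval_sub_left (cg.intervalIntegrable _ _)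
        (cg.intervalIntegrable _ _)).symm
    simp only [h1]
    have c := intervalIntegral.continuous_primitive (μ := volume) 
      (fun a b => cg.intervalIntegrable a b) s
    exact ((c.comp (continuous_add_const h)).sub c).continuousOn
  · rw [intervalIntegral.integral_congr (g := fun τ => ∫ σ in τ..(τ + h), g σ) fun τ hτ => by
        rw [uIcc_of_le hst] at hτ; exact e1 τ hτ,
      intervalIntegral.integral_congr (a := s) (b := t + h) (g := g) fun σ hσ => by
        rw [uIcc_of_le hsth] at hσ; exact e σ hσ]
    refine integral_integral_window_le_of_continuous cg (fun σ => ?_) hst hh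
    rw [hg]
    exact h0 _

lemma wt_le_bump (x : E2) : wt x ≤ 16 * bump 3 4 x := by
  by_cases hx : ‖x‖ ^ 2 ≤ 2
  · have := le_bump 3 (ρ := 4) (r := 2) (by norm_num) (by norm_num) hx
    have := wt_le_two x
    norm_num at *
    linarith
  · rw [wt, max_eq_right (by linarith)]
    linarith [bump_nonneg 3 4 x]

lemma GReg.integral_abs_deriv_le {v v' : E2 → ℝ → ℝ} {a b R M : ℝ} (g : GReg v v' a b R M) {t : ℝ}
    (ht : t ∈ Ioo a b) : ∫ x, |v' x t| * wt x
      ≤ 16 * (∫ x, v' x t * v' x t * bump 3 4 x) + ∫ x, wt x := by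
  have i1 : Integrable fun x => v' x t * v' x t * bump 3 4 x :=
    ((bump_vanish_four 3 (by norm_num)).mul_left _).integrable
      (((g.c0 t ht).mul (g.c0 t ht)).mul (bump_continuous _ _))
  have iw : Integrable wt := wt_vanish.integrable wt_continuous
  rw [← integral_const_mul, ← integral_add (i1.const_mul 16) iw]
  refine MeasureTheory.integral_mono (g.integrable_abs' ht) ((i1.const_mul 16).add iw) fun x => ?_
  have h1 : |v' x t| ≤ v' x t * v' x t + 1 := by
    rw [← abs_mul_abs_self]; nlinarith [sq_nonneg (|v' x t| - 1)]
  have h2 := mul_le_mul_of_nonneg_right h1 (wt_nonneg x)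
  have h3 := mul_le_mul_of_nonneg_left (wt_le_bump x) (mul_self_nonneg (v' x t))
  simp only
  linarith

/-- Interior estimate for time differences. -/
lemma exists_abs_shift_sub_le {p : ℝ} (hp : 1 < p) {M L C₄ : ℝ} (hM0 : 0 ≤ M) (hL0 : 0 ≤ L)
    (hC₄ : 0 ≤ C₄) : ∃ C > 0, ∀ (V V' : E2 → ℝ → ℝ) (a b R N s t h : ℝ), PSol p 3 V V' a b R N →
      (∀ x, ‖x‖ ≤ 3 → ∀ t ∈ Ioo a b, V x t ≤ M) → 0 < h → a < s → s < t → t + h < b →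
      t + h ≤ s + 1 → (∀ x, ‖x‖ ≤ 1 → |V x (s + h) - V x s| ≤ L * h) →
      ∫ τ in s..(t + h), ∫ x, V' x τ * V' x τ * bump 3 4 x ≤ C₄ →
      |V 0 (t + h) - V 0 t| ≤ C * h := by
  obtain ⟨C₁, hC₁, hmv⟩ := exists_mv_abs
  obtain ⟨I, hI⟩ : ∃ I, I = ∫ x, wt x := ⟨_, rfl⟩
  have hI0 : 0 ≤ I := hI ▸ integral_nonneg wt_nonneg
  refine ⟨Real.exp (p * M ^ (p - 1)) * (L + C₁ * (16 * C₄ + I)) + 1, by positivity,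
    fun V V' a b R N s t h S hM hh has hst htb hts hLip hC => ?_⟩
  have hsub : Icc s (t + h) ⊆ Ioo a b := fun τ hτ => ⟨has.trans_le hτ.1, hτ.2.trans_lt htb⟩
  have hsth : s ≤ t + h := by linarith
  have g := S.reg.shift_sub hh.le
  have hz : ∀ x, ‖x‖ ≤ 1 → ∀ τ ∈ Ioo a (b - h), |V' x (τ + h) - V' x τ
      - lap (fun y => V y (τ + h) - V y τ) x| ≤ p * M ^ (p - 1) * |V x (τ + h) - V x τ| + 0 :=
    fun x hx τ hτ => by
      have h1 : τ ∈ Ioo a b := ⟨hτ.1, by linarith [hτ.2]⟩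
      have h2 : τ + h ∈ Ioo a b := ⟨by linarith [hτ.1], by linarith [hτ.2]⟩
      have hx3 : ‖x‖ ≤ 3 := hx.trans (by norm_num)
      rw [lap_sub (S.reg.c2 _ h2) (S.reg.c2 _ h1), S.eq x hx3 _ h2, S.eq x hx3 _ h1, add_zero]
      have := abs_rpow_sub_rpow_le hp (M := M) ⟨S.nonneg x _ h2, hM x hx3 _ h2⟩
        ⟨S.nonneg x _ h1, hM x hx3 _ h1⟩
      convert this using 2
      ring
  have key := (hmv _ _ a (b - h) R _ (p * M ^ (p - 1)) 0 s t g
    (mul_nonneg (by linarith) (Real.rpow_nonneg hM0 _)) le_rfl hz ⟨has, by linarith⟩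
    ⟨by linarith, by linarith⟩ hst (by linarith)).1 (L * h) hLip
  have cf : ContinuousOn (fun τ => ∫ x, |V' x τ| * wt x) (Icc s (t + h)) :=
    S.reg.continuousOn_integral_abs'.mono hsub
  obtain ⟨cw, hw⟩ := integral_integral_window_le hst.le hh.le cf fun τ =>
    integral_nonneg fun x => mul_nonneg (abs_nonneg _) (wt_nonneg x)
  have h1 : ∫ τ in s..t, ((0 : ℝ) + C₁ * ∫ x, |V x (τ + h) - V x τ| * wt x)
      ≤ C₁ * ∫ τ in s..t, ∫ σ in τ..(τ + h), ∫ x, |V' x σ| * wt x := by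
    rw [← intervalIntegral.integral_const_mul]
    have c1 : ContinuousOn (fun τ => ∫ x, |V x (τ + h) - V x τ| * wt x) (Icc s t) :=
      g.continuousOn_integral_abs.mono fun τ hτ => ⟨has.trans_le hτ.1, by linarith [hτ.2]⟩
    refine intervalIntegral.integral_mono_on hst.le (μ := volume)
      (ContinuousOn.intervalIntegrable_of_Icc hst.le (by fun_prop))
      (ContinuousOn.intervalIntegrable_of_Icc hst.le (cw.const_mul C₁)) fun τ hτ => ?_
    rw [zero_add]
    exact mul_le_mul_of_nonneg_left (S.reg.integral_abs_sub_le
      (hsub ⟨hτ.1, by linarith [hτ.2]⟩) (hsub ⟨by linarith [hτ.1], by linarith [hτ.2]⟩)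
      (by linarith)) hC₁.le
  have h2 : ∫ σ in s..(t + h), ∫ x, |V' x σ| * wt x ≤ 16 * C₄ + I := by
    have cd := S.derivSq_continuousOn.mono hsub
    have id := cd.intervalIntegrable_of_Icc (μ := volume) hsth
    have := intervalIntegral.integral_mono_on hsth (μ := volume)
      (cf.intervalIntegrable_of_Icc hsth) ((id.const_mul 16).add intervalIntegrable_const)
      fun τ hτ => S.reg.integral_abs_deriv_le (hsub hτ)
    rw [intervalIntegral.integral_add (id.const_mul 16) intervalIntegrable_const,
      intervalIntegral.integral_const_mul, intervalIntegral.integral_const, smul_eq_mul, ← hI]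
      at this
    have h3 : (t + h - s) * I ≤ 1 * I := mul_le_mul_of_nonneg_right (by linarith) hI0
    linarith
  have h3 := mul_le_mul_of_nonneg_left (hw.trans (mul_le_mul_of_nonneg_left h2 hh.le)) hC₁.le
  have h4 : L * h + ∫ τ in s..t, ((0 : ℝ) + C₁ * ∫ x, |V x (τ + h) - V x τ| * wt x)
      ≤ (L + C₁ * (16 * C₄ + I)) * h := by
    have := h1.trans h3
    linarith
  have h5 := mul_le_mul_of_nonneg_left h4 (Real.exp_pos (p * M ^ (p - 1))).le
  refine (key.trans h5).trans ?_
  linarith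

/-- A bounded solution whose time derivative is bounded at the initial time of an interval of
local boundedness has bounded time derivative on the whole interval. -/
lemma exists_abs_deriv_le_of_gap {p : ℝ} (hp : 1 < p) {M m : ℝ} (hM0 : 0 ≤ M) (hm : 0 ≤ m) :
    ∃ C > 0, ∀ (v v' : E2 → ℝ → ℝ) (a c : ℝ), LSol p (Metric.ball 0 7) (-1) 1 v v' →
      -1 < a → c < 1 → c ≤ a + 1 →
      (∀ x ∈ Metric.ball (0 : E2) 7, ∀ t ∈ Ioo (-1 : ℝ) 1, v x t ≤ M) →
      (∀ x ∈ Metric.ball (0 : E2) 7, |v' x a| ≤ m) →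
      (∀ x ∈ Metric.ball (0 : E2) 7, ∀ t ∈ Ioo a c, LocBdd v v' x t) →
      ∀ t ∈ Ioo a c, |v' 0 t| ≤ C := by
  obtain ⟨C₂, hC₂, hlip⟩ := exists_abs_sub_le hp M m hm
  obtain ⟨C₄, hC₄, hsq⟩ := exists_integral_deriv_sq_le_of_lip hp hM0 (L := 3 * C₂) (by positivity)
  obtain ⟨C, hC, hsh⟩ := exists_abs_shift_sub_le hp hM0 (L := 3 * C₂) (by positivity) hC₄.le
  refine ⟨C, hC, fun v v' a c S ha hc hca hM hm' hL t ht => ?_⟩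
  have hcl : ∀ x : E2, ‖x‖ ≤ 3 → ∀ τ ∈ Ioo a c, |v x τ - v x a| ≤ C₂ * (τ - a) :=
    fun x hx τ hτ => by
      have hmem : ∀ y ∈ Metric.ball (0 : E2) 3, x + y ∈ Metric.ball (0 : E2) 7 := fun y hy => by
        rw [mem_ball_zero_iff] at hy ⊢
        have := norm_add_le x y
        linarith
      have := hlip _ _ a c (S.translate hp x (Ω' := Metric.ball 0 3) hmem) ha hc
        (fun y hy s hs => hM _ (hmem y hy) s hs) (fun y hy => hm' _ (hmem y hy))
        (fun y hy s hs => ?_) τ hτ (by linarith [hτ.2])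
      · simpa using this
      · simpa using (show LocBdd v v' (x + (1 : ℝ) • y) (0 + 1 * s) by
          simpa using hL _ (hmem y hy) s hs).comp_affine 1 1
  have key : ∀ h, 0 < h → h < (t - a) / 2 → h < c - t → |v 0 (t + h) - v 0 t| ≤ C * h :=
    fun h hh h1 h2 => by
      obtain ⟨s₀, hs₀⟩ : ∃ s, s = a + h / 2 := ⟨_, rfl⟩
      have hcb : Metric.closedBall (0 : E2) 6 ⊆ Metric.ball 0 7 :=
        Metric.closedBall_subset_ball (by norm_num)
      obtain ⟨N, ε, hε, hN⟩ := exists_bound_of_locBdd (x₀ := (0 : E2)) (r := 6)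
        (by linarith : s₀ ≤ t + h)
        fun x hx τ hτ => hL x (hcb hx) τ ⟨by linarith [hτ.1], by linarith [hτ.2]⟩
      obtain ⟨δ, hδ, hδε, hδ1, hδ2⟩ : ∃ δ > 0, δ ≤ ε ∧ δ ≤ s₀ - a ∧ δ ≤ c - (t + h) :=
        ⟨min ε (min (s₀ - a) (c - (t + h))), lt_min hε (lt_min (by linarith) (by linarith)),
          min_le_left _ _, (min_le_right _ _).trans (min_le_left _ _),
          (min_le_right _ _).trans (min_le_right _ _)⟩
      have hJ : ∀ τ ∈ Ioo (s₀ - δ) (t + h + δ), τ ∈ Ioo (s₀ - ε) (t + h + ε) := fun τ hτ =>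
        ⟨by linarith [hτ.1], by linarith [hτ.2]⟩
      obtain ⟨V, V', P, e, -⟩ := (S.mono (Metric.ball_subset_closedBall.trans hcb)
        (a' := s₀ - δ) (b' := t + h + δ) (by linarith) (by linarith)).exists_psol hp (r := 3)
        (by norm_num) (by norm_num)
        (fun x hx τ hτ => (hN x (Metric.ball_subset_closedBall hx) τ (hJ τ hτ)).1)
        (fun x hx τ hτ => (hN x (Metric.ball_subset_closedBall hx) τ (hJ τ hτ)).2)
      have hVM : ∀ x, ‖x‖ ≤ 3 → ∀ τ ∈ Ioo (s₀ - δ) (t + h + δ), V x τ ≤ M := fun x hx τ hτ => by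
        rw [e x hx]
        exact hM x (by simp; linarith) τ ⟨by linarith [hτ.1], by linarith [hτ.2]⟩
      have hd : ∀ x, ‖x‖ ≤ 3 → ∀ τ ∈ Ioo a c, ∀ σ ∈ Ioo a c,
          |V x τ - V x σ| ≤ C₂ * (τ - a) + C₂ * (σ - a) := fun x hx τ hτ σ hσ => by
        rw [e x hx, e x hx, ← sub_sub_sub_cancel_right _ _ (v x a)]
        exact (abs_sub _ _).trans (add_le_add (hcl x hx τ hτ) (hcl x hx σ hσ))
      have h3 := hsq V V' _ _ _ _ s₀ (h / 2) (t + h) P hVM (by linarith) (fun x hx => by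
        refine (hd x hx s₀ ⟨by linarith, by linarith⟩ _ ⟨by linarith, by linarith⟩).trans ?_
        rw [hs₀]; linarith) (by linarith) (by linarith) (by linarith) (by linarith)
      have h4 := hsh V V' _ _ _ _ (s₀ + h / 2) t h P hVM hh (by linarith) (by linarith)
        (by linarith) (by linarith) (fun x hx => by
          refine (hd x (hx.trans (by norm_num)) _ ⟨by linarith, by linarith⟩ _
            ⟨by linarith, by linarith⟩).trans ?_
          rw [hs₀]; linarith) h3
      rwa [e 0 (by simp), e 0 (by simp)] at h4
  have hder := S.der 0 (by simp) t ⟨ha.trans ht.1, ht.2.trans hc⟩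
  have hlim := hder.tendsto_slope_zero_right.abs
  refine le_of_tendsto hlim ?_
  have hev : Ioo 0 (min ((t - a) / 2) (c - t)) ∈ 𝓝[>] (0 : ℝ) :=
    Ioo_mem_nhdsGT (lt_min (by linarith [ht.1]) (by linarith [ht.2]))
  filter_upwards [hev] with h hh
  rw [smul_eq_mul, abs_mul, abs_inv, abs_of_pos hh.1, inv_mul_le_iff₀ hh.1, mul_comm]
  exact key h hh.1 (hh.2.trans_le (min_le_left _ _)) (hh.2.trans_le (min_le_right _ _))

lemma LSol.locBdd_of_forall_or {p : ℝ} (hp : 1 < p) {v v' : E2 → ℝ → ℝ} {M m : ℝ}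
    (S : LSol p (Metric.ball 0 8) (-1) 1 v v')
    (hM : ∀ x ∈ Metric.ball (0 : E2) 8, ∀ t ∈ Ioo (-1 : ℝ) 1, v x t ≤ M)
    (h : ∀ t ∈ Ioo (-1 : ℝ) 1, (∀ x ∈ Metric.ball (0 : E2) 8, |v' x t| ≤ m) ∨
      ∀ x ∈ Metric.ball (0 : E2) 8, LocBdd v v' x t) : LocBdd v v' 0 0 := by
  have hcb : Metric.closedBall (0 : E2) (15 / 2) ⊆ Metric.ball 0 8 :=
    Metric.closedBall_subset_ball (by norm_num)
  obtain ⟨m₁, hm₁⟩ := (isCompact_closedBall (0 : E2) (15 / 2)).exists_bound_of_continuousOn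
    ((S.continuousOn_deriv hp Metric.isOpen_ball (t := -1 / 2)
      ⟨by norm_num, by norm_num⟩).mono hcb)
  obtain ⟨m₂, h1, h2⟩ : ∃ m₂, m ≤ m₂ ∧ m₁ ≤ m₂ := ⟨_, le_max_left _ _, le_max_right _ _⟩
  have hm₂ : 0 ≤ m₂ := ((norm_nonneg _).trans (hm₁ 0 (by simp; norm_num))).trans h2
  have hM0 : 0 ≤ M := (S.nonneg 0 (by simp) 0 (by simp)).trans (hM 0 (by simp) 0 (by simp))
  obtain ⟨C, hC, hgap⟩ := exists_abs_deriv_le_of_gap hp hM0 hm₂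
  have hI : Icc (-1 / 2 : ℝ) (1 / 2) ⊆ Ioo (-1) 1 := fun t ht =>
    ⟨by linarith [ht.1], by linarith [ht.2]⟩
  obtain ⟨F, hF⟩ : ∃ F : Set ℝ, F = {t ∈ Icc (-1 / 2 : ℝ) (1 / 2) |
    ∀ x ∈ Metric.closedBall (0 : E2) (15 / 2), |v' x t| ≤ m₂} := ⟨_, rfl⟩
  have hFc : IsClosed F := by
    have : F = ⋂ x ∈ Metric.closedBall (0 : E2) (15 / 2),
        Icc (-1 / 2 : ℝ) (1 / 2) ∩ {t | |v' x t| ≤ m₂} := by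
      rw [hF]
      ext t
      simp only [mem_iInter, mem_inter_iff, mem_ofPred_eq]
      exact ⟨fun h x hx => ⟨h.1, h.2 x hx⟩,
        fun h => ⟨(h 0 (by simp; norm_num)).1, fun x hx => (h x hx).2⟩⟩
    rw [this]
    refine isClosed_biInter fun x hx => ?_
    exact ((S.ct x (hcb hx)).mono hI).abs.preimage_isClosed_of_isClosed isClosed_Icc isClosed_Iic
  have hs₀ : (-1 / 2 : ℝ) ∈ F := by
    rw [hF]
    exact ⟨⟨le_rfl, by norm_num⟩, fun x hx => (hm₁ x hx).trans h2⟩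
  have key : ∀ x : E2, ‖x‖ < 1 / 2 → ∀ t ∈ Ioo (-1 / 2 : ℝ) (1 / 2), |v' x t| ≤ max m₂ C :=
    fun x hx t ht => by
      by_cases htF : t ∈ F
      · rw [hF] at htF
        exact (htF.2 x (by simp; linarith)).trans (le_max_left _ _)
      obtain ⟨a, ⟨haF, hat⟩, hmax⟩ := (isCompact_Icc.inter_left hFc :
        IsCompact (F ∩ Icc (-1 / 2) t)).exists_isGreatest ⟨_, hs₀, le_rfl, ht.1.le⟩
      have hat' : a < t := lt_of_le_of_ne hat.2 fun h => htF (h ▸ haF)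
      obtain ⟨ε, hε, hball⟩ := Metric.isOpen_iff.1 hFc.isOpen_compl t htF
      have hgapF : ∀ σ ∈ Ioo a (min (t + ε) (1 / 2)), σ ∉ F := fun σ hσ hσF => by
        rcases le_total σ t with h | h
        · have := hmax ⟨hσF, hat.1.trans hσ.1.le, h⟩
          linarith [hσ.1]
        · refine hball ?_ hσF
          rw [Metric.mem_ball, Real.dist_eq, abs_of_nonneg (by linarith)]
          linarith [hσ.2.trans_le (min_le_left _ _)]
      have hmem : ∀ y ∈ Metric.ball (0 : E2) 7, x + y ∈ Metric.closedBall (0 : E2) (15 / 2) :=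
        fun y hy => by
          rw [mem_ball_zero_iff] at hy
          rw [mem_closedBall_zero_iff]
          have := norm_add_le x y
          linarith
      have hFa := haF
      rw [hF] at hFa
      have := hgap _ _ a (min (t + ε) (1 / 2)) (S.translate hp x (Ω' := Metric.ball 0 7)
        fun y hy => hcb (hmem y hy)) (by linarith [hat.1])
        ((min_le_right _ _).trans_lt (by norm_num))
        ((min_le_right _ _).trans (by linarith [hat.1]))
        (fun y hy s hs => hM _ (hcb (hmem y hy)) s hs) (fun y hy => hFa.2 _ (hmem y hy))
        (fun y hy s hs => ?_) t ⟨hat', lt_min (by linarith) ht.2⟩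
      · simp only [add_zero] at this
        exact this.trans (le_max_right _ _)
      · have hsI : s ∈ Icc (-1 / 2 : ℝ) (1 / 2) :=
          ⟨hat.1.trans hs.1.le, (hs.2.trans_le (min_le_right _ _)).le⟩
        have hL : LocBdd v v' (x + y) s := by
          refine ((h s (hI hsI)).resolve_left fun h' => hgapF s hs ?_) _ (hcb (hmem y hy))
          rw [hF]
          exact ⟨hsI, fun z hz => (h' z (hcb hz)).trans h1⟩
        simpa using (show LocBdd v v' (x + (1 : ℝ) • y) (0 + 1 * s) by
          simpa using hL).comp_affine 1 1
  refine ⟨max M (max m₂ C), ?_⟩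
  have hn : Metric.ball (0 : E2) (1 / 2) ×ˢ Ioo (-1 / 2 : ℝ) (1 / 2) ∈ 𝓝 ((0 : E2), (0 : ℝ)) :=
    prod_mem_nhds (Metric.ball_mem_nhds _ (by norm_num)) (Ioo_mem_nhds (by norm_num) (by norm_num))
  filter_upwards [hn] with q hq
  have hx8 : q.1 ∈ Metric.ball (0 : E2) 8 := Metric.ball_subset_ball (by norm_num) hq.1
  have hq2 := hI (Ioo_subset_Icc_self hq.2)
  rw [abs_of_nonneg (S.nonneg _ hx8 _ hq2)]
  exact ⟨(hM _ hx8 _ hq2).trans (le_max_left _ _),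
    (key q.1 (by simpa using hq.1) q.2 hq.2).trans (le_max_right _ _)⟩

lemma LocBdd.of_comp_affine {u u' : E2 → ℝ → ℝ} {x₀ : E2} {t₀ l k c c' : ℝ} (hl : l ≠ 0)
    (hk : k ≠ 0) (hc : c ≠ 0) (hc' : c' ≠ 0)
    (h : LocBdd (fun y s => c * u (x₀ + l • y) (t₀ + k * s))
      (fun y s => c' * u' (x₀ + l • y) (t₀ + k * s)) 0 0) : LocBdd u u' x₀ t₀ := by
  have e1 : ∀ y : E2, x₀ + l • (-(l⁻¹ • x₀) + l⁻¹ • y) = y := fun y => by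
    rw [smul_add, smul_neg, smul_inv_smul₀ hl, smul_inv_smul₀ hl]; abel
  have e2 : ∀ s : ℝ, t₀ + k * (-(k⁻¹ * t₀) + k⁻¹ * s) = s := fun s => by field_simp; ring
  have h2 := LocBdd.comp_affine (x₀ := -(l⁻¹ • x₀)) (t₀ := -(k⁻¹ * t₀)) (l := l⁻¹) (k := k⁻¹)
    (y := x₀) (s := t₀) c⁻¹ c'⁻¹ (by simpa using h)
  simpa only [e1, e2, inv_mul_cancel_left₀ hc, inv_mul_cancel_left₀ hc'] using h2

lemma LSol.locBdd_zero_of_locBdd_or {p : ℝ} (hp : 1 < p) {u u' : E2 → ℝ → ℝ} {m : ℝ}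
    (S : LSol p (Metric.ball 0 16) (-256) 256 u u')
    (h0 : ∀ s ∈ Ioo (-256 : ℝ) 256, u 0 s ≤ m)
    (h : ∀ x ∈ Metric.ball (0 : E2) 16, ∀ t ∈ Ioo (-256 : ℝ) 256, LocBdd u u' x t ∨
      ((∀ s ∈ Ioo (-256 : ℝ) 256, u x s ≤ m) ∧
        ∀ y ∈ Metric.ball (0 : E2) 16, u y t ≤ m ∧ |u' y t| ≤ m)) :
    LocBdd u u' 0 0 := by
  obtain ⟨K, hK⟩ := S.exists_le_of_locBdd_or hp h0 fun x hx t ht =>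
    (h x hx t ht).imp id fun h => ⟨h.1, fun y hy => (h.2 y hy).1⟩
  obtain ⟨κ, hκ⟩ : ∃ κ : ℝ, κ = (1 / 8 : ℝ) ^ (2 * (1 / (p - 1))) := ⟨_, rfl⟩
  have hκ0 : 0 < κ := by rw [hκ]; positivity
  have hx : ∀ y ∈ Metric.ball (0 : E2) 8, (0 : E2) + (1 / 8 : ℝ) • y ∈ Metric.ball (0 : E2) 1 := by
    intro y hy
    rw [mem_ball_zero_iff] at hy ⊢
    rw [zero_add, norm_smul]
    norm_num
    linarith
  have ht : ∀ s ∈ Ioo (-1 : ℝ) 1, 0 + (1 / 8 : ℝ) ^ 2 * s ∈ Ioo (-128 : ℝ) 128 := by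
    rintro s ⟨h1, h2⟩
    constructor <;> linarith
  have hx' : ∀ y ∈ Metric.ball (0 : E2) 8, (0 : E2) + (1 / 8 : ℝ) • y ∈ Metric.ball (0 : E2) 16 :=
    fun y hy => Metric.ball_subset_ball (by norm_num) (hx y hy)
  have ht' : ∀ s ∈ Ioo (-1 : ℝ) 1, 0 + (1 / 8 : ℝ) ^ 2 * s ∈ Ioo (-256 : ℝ) 256 :=
    fun s hs => Ioo_subset_Ioo (by norm_num) (by norm_num) (ht s hs)
  have S' := S.rescale hp (l := 1 / 8) (by norm_num) 0 0 hx' ht'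
  rw [← hκ] at S'
  refine LocBdd.of_comp_affine (l := 1 / 8) (k := (1 / 8) ^ 2) (c := κ) (c' := κ * (1 / 8) ^ 2)
    (by norm_num) (by norm_num) hκ0.ne' (by positivity) ?_
  refine S'.locBdd_of_forall_or hp (M := κ * K) (m := κ * (1 / 8) ^ 2 * m)
    (fun x hxx t htt => mul_le_mul_of_nonneg_left (hK _ (hx x hxx) _ (ht t htt)) hκ0.le)
    fun t htt => ?_
  by_cases hb : ∀ x ∈ Metric.ball (0 : E2) 8,
      LocBdd u u' (0 + (1 / 8 : ℝ) • x) (0 + (1 / 8 : ℝ) ^ 2 * t)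
  · exact Or.inr fun x hxx => (hb x hxx).comp_affine _ _
  · left
    push Not at hb
    obtain ⟨x, hxx, hn⟩ := hb
    have h2 := ((h _ (hx' x hxx) _ (ht' t htt)).resolve_left hn).2
    intro y hy
    rw [abs_mul, abs_of_pos (by positivity : 0 < κ * (1 / 8 : ℝ) ^ 2)]
    exact mul_le_mul_of_nonneg_left (h2 _ (hx' y hy)).2 (by positivity)

lemma isOpen_setOf_locBdd (u u' : E2 → ℝ → ℝ) : IsOpen {q : E2 × ℝ | LocBdd u u' q.1 q.2} := by
  rw [isOpen_iff_mem_nhds]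
  rintro q ⟨M, hM⟩
  filter_upwards [eventually_eventually_nhds.2 hM] with r hr using ⟨M, hr⟩

/-- The rescaled form of `LSol.locBdd_zero_of_locBdd_or`. -/
lemma LSol.locBdd_center_of_locBdd_or {p : ℝ} (hp : 1 < p) {u u' : E2 → ℝ → ℝ} {m ρ : ℝ}
    {x₀ : E2} {t₀ : ℝ} (hρ : 0 < ρ)
    (S : LSol p (Metric.ball x₀ ρ) (t₀ - ρ ^ 2) (t₀ + ρ ^ 2) u u')
    (h0 : ∀ s ∈ Ioo (t₀ - ρ ^ 2) (t₀ + ρ ^ 2), u x₀ s ≤ m)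
    (h : ∀ x ∈ Metric.ball x₀ ρ, ∀ t ∈ Ioo (t₀ - ρ ^ 2) (t₀ + ρ ^ 2), LocBdd u u' x t ∨
      ((∀ s ∈ Ioo (t₀ - ρ ^ 2) (t₀ + ρ ^ 2), u x s ≤ m) ∧
        ∀ y ∈ Metric.ball x₀ ρ, u y t ≤ m ∧ |u' y t| ≤ m)) :
    LocBdd u u' x₀ t₀ := by
  obtain ⟨l, hl⟩ : ∃ l, l = ρ / 16 := ⟨_, rfl⟩
  have hl0 : 0 < l := by rw [hl]; positivity
  obtain ⟨κ, hκ⟩ : ∃ κ : ℝ, κ = l ^ (2 * (1 / (p - 1))) := ⟨_, rfl⟩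
  have hκ0 : 0 < κ := by rw [hκ]; positivity
  have hx : ∀ y ∈ Metric.ball (0 : E2) 16, x₀ + l • y ∈ Metric.ball x₀ ρ := by
    intro y hy
    rw [mem_ball_zero_iff] at hy
    rw [Metric.mem_ball, dist_eq_norm, add_sub_cancel_left, norm_smul, Real.norm_of_nonneg hl0.le]
    calc l * ‖y‖ < l * 16 := by gcongr
      _ = ρ := by rw [hl]; ring
  have ht : ∀ s ∈ Ioo (-256 : ℝ) 256, t₀ + l ^ 2 * s ∈ Ioo (t₀ - ρ ^ 2) (t₀ + ρ ^ 2) := by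
    rintro s ⟨h1, h2⟩
    have e : ρ ^ 2 = l ^ 2 * 256 := by rw [hl]; ring
    have : 0 < l ^ 2 := by positivity
    rw [e]
    constructor <;> nlinarith
  have S' := S.rescale hp hl0 x₀ t₀ hx ht
  rw [← hκ] at S'
  obtain ⟨m', hm1, hm2⟩ : ∃ m', κ * m ≤ m' ∧ κ * l ^ 2 * m ≤ m' :=
    ⟨_, le_max_left _ _, le_max_right _ _⟩
  refine LocBdd.of_comp_affine (l := l) (k := l ^ 2) (c := κ) (c' := κ * l ^ 2)
    hl0.ne' (by positivity) hκ0.ne' (by positivity) ?_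
  refine S'.locBdd_zero_of_locBdd_or hp (m := m') (fun s hs => ?_) fun x hxx t htt => ?_
  · simp only [smul_zero, add_zero]
    exact (mul_le_mul_of_nonneg_left (h0 _ (ht s hs)) hκ0.le).trans hm1
  · refine (h _ (hx x hxx) _ (ht t htt)).imp (fun hL => hL.comp_affine _ _) fun h2 => ⟨?_, ?_⟩
    · exact fun s hs => (mul_le_mul_of_nonneg_left (h2.1 _ (ht s hs)) hκ0.le).trans hm1
    · refine fun y hy => ⟨(mul_le_mul_of_nonneg_left (h2.2 _ (hx y hy)).1 hκ0.le).trans hm1, ?_⟩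
      rw [abs_mul, abs_of_pos (by positivity : 0 < κ * l ^ 2)]
      exact (mul_le_mul_of_nonneg_left (h2.2 _ (hx y hy)).2 (by positivity)).trans hm2

/-- A classical solution is locally bounded, together with its time derivative. -/
lemma LSol.locBdd {p : ℝ} (hp : 1 < p) {Ω : Set E2} (hΩ : IsOpen Ω) {a b : ℝ}
    {u u' : E2 → ℝ → ℝ} (S : LSol p Ω a b u u') {x : E2} (hx : x ∈ Ω) {t : ℝ} (ht : t ∈ Ioo a b) :
    LocBdd u u' x t := by
  by_contra hn
  obtain ⟨D, hD⟩ : ∃ D : Set (E2 × ℝ), D = Ω ×ˢ Ioo a b := ⟨_, rfl⟩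
  have hDo : IsOpen D := by rw [hD]; exact hΩ.prod isOpen_Ioo
  obtain ⟨F, hF⟩ : ∃ F : Set (E2 × ℝ), F = D ∩ {q : E2 × ℝ | LocBdd u u' q.1 q.2}ᶜ := ⟨_, rfl⟩
  have hFl : IsLocallyClosed F :=
    ⟨D, _, hDo, (isOpen_setOf_locBdd u u').isClosed_compl, hF⟩
  have hFq : ∀ q ∈ F, q ∈ D ∧ ¬ LocBdd u u' q.1 q.2 := by rw [hF]; exact fun q hq => hq
  have : LocallyCompactSpace F := hFl.locallyCompactSpace
  have hFm : ∀ q : F, q.1.1 ∈ Ω ∧ q.1.2 ∈ Ioo a b := fun q => by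
    have : q.1 ∈ D := (hFq q.1 q.2).1
    rw [hD] at this
    exact this
  have : Nonempty F := ⟨⟨(x, t), by rw [hF, hD]; exact ⟨⟨hx, ht⟩, hn⟩⟩⟩
  let A : ℕ → Set F := fun n => {q | (∀ y ∈ Ω, y ∈ Metric.ball q.1.1 (1 / ((n : ℝ) + 1)) →
      u y q.1.2 ≤ n ∧ |u' y q.1.2| ≤ n) ∧
    ∀ s ∈ Ioo a b, |s - q.1.2| < 1 / ((n : ℝ) + 1) → u q.1.1 s ≤ n}
  have hc1 : Continuous fun q : F => q.1.1 := continuous_fst.comp continuous_subtype_val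
  have hc2 : Continuous fun q : F => q.1.2 := continuous_snd.comp continuous_subtype_val
  have hAc : ∀ n, IsClosed (A n) := by
    intro n
    have e : A n = (⋂ y ∈ Ω, {q : F | y ∈ Metric.ball q.1.1 (1 / ((n : ℝ) + 1)) →
        u y q.1.2 ≤ n ∧ |u' y q.1.2| ≤ n}) ∩ ⋂ s ∈ Ioo a b,
        {q : F | |s - q.1.2| < 1 / ((n : ℝ) + 1) → u q.1.1 s ≤ n} := by
      ext q
      simp only [A, mem_inter_iff, mem_iInter, mem_ofPred_eq]
    rw [e]
    refine IsClosed.inter (isClosed_biInter fun y hy => isClosed_imp ?_ ?_)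
      (isClosed_biInter fun s hs => isClosed_imp ?_ ?_)
    · exact isOpen_lt (continuous_const.dist hc1) continuous_const
    · have h1 : Continuous fun q : F => u y q.1.2 :=
        ContinuousOn.comp_continuous (fun t ht => (S.der y hy t ht).continuousAt.continuousWithinAt)
          hc2 fun q => (hFm q).2
      have h2 : Continuous fun q : F => u' y q.1.2 :=
        (S.ct y hy).comp_continuous hc2 fun q => (hFm q).2
      exact (isClosed_le h1 continuous_const).inter (isClosed_le h2.abs continuous_const)
    · exact isOpen_lt (continuous_const.sub hc2).abs continuous_const
    · exact isClosed_le ((S.c2 s hs).continuousOn.comp_continuous hc1 fun q => (hFm q).1)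
        continuous_const
  have hAu : ⋃ n, A n = univ := by
    refine eq_univ_of_forall fun q => ?_
    obtain ⟨hq1, hq2⟩ := hFm q
    obtain ⟨δ, hδ, hball⟩ := Metric.nhds_basis_closedBall.mem_iff.1 (hΩ.mem_nhds hq1)
    obtain ⟨η, hη, hI⟩ := Metric.nhds_basis_closedBall.mem_iff.1 (isOpen_Ioo.mem_nhds hq2)
    obtain ⟨M₁, h1⟩ := (isCompact_closedBall q.1.1 δ).exists_bound_of_continuousOn
      ((S.c2 _ hq2).continuousOn.mono hball)
    obtain ⟨M₂, h2⟩ := (isCompact_closedBall q.1.1 δ).exists_bound_of_continuousOn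
      ((S.continuousOn_deriv hp hΩ hq2).mono hball)
    obtain ⟨M₃, h3⟩ := (isCompact_closedBall q.1.2 η).exists_bound_of_continuousOn
      (f := u q.1.1) (fun t ht => (S.der _ hq1 t (hI ht)).continuousAt.continuousWithinAt)
    obtain ⟨n, hn⟩ := exists_nat_ge (max (max M₁ M₂) (max M₃ (max (1 / δ) (1 / η))))
    simp only [max_le_iff] at hn
    obtain ⟨⟨n1, n2⟩, n3, n4, n5⟩ := hn
    have e1 : 1 / ((n : ℝ) + 1) ≤ δ := by
      rw [div_le_iff₀ hδ] at n4
      rw [div_le_iff₀ (by positivity)]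
      nlinarith
    have e2 : 1 / ((n : ℝ) + 1) ≤ η := by
      rw [div_le_iff₀ hη] at n5
      rw [div_le_iff₀ (by positivity)]
      nlinarith
    refine mem_iUnion.2 ⟨n, fun y _ hy => ?_, fun s _ hs => ?_⟩
    · have hy' := Metric.ball_subset_closedBall (Metric.ball_subset_ball e1 hy)
      exact ⟨(le_abs_self _).trans ((h1 y hy').trans n1), (h2 y hy').trans n2⟩
    · exact (le_abs_self _).trans ((h3 s (by
        rw [Metric.mem_closedBall, Real.dist_eq]; exact (hs.trans_le e2).le)).trans n3)
  obtain ⟨n, q, hq⟩ := nonempty_interior_of_iUnion_of_closed hAc hAu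
  obtain ⟨V, hV, hqV⟩ := mem_nhds_subtype F q _ |>.1 (mem_interior_iff_mem_nhds.1 hq)
  have hqD : q.1 ∈ D := by rw [hD]; exact hFm q
  obtain ⟨ε, hε, hball⟩ := Metric.mem_nhds_iff.1 (Filter.inter_mem hV (hDo.mem_nhds hqD))
  obtain ⟨ρ, hρ0, hρ1, hρε, hρn⟩ : ∃ ρ : ℝ, 0 < ρ ∧ ρ ≤ 1 ∧ ρ ≤ ε ∧
      2 * ρ ≤ 1 / ((n : ℝ) + 1) := by
    refine ⟨min 1 (min ε (1 / ((n : ℝ) + 1) / 2)), by positivity, min_le_left _ _,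
      (min_le_right _ _).trans (min_le_left _ _), ?_⟩
    have := (min_le_right (1 : ℝ) (min ε (1 / ((n : ℝ) + 1) / 2))).trans (min_le_right _ _)
    linarith
  have hρ2 : ρ ^ 2 ≤ ρ := by nlinarith
  have hbox : ∀ y ∈ Metric.ball q.1.1 ρ, ∀ s ∈ Ioo (q.1.2 - ρ ^ 2) (q.1.2 + ρ ^ 2),
      (y, s) ∈ V ∩ D := by
    intro y hy s hs
    refine hball ?_
    rw [Metric.mem_ball] at hy
    rw [Metric.mem_ball, Prod.dist_eq, max_lt_iff, Real.dist_eq, abs_lt]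
    exact ⟨hy.trans_le hρε, by linarith [hs.1], by linarith [hs.2]⟩
  have hcen : ∀ {s}, s ∈ Ioo (q.1.2 - ρ ^ 2) (q.1.2 + ρ ^ 2) → s ∈ Ioo a b := fun {s} hs => by
    have := (hbox q.1.1 (Metric.mem_ball_self hρ0) s hs).2
    rw [hD] at this
    exact this.2
  have hcen' : ∀ {y}, y ∈ Metric.ball q.1.1 ρ → y ∈ Ω := fun {y} hy => by
    have := (hbox y hy q.1.2 ⟨by nlinarith, by nlinarith⟩).2
    rw [hD] at this
    exact this.1
  have S' : LSol p (Metric.ball q.1.1 ρ) (q.1.2 - ρ ^ 2) (q.1.2 + ρ ^ 2) u u' :=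
    ⟨fun t ht => (S.c2 t (hcen ht)).mono fun y hy => hcen' hy,
      fun x hx t ht => S.der x (hcen' hx) t (hcen ht),
      fun x hx => (S.ct x (hcen' hx)).mono fun s hs => hcen hs,
      fun x hx t ht => S.nonneg x (hcen' hx) t (hcen ht),
      fun x hx t ht => S.eq x (hcen' hx) t (hcen ht)⟩
  refine (hFq q.1 q.2).2 (S'.locBdd_center_of_locBdd_or hp hρ0 (m := n)
    (fun s hs => ?_) fun y hy s hs => ?_)
  · refine (interior_subset hq).2 s (hcen hs) ?_
    rw [abs_lt]
    constructor <;> linarith [hs.1, hs.2]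
  · by_cases hL : LocBdd u u' y s
    · exact Or.inl hL
    right
    obtain ⟨g1, g2⟩ := hqV (show (⟨(y, s), by
      rw [hF]; exact ⟨(hbox y hy s hs).2, hL⟩⟩ : F) ∈ Subtype.val ⁻¹' V from (hbox y hy s hs).1)
    refine ⟨fun τ hτ => g2 τ (hcen hτ) ?_, fun z hz => g1 z (hcen' hz) ?_⟩
    · rw [abs_lt]
      constructor <;> simp only <;> linarith [hs.1, hs.2, hτ.1, hτ.2]
    · rw [Metric.mem_ball] at *
      have := dist_triangle_right z y q.1.1
      simp only
      linarith

/-- The universal bound in a parabolic cylinder, without any boundedness assumption. -/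
lemma exists_le_of_lsol {p : ℝ} (hp : 1 < p) : ∃ C > 0,
    ∀ (u u' : E2 → ℝ → ℝ) (r : ℝ) (x₀ : E2) (t₀ : ℝ), 0 < r →
    LSol p (Metric.ball x₀ r) (t₀ - r ^ 2) (t₀ + r ^ 2) u u' →
    u x₀ t₀ ≤ C * r ^ (-(2 * (1 / (p - 1)))) := by
  obtain ⟨C, hC, h⟩ := exists_cylinder_le hp
  refine ⟨C, hC, fun u u' r x₀ t₀ hr S => ?_⟩
  have key : ∀ r' ∈ Ioo 0 r, u x₀ t₀ ≤ C * r' ^ (-(2 * (1 / (p - 1)))) := by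
    rintro r' ⟨h1, h2⟩
    have hsq : r' ^ 2 < r ^ 2 := by gcongr
    obtain ⟨M, ε, hε, hM⟩ := exists_bound_of_locBdd (u := u) (u' := u') (x₀ := x₀) (r := r')
      (a := t₀ - r' ^ 2) (b := t₀ + r' ^ 2) (by nlinarith) fun x hx t ht =>
        S.locBdd hp Metric.isOpen_ball (Metric.closedBall_subset_ball h2 hx)
          ⟨by linarith [ht.1], by linarith [ht.2]⟩
    have hM' : ∀ x ∈ Metric.ball x₀ r', ∀ t ∈ Ioo (t₀ - r' ^ 2) (t₀ + r' ^ 2),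
        |u x t| ≤ M ∧ |u' x t| ≤ M := fun x hx t ht =>
      hM x (Metric.ball_subset_closedBall hx) t ⟨by linarith [ht.1], by linarith [ht.2]⟩
    exact h u u' M r' x₀ t₀ h1
      (S.mono (Metric.ball_subset_ball h2.le) (by linarith) (by linarith))
      (fun x hx t ht => (hM' x hx t ht).1) fun x hx t ht => (hM' x hx t ht).2
  have hc : ContinuousAt (fun r' : ℝ => C * r' ^ (-(2 * (1 / (p - 1))))) r :=
    continuousAt_const.mul (Real.continuousAt_rpow_const _ _ (Or.inl hr.ne'))
  refine ge_of_tendsto (hc.tendsto.mono_left (nhdsWithin_le_nhds (s := Iio r))) ?_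
  filter_upwards [Ioo_mem_nhdsLT hr] with r' hr' using key r' hr'

lemma exists_pos_rpow_neg_le {β ε : ℝ} (hβ : 0 < β) (hε : 0 < ε) :
    ∃ r > 0, r ^ (-β) ≤ ε := by
  refine ⟨ε ^ (-β⁻¹), by positivity, le_of_eq ?_⟩
  rw [← Real.rpow_mul hε.le, neg_mul_neg, inv_mul_cancel₀ hβ.ne', Real.rpow_one]

lemma sq_le_of_le_sqrt {r d : ℝ} (hr : 0 < r) (h : r ≤ √d) : r ^ 2 ≤ d :=
  (Real.le_sqrt' hr).1 h

lemma sqrt_rpow_two_mul {d β : ℝ} (hd : 0 < d) : √d ^ (-(2 * β)) = d ^ (-β) := by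
  rw [Real.sqrt_eq_rpow, ← Real.rpow_mul hd.le]
  congr 1
  ring

lemma ball_subset_of_le_infDist_frontier {Ω : Set E2} (hΩ : IsOpen Ω) {x : E2} (hx : x ∈ Ω)
    {r : ℝ} (hr : 0 < r) (h : r ≤ Metric.infDist x (frontier Ω)) : Metric.ball x r ⊆ Ω := by
  refine (convex_ball x r).isPreconnected.subset_left_of_subset_union hΩ
    (isClosed_closure (s := Ω)).isOpen_compl
    (disjoint_compl_right_iff_subset.2 subset_closure) (fun y hy => ?_)
    ⟨x, Metric.mem_ball_self hr, hx⟩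
  by_contra hn
  rw [mem_union, not_or, notMem_compl_iff] at hn
  have hf : y ∈ frontier Ω := by rw [hΩ.frontier_eq]; exact ⟨hn.2, hn.1⟩
  have := Metric.infDist_le_dist_of_mem (x := x) hf
  rw [Metric.mem_ball, dist_comm] at hy
  linarith

lemma exists_ball_subset_rpow_le {Ω : Set E2} (hΩ : IsOpen Ω) {x : E2} (hx : x ∈ Ω) {β ε : ℝ}
    (hβ : 0 < β) (hε : 0 < ε) : ∃ r₀ > 0, r₀ ^ (-β) ≤ Metric.infDist x (frontier Ω) ^ (-β) + ε ∧
      ∀ r, 0 < r → r ≤ r₀ → Metric.ball x r ⊆ Ω := by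
  rcases (frontier Ω).eq_empty_or_nonempty with h | h
  · obtain ⟨r₀, h1, h2⟩ := exists_pos_rpow_neg_le hβ hε
    have hu : Ω = univ := (frontier_eq_empty_iff.1 h).resolve_left (nonempty_iff_ne_empty.1 ⟨x, hx⟩)
    refine ⟨r₀, h1, h2.trans ?_, fun r _ _ => by simp [hu]⟩
    have : 0 ≤ Metric.infDist x (frontier Ω) ^ (-β) := Real.rpow_nonneg Metric.infDist_nonneg _
    linarith
  · have hd : 0 < Metric.infDist x (frontier Ω) :=
      (isClosed_frontier.notMem_iff_infDist_pos h).1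
        fun hf => by rw [hΩ.frontier_eq] at hf; exact hf.2 hx
    exact ⟨_, hd, by linarith, fun r h1 h2 => ball_subset_of_le_infDist_frontier hΩ hx h1 h2⟩

lemma exists_le_sub_sq_rpow_le {T : EReal} {t β ε : ℝ} (hT : T < (t : EReal)) (hβ : 0 < β)
    (hε : 0 < ε) : ∃ r₀ > 0, r₀ ^ (-(2 * β)) ≤ (if T = ⊥ then 0 else (t - T.toReal) ^ (-β)) + ε ∧
      ∀ r, 0 < r → r ≤ r₀ → T ≤ ((t - r ^ 2 : ℝ) : EReal) := by
  induction T with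
  | bot =>
    obtain ⟨r₀, h1, h2⟩ := exists_pos_rpow_neg_le (mul_pos two_pos hβ) hε
    exact ⟨r₀, h1, by simpa using h2, fun r _ _ => bot_le⟩
  | top => simp at hT
  | coe T =>
    have hd : 0 < t - T := sub_pos.2 (EReal.coe_lt_coe_iff.1 hT)
    refine ⟨√(t - T), Real.sqrt_pos.2 hd, ?_, fun r h1 h2 => ?_⟩
    · rw [sqrt_rpow_two_mul hd, if_neg (EReal.coe_ne_bot T), EReal.toReal_coe]
      linarith
    · rw [EReal.coe_le_coe_iff]
      linarith [sq_le_of_le_sqrt h1 h2]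

lemma exists_add_sq_le_rpow_le {T : EReal} {t β ε : ℝ} (hT : (t : EReal) < T) (hβ : 0 < β)
    (hε : 0 < ε) : ∃ r₀ > 0, r₀ ^ (-(2 * β)) ≤ (if T = ⊤ then 0 else (T.toReal - t) ^ (-β)) + ε ∧
      ∀ r, 0 < r → r ≤ r₀ → ((t + r ^ 2 : ℝ) : EReal) ≤ T := by
  induction T with
  | top =>
    obtain ⟨r₀, h1, h2⟩ := exists_pos_rpow_neg_le (mul_pos two_pos hβ) hε
    exact ⟨r₀, h1, by simpa using h2, fun r _ _ => le_top⟩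
  | bot => simp at hT
  | coe T =>
    have hd : 0 < T - t := sub_pos.2 (EReal.coe_lt_coe_iff.1 hT)
    refine ⟨√(T - t), Real.sqrt_pos.2 hd, ?_, fun r h1 h2 => ?_⟩
    · rw [sqrt_rpow_two_mul hd, if_neg (EReal.coe_ne_top T), EReal.toReal_coe]
      linarith
    · rw [EReal.coe_le_coe_iff]
      linarith [sq_le_of_le_sqrt h1 h2]

lemma rpow_neg_min_le {a b β : ℝ} (ha : 0 < a) (hb : 0 < b) :
    (min a b) ^ (-β) ≤ a ^ (-β) + b ^ (-β) := by
  have h1 : 0 < a ^ (-β) := by positivity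
  have h2 : 0 < b ^ (-β) := by positivity
  rcases min_choice a b with h | h <;> rw [h] <;> linarith

/-- Universal a priori bound for nonnegative classical solutions of
`∂ₜ u = Δu + u^p` in `Ω × (T₁,T₂)`, `Ω ⊆ ℝ²`. The constant `C` depends only on
`p`, not on `Ω`, `T₁`, `T₂` or `u`. -/
theorem universal_bound_pow
    (p : ℝ) (hp : 1 < p) :
    ∃ C > 0, ∀ (Ω : Set (EuclideanSpace ℝ (Fin 2))), IsOpen Ω → Ω.Nonempty →
      ∀ T₁ T₂ : EReal, T₁ < T₂ →
      ∀ u : EuclideanSpace ℝ (Fin 2) × ℝ → ℝ,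
        (∀ t : ℝ, T₁ < (t : EReal) → (t : EReal) < T₂ →
          ContDiffOn ℝ 2 (fun x => u (x, t)) Ω) →
        (∀ x ∈ Ω, ContDiffOn ℝ 1 (fun t => u (x, t))
          {t : ℝ | T₁ < (t : EReal) ∧ (t : EReal) < T₂}) →
        (∀ x ∈ Ω, ∀ t : ℝ, T₁ < (t : EReal) → (t : EReal) < T₂ → 0 ≤ u (x, t)) →
        (∀ x ∈ Ω, ∀ t : ℝ, T₁ < (t : EReal) → (t : EReal) < T₂ →
          deriv (fun s => u (x, s)) t
            = lap (fun y => u (y, t)) x + u (x, t) ^ p) →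
        ∀ x ∈ Ω, ∀ t : ℝ, T₁ < (t : EReal) → (t : EReal) < T₂ →
          u (x, t) ≤ C * (
            (if T₁ = ⊥ then 0 else (t - T₁.toReal) ^ (-(1 / (p - 1))))
            + (if T₂ = ⊤ then 0 else (T₂.toReal - t) ^ (-(1 / (p - 1))))
            + Metric.infDist x (frontier Ω) ^ (-(2 * (1 / (p - 1))))) := by
  obtain ⟨C, hC, hbound⟩ := exists_le_of_lsol hp
  refine ⟨C, hC, fun Ω hΩ _ T₁ T₂ _ u hx2 ht1 hnn heq x hx t hT₁ hT₂ => ?_⟩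
  have hβ : 0 < 1 / (p - 1) := one_div_pos.2 (sub_pos.2 hp)
  have hTo : IsOpen {t : ℝ | T₁ < (t : EReal) ∧ (t : EReal) < T₂} :=
    (isOpen_Ioo (a := T₁) (b := T₂)).preimage continuous_coe_real_ereal
  refine le_of_forall_pos_le_add fun ε hε => ?_
  obtain ⟨δ, hδ, hδε⟩ : ∃ δ > 0, C * (3 * δ) = ε :=
    ⟨ε / (3 * C), by positivity, by field_simp⟩
  obtain ⟨r₁, hr₁, hg₁, h₁⟩ := exists_le_sub_sq_rpow_le hT₁ hβ hδ
  obtain ⟨r₂, hr₂, hg₂, h₂⟩ := exists_add_sq_le_rpow_le hT₂ hβ hδ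
  obtain ⟨r₃, hr₃, hg₃, h₃⟩ := exists_ball_subset_rpow_le hΩ hx (mul_pos two_pos hβ) hδ
  obtain ⟨r, hr⟩ : ∃ r, r = min (min r₁ r₂) r₃ := ⟨_, rfl⟩
  have hr0 : 0 < r := by rw [hr]; positivity
  have hrr : r ^ (-(2 * (1 / (p - 1)))) ≤ r₁ ^ (-(2 * (1 / (p - 1))))
      + r₂ ^ (-(2 * (1 / (p - 1)))) + r₃ ^ (-(2 * (1 / (p - 1)))) := by
    rw [hr]
    have e1 := rpow_neg_min_le (β := 2 * (1 / (p - 1))) (lt_min hr₁ hr₂) hr₃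
    have e2 := rpow_neg_min_le (β := 2 * (1 / (p - 1))) hr₁ hr₂
    linarith
  have hrle : r ≤ r₁ ∧ r ≤ r₂ ∧ r ≤ r₃ := by
    rw [hr]
    exact ⟨(min_le_left _ _).trans (min_le_left _ _), (min_le_left _ _).trans (min_le_right _ _),
      min_le_right _ _⟩
  have hball := h₃ r hr0 hrle.2.2
  have hI : ∀ s ∈ Ioo (t - r ^ 2) (t + r ^ 2), T₁ < (s : EReal) ∧ (s : EReal) < T₂ := fun s hs =>
    ⟨(h₁ r hr0 hrle.1).trans_lt (EReal.coe_lt_coe_iff.2 hs.1),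
      (EReal.coe_lt_coe_iff.2 hs.2).trans_le (h₂ r hr0 hrle.2.1)⟩
  have S : LSol p (Metric.ball x r) (t - r ^ 2) (t + r ^ 2) (fun y s => u (y, s))
      (fun y s => deriv (fun s => u (y, s)) s) := by
    refine ⟨fun s hs => (hx2 s (hI s hs).1 (hI s hs).2).mono hball, fun y hy s hs => ?_,
      fun y hy => ?_, fun y hy s hs => hnn y (hball hy) s (hI s hs).1 (hI s hs).2,
      fun y hy s hs => heq y (hball hy) s (hI s hs).1 (hI s hs).2⟩
    · exact (((ht1 y (hball hy)).contDiffAt (hTo.mem_nhds (hI s hs))).differentiableAt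
        (by norm_num)).hasDerivAt
    · exact ((ht1 y (hball hy)).continuousOn_deriv_of_isOpen hTo le_rfl).mono hI
  calc u (x, t) ≤ C * r ^ (-(2 * (1 / (p - 1)))) := hbound _ _ r x t hr0 S
    _ ≤ C * (r₁ ^ (-(2 * (1 / (p - 1)))) + r₂ ^ (-(2 * (1 / (p - 1))))
        + r₃ ^ (-(2 * (1 / (p - 1))))) := mul_le_mul_of_nonneg_left hrr hC.le
    _ ≤ C * (((if T₁ = ⊥ then 0 else (t - T₁.toReal) ^ (-(1 / (p - 1)))) + δ)
        + ((if T₂ = ⊤ then 0 else (T₂.toReal - t) ^ (-(1 / (p - 1)))) + δ)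
        + (Metric.infDist x (frontier Ω) ^ (-(2 * (1 / (p - 1)))) + δ)) := by gcongr
    _ = _ := by rw [← hδε]; ring
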